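/- Let q be a prime power, let d be a positive integer coprime to q, let n_0 be a positive integer and let g ∈ GL(n_0, F_q). Then the proportion of irreducible complex characters χ of GL(n, F_q) such that d divides χ(g) tends to 1 as n → ∞; that is, lim_{n→∞} #{χ ∈ Irr(GL(n,q)) : d divides χ(g)} / |Irr(GL(n,q))| = 1. -/

import Mathlib

open Matrix

noncomputable def blockOneHom (F : Type*) [Field F] (n₀ n : ℕ) (h : n₀ ≤ n) :
    Matrix (Fin n₀) (Fin n₀) F →* Matrix (Fin n) (Fin n) F :=
  (Matrix.reindexAlgEquiv F F
      ((finSumFinEquiv (m := n₀) (n := n - n₀)).trans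
        (finCongr (Nat.add_sub_cancel' h)))).toAlgHom.toMonoidHom.comp
    { toFun := fun A => Matrix.fromBlocks A 0 0 (1 : Matrix (Fin (n - n₀)) (Fin (n - n₀)) F)
      map_one' := by simp [Matrix.fromBlocks_one]
      map_mul' := fun A B => by
        simp [Matrix.fromBlocks_multiply] }

noncomputable def glEmbed {F : Type*} [Field F] {n₀ n : ℕ} (h : n₀ ≤ n) :
    GL (Fin n₀) F →* GL (Fin n) F :=
  Units.map (blockOneHom F n₀ n h)

def IsIrrChar (G : Type) [Group G] (f : G → ℂ) : Prop :=
  ∃ V : FDRep ℂ G, CategoryTheory.Simple V ∧ FDRep.character V = f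

/-- `d` divides the algebraic number `z`, i.e. `z / d` is an algebraic integer. -/
def NatDvdAlg (d : ℕ) (z : ℂ) : Prop := IsIntegral ℤ (z / (d : ℂ))
set_option linter.unusedSectionVars false
set_option linter.style.haveILetI false

section PartA
variable {G : Type} [Group G] [Fintype G]

/-- characters of finite-dimensional representations -/
def IsChr (G : Type) [Group G] (f : G → ℂ) : Prop :=
  ∃ V : FDRep ℂ G, FDRep.character V = f

def IsCl (f : G → ℂ) : Prop := ∀ g h : G, f (h * g * h⁻¹) = f g

theorem IsIrrChar.isChr {f : G → ℂ} (h : IsIrrChar G f) : IsChr G f := by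
  obtain ⟨V, _, hV⟩ := h; exact ⟨V, hV⟩

theorem IsChr.isCl {f : G → ℂ} (h : IsChr G f) : IsCl f := by
  obtain ⟨V, rfl⟩ := h; intro g h; simp

theorem cardC_ne : (Nat.card G : ℂ) ≠ 0 := by
  exact_mod_cast Nat.card_pos.ne'

theorem IsChr.pair_nat {f h : G → ℂ} (hf : IsChr G f) (hh : IsChr G h) :
    ∃ n : ℕ, (Nat.card G : ℂ)⁻¹ * ∑ g, f g * h g⁻¹ = n := by
  obtain ⟨V, rfl⟩ := hf
  obtain ⟨W, rfl⟩ := hh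
  haveI := invertibleOfNonzero (cardC_ne (G := G))
  exact ⟨_, FDRep.scalar_product_char_eq_finrank_equivariant W V⟩

open Classical in
theorem IsIrrChar.orth {f h : G → ℂ} (hf : IsIrrChar G f) (hh : IsIrrChar G h) :
    ∑ g, f g * h g⁻¹ = if f = h then (Nat.card G : ℂ) else 0 := by
  obtain ⟨V, _, rfl⟩ := hf
  obtain ⟨W, _, rfl⟩ := hh
  haveI := invertibleOfNonzero (cardC_ne (G := G))
  have h1 := FDRep.char_orthonormal V W
  have h2 := FDRep.char_orthonormal V V
  rw [inv_mul_eq_iff_eq_mul₀ cardC_ne] at h1 h2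
  by_cases e : V.character = W.character
  · rw [if_pos e, ← e, h2, if_pos ⟨CategoryTheory.Iso.refl V⟩]; simp
  · rw [if_neg e, h1, if_neg]; · simp
    rintro ⟨i⟩
    exact e (FDRep.char_iso i)

theorem isIrrChar_of_irr {V : Type} [AddCommGroup V] [Module ℂ V] [FiniteDimensional ℂ V]
    (ρ : Representation ℂ G V) (hρ : ρ.IsIrreducible) : IsIrrChar G ρ.character := by
  haveI := invertibleOfNonzero (cardC_ne (G := G))
  refine ⟨FDRep.of ρ, ?_, rfl⟩
  rw [FDRep.simple_iff_char_is_norm_one]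
  have := Representation.char_orthonormal ρ ρ
  rw [inv_mul_eq_iff_eq_mul₀ cardC_ne, if_pos ⟨Representation.Equiv.refl ρ⟩] at this
  have h2 : ∑ g, (FDRep.of ρ).character g * (FDRep.of ρ).character g⁻¹ =
    ∑ g, ρ.character g * ρ.character g⁻¹ := rfl
  rw [h2]
  simpa using this

theorem isChr_of_rep {V : Type} [AddCommGroup V] [Module ℂ V] [FiniteDimensional ℂ V]
    (ρ : Representation ℂ G V)  : IsChr G ρ.character := ⟨FDRep.of ρ, rfl⟩

theorem irr_op_zero {V : Type} [AddCommGroup V] [Module ℂ V] [FiniteDimensional ℂ V]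
    (ρ : Representation ℂ G V) (hρ : IsIrrChar G ρ.character) (f : G → ℂ) (hf : IsCl f)
    : ∃ c : ℂ, ∑ g, f g • ρ g⁻¹ = c • LinearMap.id ∧
      c * Module.finrank ℂ V = ∑ g, f g * ρ.character g⁻¹ := by
  let T : Representation.IntertwiningMap ρ ρ := 
    ⟨∑ g, f g • ρ g⁻¹, by
      intro h
      simp only [← Module.End.mul_eq_comp, Finset.sum_mul, Finset.mul_sum, smul_mul_assoc, mul_smul_comm]
      refine Fintype.sum_equiv (MulAut.conj h⁻¹).toEquiv _ _ fun g => ?_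
      have : f ((MulAut.conj h⁻¹) g) = f g := by simpa using hf g h⁻¹
      simp only [MulEquiv.toEquiv_eq_coe, EquivLike.coe_coe, this]
      rw [← map_mul, ← map_mul]
      simp [mul_assoc]⟩
  have hfr : Module.finrank ℂ (Representation.IntertwiningMap ρ ρ) = 1 := by
    haveI := invertibleOfNonzero (cardC_ne (G := G))
    have h1 := Representation.card_inv_mul_sum_char_mul_char_eq_finrank ρ ρ
    rw [hρ.orth hρ, if_pos rfl, inv_mul_cancel₀ cardC_ne] at h1
    exact_mod_cast h1.symm
  have hV : Nontrivial V := by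
    by_contra hV
    rw [not_nontrivial_iff_subsingleton] at hV
    have : Subsingleton (Representation.IntertwiningMap ρ ρ) := 
      ⟨fun a b => by ext v; exact Subsingleton.elim _ _⟩
    rw [Module.finrank_zero_of_subsingleton] at hfr
    omega
  obtain ⟨c, hc⟩ := (finrank_eq_one_iff_of_nonzero' (1 : Representation.IntertwiningMap ρ ρ) (by
    intro h0
    obtain ⟨v, hv⟩ := exists_ne (0 : V)
    exact hv (congrArg (fun t : Representation.IntertwiningMap ρ ρ => t.toLinearMap v) h0))).1 hfr T
  have h1 : ∑ g, f g • ρ g⁻¹ = c • LinearMap.id := by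
    have := congrArg (fun t : Representation.IntertwiningMap ρ ρ => t.toLinearMap) hc
    refine this.symm.trans ?_
    ext v
    rfl
  refine ⟨c, h1, ?_⟩
  have := congrArg (LinearMap.trace ℂ V) h1
  simp only [map_sum, map_smul, smul_eq_mul, LinearMap.trace_id] at this
  rw [← this]; rfl

theorem rep_op_zero {f : G → ℂ} (hf : IsCl f)
    (h : ∀ χ, IsIrrChar G χ → ∑ g, f g * χ g⁻¹ = 0) (n : ℕ) :
    ∀ {V : Type} [AddCommGroup V] [Module ℂ V] [FiniteDimensional ℂ V]
    (ρ : Representation ℂ G V), Module.finrank ℂ V ≤ n → ∑ g, f g • ρ g⁻¹ = 0 := by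
  haveI : NeZero (Nat.card G : ℂ) := ⟨cardC_ne⟩
  induction n with
  | zero =>
    intro V _ _ _ ρ hn
    have : Subsingleton V := Module.finrank_zero_iff.1 (Nat.le_zero.1 hn)
    ext v; exact Subsingleton.elim _ _
  | succ n ih =>
    intro V _ _ _ ρ hn
    by_cases hV : Subsingleton V
    · ext v; exact Subsingleton.elim _ _
    rw [not_subsingleton_iff_nontrivial] at hV
    by_cases hρ : ρ.IsIrreducible
    · obtain ⟨c, hc1, hc2⟩ := irr_op_zero ρ (isIrrChar_of_irr ρ hρ) f hf
      rw [h _ (isIrrChar_of_irr ρ hρ)] at hc2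
      have hc : c = 0 := by
        rcases mul_eq_zero.1 hc2 with h | h
        · exact h
        · exact absurd (by exact_mod_cast h) (Module.finrank_pos (R := ℂ) (M := V)).ne'
      rw [hc1, hc, zero_smul]
    · have hnt : Nontrivial (Subrepresentation ρ) := by
        refine ⟨⊥, ⊤, fun e => ?_⟩
        have := congrArg (fun s : Subrepresentation ρ => s.toSubmodule) e
        exact bot_ne_top (α := Submodule ℂ V) this
      obtain ⟨W, hW0, hW1⟩ : ∃ W : Subrepresentation ρ, W ≠ ⊥ ∧ W ≠ ⊤ := by
        by_contra! hcon
        exact hρ ⟨fun a => or_iff_not_imp_left.2 (hcon a)⟩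
      obtain ⟨W', hc⟩ := exists_isCompl W
      have hc' : IsCompl W.toSubmodule W'.toSubmodule := by
        refine ⟨disjoint_iff.2 ?_, codisjoint_iff.2 ?_⟩
        · rw [← Subrepresentation.toSubmodule_inf, hc.inf_eq_bot]; rfl
        · rw [← Subrepresentation.toSubmodule_sup, hc.sup_eq_top]; rfl
      have key : ∀ U : Subrepresentation ρ, Module.finrank ℂ U.toSubmodule < Module.finrank ℂ V →
          ∀ u ∈ U.toSubmodule, (∑ g, f g • ρ g⁻¹) u = 0 := by
        intro U hU u hu
        have := ih U.toRepresentation (by omega)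
        have := congrArg (fun t => ((t ⟨u, hu⟩ : U.toSubmodule) : V)) this
        simpa [LinearMap.sum_apply, Subrepresentation.toRepresentation] using this
      have hsum := Submodule.finrank_add_eq_of_isCompl hc'
      have hp1 : 0 < Module.finrank ℂ W.toSubmodule := by
        rw [Nat.pos_iff_ne_zero]; intro h0
        exact hW0 (Subrepresentation.toSubmodule_injective (Submodule.finrank_eq_zero.1 h0))
      have hp2 : 0 < Module.finrank ℂ W'.toSubmodule := by
        rw [Nat.pos_iff_ne_zero]; intro h0
        have h1 := Submodule.finrank_eq_zero.1 h0
        rw [h1] at hc'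
        have h2 : W.toSubmodule = ⊤ := by simpa using hc'.sup_eq_top
        exact hW1 (Subrepresentation.toSubmodule_injective h2)
      ext v
      have hv : v ∈ W.toSubmodule ⊔ W'.toSubmodule := by rw [hc'.sup_eq_top]; trivial
      obtain ⟨a, ha, b, hb, rfl⟩ := Submodule.mem_sup.1 hv
      rw [map_add, key W (by omega) a ha, key W' (by omega) b hb]; simp

theorem IsCl.eq_zero {f : G → ℂ} (hf : IsCl f)
    (h : ∀ χ, IsIrrChar G χ → ∑ g, f g * χ g⁻¹ = 0) : f = 0 := by
  classical
  have h1 := rep_op_zero hf h _ (Representation.leftRegular ℂ G) le_rfl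
  ext g
  have := congrArg (fun t => (t (MonoidAlgebra.single 1 1)).coeff g⁻¹) h1
  simp [LinearMap.sum_apply, Finsupp.single_apply] at this
  exact this

abbrev Irr (G : Type) [Group G] := {χ : G → ℂ // IsIrrChar G χ}

theorem Irr.isCl (χ : Irr G) : IsCl χ.1 := χ.2.isChr.isCl

def clFun (f : G → ℂ) (hf : IsCl f) : ConjClasses G → ℂ :=
  Quotient.lift f (by
    intro a b hab
    obtain ⟨c, hc⟩ := isConj_iff.1 hab
    rw [← hc, hf])

theorem irr_linInd : LinearIndependent ℂ (fun χ : Irr G => clFun χ.1 χ.isCl) := by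
  classical
  rw [linearIndependent_iff']
  intro s c hs χ hχ
  have h1 : ∀ g : G, ∑ i ∈ s, c i * i.1 g = 0 := by
    intro g
    have := congrFun hs (ConjClasses.mk g)
    simp only [Finset.sum_apply, Pi.smul_apply, smul_eq_mul, Pi.zero_apply] at this
    exact this
  have h2 : ∑ g, (∑ i ∈ s, c i * i.1 g) * χ.1 g⁻¹ = 0 := by simp [h1]
  simp_rw [Finset.sum_mul, mul_assoc] at h2
  rw [Finset.sum_comm] at h2
  simp_rw [← Finset.mul_sum, fun i : Irr G => i.2.orth χ.2, ← Subtype.ext_iff] at h2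
  simp [hχ] at h2
  simpa using h2

noncomputable instance : Fintype (Irr G) := 
  haveI := (irr_linInd (G := G)).finite
  Fintype.ofFinite _

theorem IsCl.inv {f : G → ℂ} (hf : IsCl f) : IsCl (fun g => f g⁻¹) := by
  intro g h; simpa [mul_assoc] using hf g⁻¹ h

theorem IsCl.expand {f : G → ℂ} (hf : IsCl f) (g : G) :
    f g = (Nat.card G : ℂ)⁻¹ * ∑ χ : Irr G, (∑ h, f h * χ.1 h⁻¹) * χ.1 g := by
  classical
  have key : (fun g => f g - (Nat.card G : ℂ)⁻¹ * ∑ χ : Irr G, (∑ h, f h * χ.1 h⁻¹) * χ.1 g) = 0 := by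
    apply IsCl.eq_zero
    · intro g h
      have : ∀ χ : Irr G, χ.1 (h * g * h⁻¹) = χ.1 g := fun χ => χ.isCl g h
      simp only [hf g h, this]
    · intro χ hχ
      have e : ∀ (c : ℂ) (a : Irr G → ℂ), ∑ x, (c * ∑ i : Irr G, a i * i.1 x) * χ x⁻¹ =
          c * ∑ i : Irr G, a i * ∑ x, i.1 x * χ x⁻¹ := by
        intro c a
        simp_rw [mul_assoc, ← Finset.mul_sum, Finset.sum_mul, Finset.mul_sum, mul_assoc]
        rw [Finset.sum_comm]
      simp_rw [sub_mul]
      rw [Finset.sum_sub_distrib, e]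
      simp_rw [fun i : Irr G => i.2.orth hχ]
      rw [Finset.sum_eq_single (⟨χ, hχ⟩ : Irr G)]
      · simp only [if_true]
        rw [mul_comm _ (Nat.card G : ℂ), inv_mul_cancel_left₀ cardC_ne, sub_self]
      · intro b _ hb
        rw [if_neg, mul_zero]
        intro e; exact hb (Subtype.ext e)
      · simp
  exact sub_eq_zero.1 (congrFun key g)

theorem IsCl.expand' {f : G → ℂ} (hf : IsCl f) (g : G) :
    f g = (Nat.card G : ℂ)⁻¹ * ∑ χ : Irr G, (∑ h, f h * χ.1 h) * χ.1 g⁻¹ := by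
  have h1 := hf.inv.expand g⁻¹
  simp only [inv_inv] at h1
  rw [h1]
  congr 1
  refine Finset.sum_congr rfl fun χ _ => ?_
  congr 1
  exact Fintype.sum_equiv (Equiv.inv G) _ _ (fun x => by simp)

theorem card_irr_eq : Nat.card (Irr G) = Nat.card (ConjClasses G) := by
  classical
  haveI : Fintype (ConjClasses G) := Fintype.ofFinite _
  rw [Nat.card_eq_fintype_card, Nat.card_eq_fintype_card]
  apply le_antisymm
  · have := (irr_linInd (G := G)).fintype_card_le_finrank
    simpa using this
  · let φ : (ConjClasses G → ℂ) →ₗ[ℂ] (Irr G → ℂ) :=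
      { toFun := fun f χ => ∑ g, f (ConjClasses.mk g) * χ.1 g⁻¹
        map_add' := by intro a b; ext χ; simp [add_mul, Finset.sum_add_distrib]
        map_smul' := by intro a b; ext χ; simp [Finset.mul_sum, mul_assoc] }
    have hφ : Function.Injective φ := by
      rw [← LinearMap.ker_eq_bot, LinearMap.ker_eq_bot']
      intro f hf
      have : (fun g => f (ConjClasses.mk g)) = 0 := by
        apply IsCl.eq_zero
        · intro g h
          have : ConjClasses.mk (h * g * h⁻¹) = ConjClasses.mk g := 
            ConjClasses.mk_eq_mk_iff_isConj.2 (isConj_iff.2 ⟨h, rfl⟩).symm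
          simp only [this]
        · intro χ hχ
          exact congrFun hf ⟨χ, hχ⟩
      ext c
      obtain ⟨g, rfl⟩ := ConjClasses.exists_rep c
      exact congrFun this g
    have := LinearMap.finrank_le_finrank_of_injective hφ
    simpa using this

theorem IsIrrChar.deg_pos {χ : G → ℂ} (hχ : IsIrrChar G χ) : ∃ n : ℕ, 0 < n ∧ χ 1 = n := by
  have ho := hχ.orth hχ
  obtain ⟨V, hV, rfl⟩ := hχ
  refine ⟨_, Nat.pos_of_ne_zero fun h0 => ?_, V.char_one⟩
  have : Subsingleton V := Module.finrank_zero_iff.1 h0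
  have h1 : ∀ g, V.character g = 0 := by
    intro g
    have : V.ρ g = 0 := by ext v; exact Subsingleton.elim _ _
    simp [FDRep.character, this]
  simp only [h1] at ho
  simp at ho
  exact absurd ho.symm (by exact_mod_cast Fintype.card_ne_zero)

theorem IsIrrChar.central {χ : G → ℂ} (hχ : IsIrrChar G χ) (g : G) :
    IsIntegral ℤ (χ g * (Nat.card {x : G // IsConj g x} : ℂ) / χ 1) := by
  classical
  obtain ⟨n, hn, hn1⟩ := hχ.deg_pos
  obtain ⟨V, hV, rfl⟩ := hχ
  have hch : Representation.character V.ρ = V.character := rfl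
  let f : G → ℂ := fun x => if IsConj g x⁻¹ then 1 else 0
  have hf : IsCl f := by
    intro x h
    have : IsConj g (h * x * h⁻¹)⁻¹ ↔ IsConj g x⁻¹ := by
      have : IsConj (x⁻¹) ((h * x * h⁻¹)⁻¹) := isConj_iff.2 ⟨h, by simp [mul_assoc]⟩
      exact ⟨fun h => h.trans this.symm, fun h => h.trans this⟩
    simp only [f, this]
  obtain ⟨c, hc1, hc2⟩ := irr_op_zero V.ρ ⟨V, hV, rfl⟩ f hf
  have hn2 : (Module.finrank ℂ V : ℂ) = n := by rw [← hn1]; simp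
  have hs : ∑ x, f x * Representation.character V.ρ x⁻¹ = V.character g * (Nat.card {x : G // IsConj g x} : ℂ) := by
    rw [Fintype.sum_equiv (Equiv.inv G) _ (fun x => if IsConj g x then V.character g else 0)]
    · rw [← Finset.sum_filter, Finset.sum_const, Nat.card_eq_fintype_card, Fintype.card_subtype]
      simp [mul_comm]
    · intro x
      simp only [f, Equiv.inv_apply]
      split_ifs with h
      · obtain ⟨y, hy⟩ := isConj_iff.1 h
        rw [hch, ← hy]; simp
      · simp
  rw [hs, hn2] at hc2
  have hcc : c = V.character g * (Nat.card {x : G // IsConj g x} : ℂ) / V.character 1 := by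
    rw [hn1, eq_div_iff (by exact_mod_cast hn.ne'), hc2]
  rw [← hcc]
  let z : MonoidAlgebra ℤ G := ∑ x, (if IsConj g x⁻¹ then MonoidAlgebra.single x⁻¹ 1 else 0)
  have hz : IsIntegral ℤ z := IsIntegral.of_finite ℤ z
  let Φ := MonoidAlgebra.lift ℤ (Module.End ℂ V) G V.ρ
  have h1 := hz.map Φ
  have h2 : Φ z = algebraMap ℂ (Module.End ℂ V) c := by
    have : algebraMap ℂ (Module.End ℂ V) c = c • LinearMap.id := rfl
    rw [this, ← hc1, map_sum]
    refine Finset.sum_congr rfl fun x _ => ?_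
    simp only [f]
    split_ifs
    · simp [Φ]
    · simp
  rw [h2] at h1
  have : Nontrivial V := Module.nontrivial_of_finrank_pos (R := ℂ) (by
    have : Module.finrank ℂ V = n := by exact_mod_cast hn2
    omega)
  exact (isIntegral_algebraMap_iff (FaithfulSMul.algebraMap_injective ℂ (Module.End ℂ V))).1 h1
end PartA
set_option linter.unusedSectionVars false
set_option linter.style.haveILetI false

section PartB
variable {F : Type} [Field F] [Fintype F] [DecidableEq F]
variable {V : Type} [AddCommGroup V] [Module F V] [Finite V]
variable {W : Type} [AddCommGroup W] [Module F W] [Finite W]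
variable {Z : Type} [AddCommGroup Z] [Module F Z] [Finite Z]

instance homFin : Finite (V →ₗ[F] W) := DFunLike.finite _
noncomputable instance homFt : Fintype (V →ₗ[F] W) := Fintype.ofFinite _

/-- the endomorphism of `V` attached to a matrix via a coordinate system -/
noncomputable def lin {n : ℕ} (e : V ≃ₗ[F] (Fin n → F)) : GL (Fin n) F →* (Module.End F V) where
  toFun g := e.symm.toLinearMap ∘ₗ Matrix.toLin' g.1 ∘ₗ e.toLinearMap
  map_one' := by ext v; simp
  map_mul' g h := by ext v; simp

theorem lin_apply {n : ℕ} (e : V ≃ₗ[F] (Fin n → F)) (g : GL (Fin n) F) (v : V) :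
    lin e g v = e.symm (g.1 *ᵥ e v) := rfl

open Classical in
noncomputable def ev {n : ℕ} (f : GL (Fin n) F → ℂ) (x : V →ₗ[F] V) : ℂ :=
  if h : ∃ (g : GL (Fin n) F) (e : V ≃ₗ[F] (Fin n → F)), x = lin e g then f h.choose else 0

theorem ev_lin {n : ℕ} {f : GL (Fin n) F → ℂ} (hf : IsCl f) (e : V ≃ₗ[F] (Fin n → F))
    (g : GL (Fin n) F) : ev f (lin e g) = f g := by
  have h : ∃ (g' : GL (Fin n) F) (e' : V ≃ₗ[F] (Fin n → F)), lin e g = lin e' g' := ⟨g, e, rfl⟩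
  rw [ev, dif_pos h]
  obtain ⟨e', h'⟩ := h.choose_spec
  set g' := h.choose
  let P : GL (Fin n) F := Matrix.GeneralLinearGroup.toLin.symm
    (LinearMap.GeneralLinearGroup.ofLinearEquiv (e.symm.trans e'))
  have hP : ∀ v, P.1 *ᵥ v = e' (e.symm v) := by
    intro v
    have : (Matrix.GeneralLinearGroup.toLin P).1 v = e' (e.symm v) := by
      simp only [P, MulEquiv.apply_symm_apply]; rfl
    rw [← this]; rfl
  have : g' = P * g * P⁻¹ := by
    rw [eq_mul_inv_iff_mul_eq]
    apply Units.ext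
    apply Matrix.toLin'.injective
    ext1 v
    ext1
    simp only [Matrix.toLin'_apply, Units.val_mul, LinearMap.comp_apply]
    rw [← Matrix.mulVec_mulVec, ← Matrix.mulVec_mulVec, hP, hP]
    have h2 := congrArg (fun t : Module.End F V => e' (t (e.symm (LinearMap.single F (fun _ => F) v 1)))) h'
    simp only [lin_apply] at h2
    simp at h2
    simpa using h2.symm
  rw [this, hf]

theorem ev_eq_zero {n : ℕ} (f : GL (Fin n) F → ℂ) {x : V →ₗ[F] V} (h : ¬ ∃ (g : GL (Fin n) F) (e : V ≃ₗ[F] (Fin n → F)), x = lin e g) : ev f x = 0 := by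
  rw [ev, dif_neg h]

theorem ev_conj {n : ℕ} {f : GL (Fin n) F → ℂ} (hf : IsCl f) (E : V ≃ₗ[F] W) {x : V →ₗ[F] V}
    {y : W →ₗ[F] W} (h : ∀ v, E (x v) = y (E v)) : ev f x = ev f y := by
  by_cases hx : ∃ (g : GL (Fin n) F) (e : V ≃ₗ[F] (Fin n → F)), x = lin e g
  · obtain ⟨g, e, rfl⟩ := hx
    have : y = lin (E.symm.trans e) g := by
      ext w
      have := h (E.symm w)
      simp only [LinearEquiv.apply_symm_apply] at this
      rw [← this]
      simp [lin_apply]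
    rw [this, ev_lin hf, ev_lin hf]
  · rw [ev_eq_zero f hx, ev_eq_zero]
    rintro ⟨g, e, rfl⟩
    refine hx ⟨g, E.trans e, ?_⟩
    ext v
    apply E.injective
    rw [h]
    simp [lin_apply]

theorem ev_dim {n : ℕ} {f : GL (Fin n) F → ℂ} {x : V →ₗ[F] V} (h : ev f x ≠ 0) :
    Module.finrank F V = n ∧ Function.Bijective x := by
  by_cases hx : ∃ (g : GL (Fin n) F) (e : V ≃ₗ[F] (Fin n → F)), x = lin e g
  · obtain ⟨g, e, rfl⟩ := hx
    refine ⟨by simpa using e.finrank_eq, ?_⟩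
    refine Function.bijective_iff_has_inverse.2 ⟨lin e g⁻¹, fun v => ?_, fun v => ?_⟩
    · rw [← Module.End.mul_apply, ← map_mul]; simp
    · rw [← Module.End.mul_apply, ← map_mul]; simp
  · exact absurd (ev_eq_zero f hx) h

theorem exists_lin {n : ℕ} (e : V ≃ₗ[F] (Fin n → F)) {x : V →ₗ[F] V} (hx : Function.Bijective x) :
    ∃ g : GL (Fin n) F, x = lin e g := by
  let E := (e.symm.trans (LinearEquiv.ofBijective x hx)).trans e
  refine ⟨Matrix.GeneralLinearGroup.toLin.symm (LinearMap.GeneralLinearGroup.ofLinearEquiv E), ?_⟩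
  ext v
  rw [lin_apply]
  set P := Matrix.GeneralLinearGroup.toLin.symm (LinearMap.GeneralLinearGroup.ofLinearEquiv E) with hP
  have : ∀ w, P.1 *ᵥ w = E w := by
    intro w
    have : (Matrix.GeneralLinearGroup.toLin P).1 w = E w := by
      simp only [P, MulEquiv.apply_symm_apply]; rfl
    rw [← this]; rfl
  rw [this]; simp [E]

theorem lin_inj {n : ℕ} (e : V ≃ₗ[F] (Fin n → F)) : Function.Injective (lin e) := by
  intro g h hgh
  apply Units.ext
  apply Matrix.toLin'.injective
  ext1 v
  ext1
  have := congrArg (fun t : Module.End F V => e (t (e.symm (LinearMap.single F (fun _ => F) v 1)))) hgh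
  simp only [lin_apply] at this
  simp at this
  simpa using this

theorem sum_ev {n : ℕ} {f : GL (Fin n) F → ℂ} (hf : IsCl f) (e : V ≃ₗ[F] (Fin n → F))
    (φ : (V →ₗ[F] V) → ℂ) : ∑ x : V →ₗ[F] V, ev f x * φ x = ∑ g, f g * φ (lin e g) := by
  classical
  symm
  rw [← Finset.sum_subset (Finset.subset_univ (Finset.univ.image (lin e)))]
  · rw [Finset.sum_image (fun a _ b _ h => lin_inj e h)]
    exact Finset.sum_congr rfl fun g _ => by rw [ev_lin hf]
  · intro x _ hx
    rw [show ev f x = 0 from ?_, zero_mul]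
    by_contra h
    obtain ⟨g, hg⟩ := exists_lin e (ev_dim h).2
    exact hx (by simp [hg])

theorem ev_sum {n : ℕ} {ι : Type} (s : Finset ι) (c : ι → ℂ) (f : ι → GL (Fin n) F → ℂ) (x : V →ₗ[F] V) :
    ev (fun g => ∑ i ∈ s, c i * f i g) x = ∑ i ∈ s, c i * ev (f i) x := by
  unfold ev
  split_ifs with h
  · rfl
  · simp

theorem ev_mul_left {n : ℕ} (c : ℂ) (f : GL (Fin n) F → ℂ) (x : V →ₗ[F] V) :
    ev (fun g => c * f g) x = c * ev f x := by
  unfold ev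
  split_ifs with h
  · rfl
  · simp

def ivf {G : Type} [Group G] (f : G → ℂ) : G → ℂ := fun g => f g⁻¹

theorem IsCl.ivf {n : ℕ} {f : GL (Fin n) F → ℂ} (hf : IsCl f) : IsCl (ivf f) := hf.inv

theorem ev_ivf {n : ℕ} {f : GL (Fin n) F → ℂ} (hf : IsCl f) {x y : V →ₗ[F] V} (h : x ∘ₗ y = LinearMap.id)
     : ev (ivf f) x = ev f y := by
  have hi : Function.Injective y := fun a b hab => by
    have := congrArg x hab
    rwa [← LinearMap.comp_apply, ← LinearMap.comp_apply, h] at this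
  have hyb : Function.Bijective y := ⟨hi, LinearMap.injective_iff_surjective.1 hi⟩
  by_cases hn : Module.finrank F V = n
  · let e : V ≃ₗ[F] (Fin n → F) := LinearEquiv.ofFinrankEq _ _ (by simpa using hn)
    obtain ⟨g, hg⟩ := exists_lin e hyb
    have hx : x = lin e g⁻¹ := by
      have : lin e g * lin e g⁻¹ = 1 := by rw [← map_mul]; simp
      calc x = x * (lin e g * lin e g⁻¹) := by rw [this, mul_one]
        _ = (x * lin e g) * lin e g⁻¹ := by rw [mul_assoc]
        _ = lin e g⁻¹ := by
          rw [← hg, Module.End.mul_eq_comp x y, h]; rfl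
    rw [hx, hg, ev_lin hf.ivf, ev_lin hf, ivf, inv_inv]
  · rw [show ev f y = 0 from ?_, show ev (ivf f) x = 0 from ?_]
    · by_contra h; exact hn (ev_dim h).1
    · by_contra h; exact hn (ev_dim h).1

theorem ev_cl {n : ℕ} {f : GL (Fin n) F → ℂ} (hf : IsCl f) (x : V →ₗ[F] V) :
    ev f x = (Nat.card (GL (Fin n) F) : ℂ)⁻¹ * ∑ χ : Irr (GL (Fin n) F), (∑ h, f h * ivf χ.1 h) * ev χ.1 x := by
  rw [← ev_sum, ← ev_mul_left]
  congr 1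
  ext g
  exact hf.expand g

theorem ev_cl' {n : ℕ} {f : GL (Fin n) F → ℂ} (hf : IsCl f) (x : V →ₗ[F] V) :
    ev f x = (Nat.card (GL (Fin n) F) : ℂ)⁻¹ * ∑ χ : Irr (GL (Fin n) F), (∑ h, f h * χ.1 h) * ev (ivf χ.1) x := by
  rw [← ev_sum, ← ev_mul_left]
  congr 1
  ext g
  exact hf.expand' g

/-- block upper triangular endomorphism -/
def blk (x : V →ₗ[F] V) (u : W →ₗ[F] V) (y : W →ₗ[F] W) : V × W →ₗ[F] V × W :=
  LinearMap.prod (x ∘ₗ LinearMap.fst F V W + u ∘ₗ LinearMap.snd F V W) (y ∘ₗ LinearMap.snd F V W)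

@[simp] theorem blk_apply (x : V →ₗ[F] V) (u : W →ₗ[F] V) (y : W →ₗ[F] W) (v : V × W) :
    blk x u y v = (x v.1 + u v.2, y v.2) := rfl

/-- semidirect product of block triangular type -/
@[ext] structure Pb {A B : Type} [Group A] [Group B] (τ : A →* Module.End F V) (σ : B →* Module.End F W) where
  a : A
  b : B
  u : W →ₗ[F] V

variable {A B : Type} [Group A] [Group B] (τ : A →* Module.End F V) (σ : B →* Module.End F W)

theorem hom_inv_left (a : A) (v : V) : τ a⁻¹ (τ a v) = v := by
  rw [← Module.End.mul_apply, ← map_mul]; simp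
theorem hom_inv_right (a : A) (v : V) : τ a (τ a⁻¹ v) = v := by
  rw [← Module.End.mul_apply, ← map_mul]; simp

instance : Group (Pb τ σ) where
  mul p q := ⟨p.a * q.a, p.b * q.b, τ p.a ∘ₗ q.u + p.u ∘ₗ σ q.b⟩
  one := ⟨1, 1, 0⟩
  inv p := ⟨p.a⁻¹, p.b⁻¹, - (τ p.a⁻¹ ∘ₗ p.u ∘ₗ σ p.b⁻¹)⟩
  mul_assoc p q r := by
    refine Pb.ext (mul_assoc _ _ _) (mul_assoc _ _ _) ?_
    ext w
    change τ (p.a * q.a) (r.u w) + (τ p.a (q.u (σ r.b w)) + p.u (σ q.b (σ r.b w))) =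
      τ p.a (τ q.a (r.u w) + q.u (σ r.b w)) + p.u (σ (q.b * r.b) w)
    simp [add_assoc]
  one_mul p := by
    refine Pb.ext (one_mul _) (one_mul _) ?_
    ext w
    change τ 1 (p.u w) + (0 : W →ₗ[F] V) (σ p.b w) = p.u w
    simp
  mul_one p := by
    refine Pb.ext (mul_one _) (mul_one _) ?_
    ext w
    change τ p.a ((0 : W →ₗ[F] V) w) + p.u (σ 1 w) = p.u w
    simp
  inv_mul_cancel p := by
    refine Pb.ext (inv_mul_cancel _) (inv_mul_cancel _) ?_
    ext w
    change τ p.a⁻¹ (p.u w) + -(τ p.a⁻¹ (p.u (σ p.b⁻¹ (σ p.b w)))) = 0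
    rw [hom_inv_left]; simp

def Pb.fst : Pb τ σ →* A where
  toFun p := p.a
  map_one' := rfl
  map_mul' _ _ := rfl

def Pb.snd : Pb τ σ →* B where
  toFun p := p.b
  map_one' := rfl
  map_mul' _ _ := rfl

def Pb.toEnd : Pb τ σ →* Module.End F (V × W) where
  toFun p := blk (τ p.a) p.u (σ p.b)
  map_one' := by
    apply LinearMap.ext; intro v
    change (τ 1 v.1 + (0 : W →ₗ[F] V) v.2, σ 1 v.2) = v
    simp
  map_mul' p q := by
    apply LinearMap.ext; intro v
    change (τ (p.a * q.a) v.1 + (τ p.a (q.u v.2) + p.u (σ q.b v.2)), σ (p.b * q.b) v.2) =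
      (τ p.a (τ q.a v.1 + q.u v.2) + p.u (σ q.b v.2), σ p.b (σ q.b v.2))
    simp [add_assoc]

def Pb.equiv : Pb τ σ ≃ A × B × (W →ₗ[F] V) where
  toFun p := (p.a, p.b, p.u)
  invFun p := ⟨p.1, p.2.1, p.2.2⟩
  left_inv _ := rfl
  right_inv _ := rfl

theorem IsChr.comp {G H : Type} [Group G] [Group H] {f : H → ℂ} (hf : IsChr H f) (φ : G →* H) :
    IsChr G (fun g => f (φ g)) := by
  obtain ⟨V, rfl⟩ := hf
  exact ⟨FDRep.of (V.ρ.comp φ), rfl⟩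

theorem IsChr.mul {G : Type} [Group G] {f h : G → ℂ} (hf : IsChr G f) (hh : IsChr G h) :
    IsChr G (fun g => f g * h g) := by
  obtain ⟨V, rfl⟩ := hf
  obtain ⟨W, rfl⟩ := hh
  exact ⟨CategoryTheory.MonoidalCategoryStruct.tensorObj V W, FDRep.char_tensor V W⟩

theorem pb_nat [Fintype A] [Fintype B] {n : ℕ} {f : A → ℂ} {h : B → ℂ} {k : GL (Fin n) F → ℂ}
    (hf : IsChr A f) (hh : IsChr B h) (hk : IsChr _ k) (hn : Module.finrank F (V × W) = n) :
    ∃ m : ℕ, ((Nat.card A : ℂ) * (Nat.card B : ℂ) * (Nat.card (W →ₗ[F] V) : ℂ))⁻¹ *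
      ∑ a, ∑ b, ∑ u : W →ₗ[F] V, f a * h b * ev (ivf k) (blk (τ a) u (σ b)) = m := by
  haveI : Fintype (Pb τ σ) := Fintype.ofEquiv _ (Pb.equiv τ σ).symm
  let e : (V × W) ≃ₗ[F] (Fin n → F) := LinearEquiv.ofFinrankEq _ _ (by simpa using hn)
  let Φ : Pb τ σ →* GL (Fin n) F :=
    ((LinearMap.toMatrixAlgEquiv' : _ ≃ₐ[F] Matrix (Fin n) (Fin n) F).toAlgHom.toMonoidHom.comp
      ((e.conjAlgEquiv F).toAlgHom.toMonoidHom.comp (Pb.toEnd τ σ))).toHomUnits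
  have hΦ : ∀ p, lin e (Φ p) = Pb.toEnd τ σ p := by
    intro p
    apply LinearMap.ext; intro v
    rw [lin_apply]
    have : (Φ p).1 = LinearMap.toMatrix' (e.toLinearMap ∘ₗ (Pb.toEnd τ σ p) ∘ₗ e.symm.toLinearMap) := rfl
    rw [this, LinearMap.toMatrix'_mulVec]
    simp
  obtain ⟨m, hm⟩ := ((hf.comp (Pb.fst τ σ)).mul (hh.comp (Pb.snd τ σ))).pair_nat (hk.comp Φ)
  refine ⟨m, ?_⟩
  rw [← hm]
  congr 1
  · rw [Nat.card_congr (Pb.equiv τ σ), Nat.card_prod, Nat.card_prod]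
    push_cast; ring
  · rw [Fintype.sum_equiv (Pb.equiv τ σ) _
      (fun t => f t.1 * h t.2.1 * ev (ivf k) (blk (τ t.1) t.2.2 (σ t.2.1)))]
    · simp_rw [Fintype.sum_prod_type]
    · intro p
      change f p.a * h p.b * _ = f p.a * h p.b * _
      congr 1
      have h1 : blk (τ p.a) p.u (σ p.b) = lin e (Φ p) := (hΦ p).symm
      change _ = ev (ivf k) (blk (τ p.a) p.u (σ p.b))
      rw [h1, ev_lin hk.isCl.ivf, ivf, map_inv]
end PartB
set_option linter.unusedSectionVars false
set_option linter.style.haveILetI false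

section PartB2
variable {F : Type} [Field F] [Fintype F] [DecidableEq F]
variable {V : Type} [AddCommGroup V] [Module F V] [Finite V]
variable {W : Type} [AddCommGroup W] [Module F W] [Finite W]
variable {Z : Type} [AddCommGroup Z] [Module F Z] [Finite Z]
variable {V' : Type} [AddCommGroup V'] [Module F V'] [Finite V']
variable {W' : Type} [AddCommGroup W'] [Module F W'] [Finite W']

theorem endo_cl {n : ℕ} (e : V ≃ₗ[F] (Fin n → F)) {φ : (V →ₗ[F] V) → ℂ}
    (hc : ∀ (E : V ≃ₗ[F] V) (x : V →ₗ[F] V), φ (E.toLinearMap ∘ₗ x ∘ₗ E.symm.toLinearMap) = φ x)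
    (hz : ∀ x : V →ₗ[F] V, ¬ Function.Bijective x → φ x = 0) :
    IsCl (fun g => φ (lin e g)) ∧ ∀ y, φ y = ev (fun g => φ (lin e g)) y := by
  have h1 : IsCl (fun g => φ (lin e g)) := by
    intro g h
    have hb : Function.Bijective (lin e h) := by
      refine Function.bijective_iff_has_inverse.2 ⟨lin e h⁻¹, fun v => ?_, fun v => ?_⟩
      · rw [← Module.End.mul_apply, ← map_mul]; simp
      · rw [← Module.End.mul_apply, ← map_mul]; simp
    have := hc (LinearEquiv.ofBijective (lin e h) hb) (lin e g)
    change φ (lin e (h * g * h⁻¹)) = φ (lin e g)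
    rw [← this]
    congr 1
    rw [map_mul, map_mul]
    ext v
    change (lin e h) ((lin e g) ((lin e h⁻¹) v)) = (lin e h) ((lin e g) ((LinearEquiv.ofBijective (lin e h) hb).symm v))
    congr 2
    rw [LinearEquiv.eq_symm_apply]
    change (lin e h) ((lin e h⁻¹) v) = v
    rw [← Module.End.mul_apply, ← map_mul]; simp
  refine ⟨h1, fun y => ?_⟩
  by_cases hy : Function.Bijective y
  · obtain ⟨g, rfl⟩ := exists_lin e hy
    rw [ev_lin h1]
  · rw [hz y hy]
    by_contra h
    exact hy (ev_dim (Ne.symm h)).2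

theorem endo_expand' {n : ℕ} (hn : Module.finrank F V = n) {φ : (V →ₗ[F] V) → ℂ}
    (hc : ∀ (E : V ≃ₗ[F] V) (x : V →ₗ[F] V), φ (E.toLinearMap ∘ₗ x ∘ₗ E.symm.toLinearMap) = φ x)
    (hz : ∀ x : V →ₗ[F] V, ¬ Function.Bijective x → φ x = 0) (y : V →ₗ[F] V) :
    φ y = (Nat.card (GL (Fin n) F) : ℂ)⁻¹ *
      ∑ γ : Irr (GL (Fin n) F), (∑ x, ev γ.1 x * φ x) * ev (ivf γ.1) y := by
  let e : V ≃ₗ[F] (Fin n → F) := LinearEquiv.ofFinrankEq _ _ (by simpa using hn)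
  obtain ⟨h1, h2⟩ := endo_cl e hc hz
  rw [h2, ev_cl' h1]
  congr 1
  refine Finset.sum_congr rfl fun γ _ => ?_
  rw [sum_ev γ.isCl e]
  simp only [mul_comm]

theorem endo_expand {n : ℕ} (hn : Module.finrank F V = n) {φ : (V →ₗ[F] V) → ℂ}
    (hc : ∀ (E : V ≃ₗ[F] V) (x : V →ₗ[F] V), φ (E.toLinearMap ∘ₗ x ∘ₗ E.symm.toLinearMap) = φ x)
    (hz : ∀ x : V →ₗ[F] V, ¬ Function.Bijective x → φ x = 0) (y : V →ₗ[F] V) :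
    φ y = (Nat.card (GL (Fin n) F) : ℂ)⁻¹ *
      ∑ γ : Irr (GL (Fin n) F), (∑ x, ev (ivf γ.1) x * φ x) * ev γ.1 y := by
  let e : V ≃ₗ[F] (Fin n → F) := LinearEquiv.ofFinrankEq _ _ (by simpa using hn)
  obtain ⟨h1, h2⟩ := endo_cl e hc hz
  rw [h2, ev_cl h1]
  congr 1
  refine Finset.sum_congr rfl fun γ _ => ?_
  rw [sum_ev γ.isCl.ivf e]
  simp only [mul_comm]

/-- triple sum -/
noncomputable def S3 (V W : Type) [AddCommGroup V] [Module F V] [Finite V]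
    [AddCommGroup W] [Module F W] [Finite W] {m d n : ℕ} (f : GL (Fin m) F → ℂ)
    (h : GL (Fin d) F → ℂ) (k : GL (Fin n) F → ℂ) : ℂ :=
  ∑ x : V →ₗ[F] V, ∑ y : W →ₗ[F] W, ∑ u : W →ₗ[F] V, ev f x * ev h y * ev k (blk x u y)

theorem sum_hom (E : V ≃ₗ[F] V') (E' : W ≃ₗ[F] W') (φ : (W' →ₗ[F] V') → ℂ) :
    ∑ u : W →ₗ[F] V, φ (E.toLinearMap ∘ₗ u ∘ₗ E'.symm.toLinearMap) = ∑ u, φ u := by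
  refine Fintype.sum_bijective (fun u : W →ₗ[F] V => E.toLinearMap ∘ₗ u ∘ₗ E'.symm.toLinearMap)
    ?_ _ _ fun u => rfl
  refine Function.bijective_iff_has_inverse.2
    ⟨fun u => E.symm.toLinearMap ∘ₗ u ∘ₗ E'.toLinearMap, fun u => ?_, fun u => ?_⟩
  · apply LinearMap.ext; intro v; simp
  · apply LinearMap.ext; intro v; simp

theorem S3_congr (E : V ≃ₗ[F] V') (E' : W ≃ₗ[F] W') {m d n : ℕ} {f : GL (Fin m) F → ℂ}
    {h : GL (Fin d) F → ℂ} {k : GL (Fin n) F → ℂ} (hf : IsCl f) (hh : IsCl h) (hk : IsCl k) :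
    S3 V W f h k = S3 V' W' f h k := by
  unfold S3
  rw [← sum_hom E E]
  refine Finset.sum_congr rfl fun x _ => ?_
  rw [← sum_hom E' E']
  refine Finset.sum_congr rfl fun y _ => ?_
  rw [← sum_hom E E']
  refine Finset.sum_congr rfl fun u _ => ?_
  rw [ev_conj hf E (y := E.toLinearMap ∘ₗ x ∘ₗ E.symm.toLinearMap) (fun v => by simp),
    ev_conj hh E' (y := E'.toLinearMap ∘ₗ y ∘ₗ E'.symm.toLinearMap) (fun v => by simp),
    ev_conj hk (E.prodCongr E') (y := blk (E.toLinearMap ∘ₗ x ∘ₗ E.symm.toLinearMap)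
      (E.toLinearMap ∘ₗ u ∘ₗ E'.symm.toLinearMap) (E'.toLinearMap ∘ₗ y ∘ₗ E'.symm.toLinearMap))
      (fun v => by simp)]

theorem blk_bij {x : V →ₗ[F] V} {u : W →ₗ[F] V} {y : W →ₗ[F] W} (h : Function.Bijective (blk x u y)) :
    Function.Bijective x ∧ Function.Bijective y := by
  constructor
  · have : Function.Injective x := by
      rw [← LinearMap.ker_eq_bot, LinearMap.ker_eq_bot']
      intro v hv
      have := h.1 (a₁ := (v, 0)) (a₂ := 0) (by simp [hv])
      simpa using this
    exact ⟨this, LinearMap.injective_iff_surjective.1 this⟩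
  · have : Function.Surjective y := by
      intro w
      obtain ⟨v, hv⟩ := h.2 (0, w)
      exact ⟨v.2, congrArg Prod.snd hv⟩
    exact ⟨LinearMap.injective_iff_surjective.2 this, this⟩

/-- partial sums -/
noncomputable def dR (V : Type) {W : Type} [AddCommGroup V] [Module F V] [Finite V]
    [AddCommGroup W] [Module F W] [Finite W] {m n : ℕ} (f : GL (Fin m) F → ℂ)
    (k : GL (Fin n) F → ℂ) (y : W →ₗ[F] W) : ℂ :=
  ∑ x : V →ₗ[F] V, ∑ u : W →ₗ[F] V, ev f x * ev k (blk x u y)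

noncomputable def dL (W : Type) {V : Type} [AddCommGroup V] [Module F V] [Finite V]
    [AddCommGroup W] [Module F W] [Finite W] {d n : ℕ} (h : GL (Fin d) F → ℂ)
    (k : GL (Fin n) F → ℂ) (x : V →ₗ[F] V) : ℂ :=
  ∑ y : W →ₗ[F] W, ∑ u : W →ₗ[F] V, ev h y * ev k (blk x u y)

variable {m d n : ℕ} {f : GL (Fin m) F → ℂ} {h : GL (Fin d) F → ℂ} {k : GL (Fin n) F → ℂ}

theorem S3_eq_dR (f : GL (Fin m) F → ℂ) (h : GL (Fin d) F → ℂ) (k : GL (Fin n) F → ℂ) : 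
    S3 V W f h k = ∑ y : W →ₗ[F] W, ev h y * dR V f k y := by
  simp only [S3, dR, Finset.mul_sum]
  rw [Finset.sum_comm]
  exact Finset.sum_congr rfl fun y _ => Finset.sum_congr rfl fun x _ =>
    Finset.sum_congr rfl fun u _ => by ring

theorem S3_eq_dL (f : GL (Fin m) F → ℂ) (h : GL (Fin d) F → ℂ) (k : GL (Fin n) F → ℂ) : 
    S3 V W f h k = ∑ x : V →ₗ[F] V, ev f x * dL W h k x := by
  simp only [S3, dL, Finset.mul_sum]
  exact Finset.sum_congr rfl fun y _ => Finset.sum_congr rfl fun x _ =>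
    Finset.sum_congr rfl fun u _ => by ring

theorem ev_blk_zero_l {x : V →ₗ[F] V} {u : W →ₗ[F] V} {y : W →ₗ[F] W} (hx : ¬ Function.Bijective x) :
    ev k (blk x u y) = 0 := by
  by_contra hh; exact hx (blk_bij (ev_dim hh).2).1
theorem ev_blk_zero_r {x : V →ₗ[F] V} {u : W →ₗ[F] V} {y : W →ₗ[F] W} (hx : ¬ Function.Bijective y) :
    ev k (blk x u y) = 0 := by
  by_contra hh; exact hx (blk_bij (ev_dim hh).2).2

theorem dR_conj (hk : IsCl k) (E : W ≃ₗ[F] W) (y : W →ₗ[F] W) :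
    dR V f k (E.toLinearMap ∘ₗ y ∘ₗ E.symm.toLinearMap) = dR V f k y := by
  refine Finset.sum_congr rfl fun x _ => ?_
  symm
  refine Fintype.sum_equiv (LinearEquiv.arrowCongr E (LinearEquiv.refl F V)).toEquiv _ _ fun u => ?_
  congr 1
  exact ev_conj hk ((LinearEquiv.refl F V).prodCongr E) (fun v => by simp)

theorem dL_conj (hk : IsCl k) (E : V ≃ₗ[F] V) (y : V →ₗ[F] V) :
    dL W f k (E.toLinearMap ∘ₗ y ∘ₗ E.symm.toLinearMap) = dL W f k y := by
  refine Finset.sum_congr rfl fun x _ => ?_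
  symm
  refine Fintype.sum_equiv (LinearEquiv.arrowCongr (LinearEquiv.refl F W) E).toEquiv _ _ fun u => ?_
  congr 1
  exact ev_conj hk (E.prodCongr (LinearEquiv.refl F W)) (fun v => by simp)

theorem dR_zero (y : W →ₗ[F] W) (hy : ¬ Function.Bijective y) : dR V f k y = 0 := by
  refine Finset.sum_eq_zero fun x _ => Finset.sum_eq_zero fun u _ => ?_
  rw [ev_blk_zero_r hy, mul_zero]
theorem dL_zero (y : V →ₗ[F] V) (hy : ¬ Function.Bijective y) : dL W f k y = 0 := by
  refine Finset.sum_eq_zero fun x _ => Finset.sum_eq_zero fun u _ => ?_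
  rw [ev_blk_zero_l hy, mul_zero]

theorem finrank_fin (n : ℕ) : Module.finrank F (Fin n → F) = n := by simp

theorem sum_pull {I A B C : Type} [Fintype I] [Fintype A] [Fintype B] [Fintype C] (c : ℂ)
    (s : I → ℂ) (p : A → ℂ) (q : B → ℂ) (r : I → A → B → C → ℂ) :
    c * ∑ γ, s γ * ∑ x, ∑ y, ∑ u, p x * q y * r γ x y u =
    ∑ x, ∑ y, ∑ u, p x * q y * (c * ∑ γ, s γ * r γ x y u) := by
  simp_rw [Finset.mul_sum]
  rw [Finset.sum_comm]
  refine Finset.sum_congr rfl fun y _ => ?_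
  rw [Finset.sum_comm]
  refine Finset.sum_congr rfl fun z _ => ?_
  rw [Finset.sum_comm]
  refine Finset.sum_congr rfl fun w _ => ?_
  refine Finset.sum_congr rfl fun γ _ => ?_
  ring

theorem sum_coprod (φ : (W × Z →ₗ[F] V) → ℂ) :
    ∑ t, φ t = ∑ u : W →ₗ[F] V, ∑ v : Z →ₗ[F] V, φ (u.coprod v) := by
  rw [← Fintype.sum_prod_type']
  symm
  refine Fintype.sum_bijective (fun t : (W →ₗ[F] V) × (Z →ₗ[F] V) => t.1.coprod t.2) ?_ _ _ fun u => rfl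
  refine Function.bijective_iff_has_inverse.2 ⟨fun s => (s ∘ₗ LinearMap.inl F W Z, s ∘ₗ LinearMap.inr F W Z), fun s => ?_, fun s => ?_⟩
  · simp
  · apply LinearMap.ext; intro v
    simp

theorem sum_prodmap (φ : (Z →ₗ[F] V × W) → ℂ) :
    ∑ t, φ t = ∑ u : Z →ₗ[F] V, ∑ v : Z →ₗ[F] W, φ (u.prod v) := by
  rw [← Fintype.sum_prod_type']
  symm
  refine Fintype.sum_bijective (fun t : (Z →ₗ[F] V) × (Z →ₗ[F] W) => t.1.prod t.2) ?_ _ _ fun u => rfl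
  exact Function.bijective_iff_has_inverse.2 ⟨fun s => (LinearMap.fst F V W ∘ₗ s, LinearMap.snd F V W ∘ₗ s), fun s => rfl, fun s => rfl⟩

theorem sum_re6 {A B C D E G : Type} [Fintype A] [Fintype B] [Fintype C] [Fintype D] [Fintype E] [Fintype G]
    (a : A → ℂ) (b : B → ℂ) (c : C → ℂ) (r : A → B → C → D → E → G → ℂ) :
    ∑ y, ∑ z, ∑ w, b y * c z * ∑ x, ∑ u, ∑ v, a x * r x y z u v w =
    ∑ x, ∑ y, ∑ u, a x * b y * ∑ z, ∑ v, ∑ w, c z * r x y z u v w := by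
  simp_rw [Finset.mul_sum, ← Fintype.sum_prod_type']
  refine Fintype.sum_bijective (fun t : B × C × G × A × D × E => (t.2.2.2.1, t.1, t.2.2.2.2.1, t.2.1, t.2.2.2.2.2, t.2.2.1)) ?_ _ _ fun t => by ring
  exact Function.bijective_iff_has_inverse.2 ⟨fun s => (s.2.1, s.2.2.2.1, s.2.2.2.2.2, s.1, s.2.2.1, s.2.2.2.2.1), fun _ => rfl, fun _ => rfl⟩

/-- coassociativity -/
theorem coassoc {i j l : ℕ} {α : GL (Fin i) F → ℂ} {β : GL (Fin j) F → ℂ} {δ : GL (Fin l) F → ℂ}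
    (hα : IsCl α) (hβ : IsCl β) (hδ : IsCl δ) (hk : IsCl k)
    (hV : Module.finrank F V = i) (hW : Module.finrank F W = j) (hZ : Module.finrank F Z = l) :
    (Nat.card (GL (Fin (j + l)) F) : ℂ)⁻¹ * ∑ γ : Irr (GL (Fin (j + l)) F),
      S3 V (Fin (j + l) → F) α γ.1 k * S3 W Z β δ (ivf γ.1) =
    (Nat.card (GL (Fin (i + j)) F) : ℂ)⁻¹ * ∑ ζ : Irr (GL (Fin (i + j)) F),
      S3 V W α β (ivf ζ.1) * S3 (Fin (i + j) → F) Z ζ.1 δ k := by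
  have hWZ : Module.finrank F (W × Z) = j + l := by rw [Module.finrank_prod, hW, hZ]
  have hVW : Module.finrank F (V × W) = i + j := by rw [Module.finrank_prod, hV, hW]
  let e1 : (W × Z) ≃ₗ[F] (Fin (j + l) → F) := LinearEquiv.ofFinrankEq _ _ (by simpa using hWZ)
  let e2 : (V × W) ≃ₗ[F] (Fin (i + j) → F) := LinearEquiv.ofFinrankEq _ _ (by simpa using hVW)
  have L : (Nat.card (GL (Fin (j + l)) F) : ℂ)⁻¹ * ∑ γ : Irr (GL (Fin (j + l)) F),
      S3 V (Fin (j + l) → F) α γ.1 k * S3 W Z β δ (ivf γ.1) =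
      ∑ y : W →ₗ[F] W, ∑ z : Z →ₗ[F] Z, ∑ w : Z →ₗ[F] W, ev β y * ev δ z * dR V α k (blk y w z) := by
    simp_rw [fun y z w => endo_expand' hWZ (dR_conj hk) (dR_zero (V := V) (f := α) (k := k)) (blk (V := W) (W := Z) y w z),
      ← S3_eq_dR, fun γ : Irr (GL (Fin (j + l)) F) => S3_congr (LinearEquiv.refl F V) e1 hα γ.isCl hk]
    exact sum_pull _ _ _ _ _
  have R : (Nat.card (GL (Fin (i + j)) F) : ℂ)⁻¹ * ∑ ζ : Irr (GL (Fin (i + j)) F),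
      S3 V W α β (ivf ζ.1) * S3 (Fin (i + j) → F) Z ζ.1 δ k = 
      ∑ x : V →ₗ[F] V, ∑ y : W →ₗ[F] W, ∑ u : W →ₗ[F] V, ev α x * ev β y * dL Z δ k (blk x u y) := by
    simp_rw [fun y z w => endo_expand' hVW (dL_conj hk) (dL_zero (W := Z) (f := δ) (k := k)) (blk (V := V) (W := W) y w z),
      ← S3_eq_dL, fun γ : Irr (GL (Fin (i + j)) F) => S3_congr e2 (LinearEquiv.refl F Z) γ.isCl hδ hk]
    simp_rw [mul_comm (S3 V W α β _)]
    exact sum_pull _ _ _ _ _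
  rw [L, R]
  have hL : ∀ (y : W →ₗ[F] W) (w : Z →ₗ[F] W) (z : Z →ₗ[F] Z), dR V α k (blk y w z) =
      ∑ x : V →ₗ[F] V, ∑ u : W →ₗ[F] V, ∑ v : Z →ₗ[F] V, ev α x * ev k (blk x (u.coprod v) (blk y w z)) := by
    intro y w z
    unfold dR
    refine Finset.sum_congr rfl fun x _ => ?_
    rw [sum_coprod]
  have hR : ∀ (x : V →ₗ[F] V) (u : W →ₗ[F] V) (y : W →ₗ[F] W), dL Z δ k (blk x u y) =
      ∑ z : Z →ₗ[F] Z, ∑ v : Z →ₗ[F] V, ∑ w : Z →ₗ[F] W, ev δ z * ev k (blk x (u.coprod v) (blk y w z)) := by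
    intro x u y
    unfold dL
    refine Finset.sum_congr rfl fun z _ => ?_
    rw [sum_prodmap]
    refine Finset.sum_congr rfl fun v _ => Finset.sum_congr rfl fun w _ => ?_
    rw [ev_conj hk (LinearEquiv.prodAssoc F V W Z) (y := blk x (u.coprod v) (blk y w z)) fun v => ?_]
    simp [add_assoc]
  simp_rw [hL, hR]
  exact sum_re6 _ _ _ _
end PartB2
set_option linter.unusedSectionVars false
set_option linter.style.haveILetI false

section PartB3
variable {F : Type} [Field F] [Fintype F] [DecidableEq F]
variable {V : Type} [AddCommGroup V] [Module F V] [Finite V]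
variable {W : Type} [AddCommGroup W] [Module F W] [Finite W]
variable {Z : Type} [AddCommGroup Z] [Module F Z] [Finite Z]

abbrev Ch (F : Type) [Field F] [Fintype F] [DecidableEq F] (n : ℕ) := Irr (GL (Fin n) F)

noncomputable def cst (F : Type) [Field F] [Fintype F] [DecidableEq F] (m d : ℕ) : ℕ :=
  Nat.card (GL (Fin m) F) * Nat.card (GL (Fin d) F) * Nat.card ((Fin d → F) →ₗ[F] (Fin m → F))

theorem cst_pos (m d : ℕ) : 0 < cst F m d := by
  unfold cst
  have := Nat.card_pos (α := GL (Fin m) F)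
  have := Nat.card_pos (α := GL (Fin d) F)
  have := Nat.card_pos (α := (Fin d → F) →ₗ[F] (Fin m → F))
  positivity

theorem S3_group {m d n : ℕ} {f : GL (Fin m) F → ℂ} {h : GL (Fin d) F → ℂ} {k : GL (Fin n) F → ℂ}
    (hf : IsCl f) (hh : IsCl h) (e : V ≃ₗ[F] (Fin m → F)) (e' : W ≃ₗ[F] (Fin d → F)) :
    S3 V W f h k = ∑ a, ∑ b, ∑ u : W →ₗ[F] V, f a * h b * ev k (blk (lin e a) u (lin e' b)) := by
  have : S3 V W f h k = ∑ x : V →ₗ[F] V, ev f x * ∑ y : W →ₗ[F] W, ev h y * ∑ u : W →ₗ[F] V, ev k (blk x u y) := by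
    unfold S3
    simp_rw [Finset.mul_sum, mul_assoc]
  rw [this, sum_ev hf e]
  refine Finset.sum_congr rfl fun a _ => ?_
  rw [sum_ev hh e']
  simp_rw [Finset.mul_sum, mul_assoc]

theorem S3_deg {m d n : ℕ} {f : GL (Fin m) F → ℂ} {h : GL (Fin d) F → ℂ} {k : GL (Fin n) F → ℂ}
    (h0 : S3 V W f h k ≠ 0) : n = m + d := by
  unfold S3 at h0
  obtain ⟨x, -, h0⟩ := Finset.exists_ne_zero_of_sum_ne_zero h0
  obtain ⟨y, -, h0⟩ := Finset.exists_ne_zero_of_sum_ne_zero h0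
  obtain ⟨u, -, h0⟩ := Finset.exists_ne_zero_of_sum_ne_zero h0
  rw [← (ev_dim (right_ne_zero_of_mul h0)).1, Module.finrank_prod,
    (ev_dim (left_ne_zero_of_mul (left_ne_zero_of_mul h0))).1,
    (ev_dim (right_ne_zero_of_mul (left_ne_zero_of_mul h0))).1]

theorem M_exists {m d n : ℕ} (α : Ch F m) (γ : Ch F d) (χ : Ch F n) :
    ∃ k : ℕ, S3 (Fin m → F) (Fin d → F) α.1 γ.1 (ivf χ.1) = cst F m d * k := by
  by_cases h : n = m + d
  · obtain ⟨k, hk⟩ := pb_nat (lin (LinearEquiv.refl F (Fin m → F))) (lin (LinearEquiv.refl F (Fin d → F)))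
      α.2.isChr γ.2.isChr χ.2.isChr (by simp [h])
    refine ⟨k, ?_⟩
    rw [← hk, S3_group α.isCl γ.isCl (LinearEquiv.refl F _) (LinearEquiv.refl F _)]
    have := cst_pos (F := F) m d
    have h0 : (cst F m d : ℂ) ≠ 0 := by exact_mod_cast this.ne'
    rw [cst] at h0 ⊢
    push_cast at h0 ⊢
    rw [mul_inv_cancel_left₀ h0]
  · refine ⟨0, ?_⟩
    by_contra h'
    exact h (S3_deg (by simpa using h'))

noncomputable def M {m d n : ℕ} (α : Ch F m) (γ : Ch F d) (χ : Ch F n) : ℕ := (M_exists α γ χ).choose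

theorem S3_M {m d n : ℕ} (α : Ch F m) (γ : Ch F d) (χ : Ch F n) (hV : Module.finrank F V = m)
    (hW : Module.finrank F W = d) : S3 V W α.1 γ.1 (ivf χ.1) = cst F m d * M α γ χ := by
  rw [M, ← (M_exists α γ χ).choose_spec]
  exact S3_congr (LinearEquiv.ofFinrankEq _ _ (by simpa using hV))
    (LinearEquiv.ofFinrankEq _ _ (by simpa using hW)) α.isCl γ.isCl χ.isCl.ivf

theorem S3_dual {m d n : ℕ} {f : GL (Fin m) F → ℂ} {h : GL (Fin d) F → ℂ} {k : GL (Fin n) F → ℂ}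
    (hf : IsCl f) (hh : IsCl h) (hk : IsCl k) (hV : Module.finrank F V = m)
    (hW : Module.finrank F W = d) : S3 V W (ivf f) (ivf h) (ivf k) = S3 V W f h k := by
  let e : V ≃ₗ[F] (Fin m → F) := LinearEquiv.ofFinrankEq _ _ (by simpa using hV)
  let e' : W ≃ₗ[F] (Fin d → F) := LinearEquiv.ofFinrankEq _ _ (by simpa using hW)
  rw [S3_group hf hh e e', S3_group hf.ivf hh.ivf e e']
  haveI : Fintype (Pb (lin e) (lin e')) := Fintype.ofEquiv _ (Pb.equiv _ _).symm
  have key : ∀ (f : GL (Fin m) F → ℂ) (h : GL (Fin d) F → ℂ) (k : GL (Fin n) F → ℂ),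
      ∑ a, ∑ b, ∑ u : W →ₗ[F] V, f a * h b * ev k (blk (lin e a) u (lin e' b)) =
      ∑ p : Pb (lin e) (lin e'), f p.a * h p.b * ev k (Pb.toEnd (lin e) (lin e') p) := by
    intro f h k
    simp_rw [← Fintype.sum_prod_type']
    symm
    exact Fintype.sum_bijective (Pb.equiv (lin e) (lin e')) (Pb.equiv (lin e) (lin e')).bijective _ _ fun u => rfl
  rw [key, key]
  refine Fintype.sum_bijective (fun p : Pb (lin e) (lin e') => p⁻¹) (Equiv.inv _).bijective _ _ fun p => ?_
  rw [ev_ivf hk (y := Pb.toEnd (lin e) (lin e') p⁻¹)]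
  · rfl
  · rw [← Module.End.mul_eq_comp, ← map_mul, mul_inv_cancel, map_one]; rfl

theorem S3_M' {m d n : ℕ} (α : Ch F m) (γ : Ch F d) (χ : Ch F n) (hV : Module.finrank F V = m)
    (hW : Module.finrank F W = d) : S3 V W (ivf α.1) (ivf γ.1) χ.1 = cst F m d * M α γ χ := by
  rw [← S3_M (V := V) (W := W) α γ χ hV hW, ← S3_dual α.isCl γ.isCl χ.isCl.ivf hV hW]
  congr 1

theorem M_deg {m d n : ℕ} {α : Ch F m} {γ : Ch F d} {χ : Ch F n} (h : M α γ χ ≠ 0) : n = m + d := by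
  refine S3_deg (V := Fin m → F) (W := Fin d → F) (f := α.1) (h := γ.1) (k := ivf χ.1) ?_
  rw [S3_M α γ χ (by simp) (by simp)]
  have := cst_pos (F := F) m d
  exact_mod_cast mul_ne_zero this.ne' h

theorem M_assoc {i j l n : ℕ} (α : Ch F i) (β : Ch F j) (δ : Ch F l) (χ : Ch F n) :
    (∃ γ : Ch F (j + l), M α γ χ ≠ 0 ∧ M β δ γ ≠ 0) ↔
    (∃ ζ : Ch F (i + j), M α β ζ ≠ 0 ∧ M ζ δ χ ≠ 0) := by
  have h := coassoc (V := Fin i → F) (W := Fin j → F) (Z := Fin l → F) α.isCl β.isCl δ.isCl χ.isCl.ivf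
    (by simp) (by simp) (by simp)
  simp_rw [fun γ : Ch F (j + l) => S3_M (V := Fin i → F) (W := Fin (j + l) → F) α γ χ (by simp) (by simp),
    fun γ : Ch F (j + l) => S3_M (V := Fin j → F) (W := Fin l → F) β δ γ (by simp) (by simp),
    fun γ : Ch F (i + j) => S3_M (V := Fin i → F) (W := Fin j → F) α β γ (by simp) (by simp),
    fun γ : Ch F (i + j) => S3_M (V := Fin (i + j) → F) (W := Fin l → F) γ δ χ (by simp) (by simp)] at h
  have c1 := cst_pos (F := F) i (j + l)
  have c2 := cst_pos (F := F) j l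
  have c3 := cst_pos (F := F) i j
  have c4 := cst_pos (F := F) (i + j) l
  have p1 := Nat.card_pos (α := GL (Fin (j + l)) F)
  have p2 := Nat.card_pos (α := GL (Fin (i + j)) F)
  have e1 : ∀ (N : ℕ) (c c' : ℕ) {I : Type} [Fintype I] (a b : I → ℕ), 0 < N → 0 < c → 0 < c' →
      (((N : ℂ)⁻¹ * ∑ γ, (c * (a γ : ℂ)) * (c' * (b γ : ℂ)) ≠ 0) ↔ ∃ γ, a γ ≠ 0 ∧ b γ ≠ 0) := by
    intro N c c' I _ a b h1 h2 h3
    have : ∑ γ, (c * (a γ : ℂ)) * (c' * (b γ : ℂ)) = ((∑ γ, (c * a γ) * (c' * b γ) : ℕ) : ℂ) := by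
      push_cast; rfl
    rw [this, mul_ne_zero_iff]
    simp only [ne_eq, inv_eq_zero, Nat.cast_eq_zero, h1.ne', not_false_eq_true, true_and,
      Finset.sum_eq_zero_iff, Finset.mem_univ, true_imp_iff, not_forall, mul_eq_zero, not_or]
    simp [h2.ne', h3.ne']
  rw [← e1 _ _ _ _ _ p1 c1 c2, ← e1 _ _ _ _ _ p2 c3 c4]
  exact not_congr (by rw [h])
end PartB3
set_option linter.unusedSectionVars false
set_option linter.style.haveILetI false

section PartB4
variable {F : Type} [Field F] [Fintype F] [DecidableEq F]
variable {V : Type} [AddCommGroup V] [Module F V] [Finite V]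
variable {W : Type} [AddCommGroup W] [Module F W] [Finite W]
variable {Z : Type} [AddCommGroup Z] [Module F Z] [Finite Z]
variable {B : Type} [AddCommGroup B] [Module F B] [Finite B]
variable {C : Type} [AddCommGroup C] [Module F C] [Finite C]

instance quotFin (A : Submodule F V) : Finite (V ⧸ A) := Finite.of_surjective _ A.mkQ_surjective

/-- cuspidal irreducible characters -/
def Cusp {d : ℕ} (ρ : Ch F d) : Prop :=
  0 < d ∧ ∀ (i j : ℕ) (α : Ch F i) (β : Ch F j), 0 < i → 0 < j → M α β ρ = 0

/-- the killing property -/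
def Kill {d : ℕ} (k : GL (Fin d) F → ℂ) : Prop :=
  ∀ (V W : Type) [AddCommGroup V] [Module F V] [Finite V] [AddCommGroup W] [Module F W] [Finite W]
    (x : V →ₗ[F] V) (y : W →ₗ[F] W), 0 < Module.finrank F V → 0 < Module.finrank F W →
    ∑ u : W →ₗ[F] V, ev k (blk x u y) = 0

theorem K_conj_l {d : ℕ} {k : GL (Fin d) F → ℂ} (hk : IsCl k) (y : W →ₗ[F] W) (E : V ≃ₗ[F] V) (x : V →ₗ[F] V) :
    ∑ u : W →ₗ[F] V, ev k (blk (E.toLinearMap ∘ₗ x ∘ₗ E.symm.toLinearMap) u y) =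
    ∑ u : W →ₗ[F] V, ev k (blk x u y) := by
  rw [← sum_hom E (LinearEquiv.refl F W)]
  refine Finset.sum_congr rfl fun u _ => ?_
  exact (ev_conj hk (E.prodCongr (LinearEquiv.refl F W)) (fun v => by simp)).symm

theorem kill_of {d : ℕ} {k : GL (Fin d) F → ℂ} (hk : IsCl k)
    (h : ∀ (i j : ℕ) (α : Ch F i) (β : Ch F j), 0 < i → 0 < j →
      S3 (Fin i → F) (Fin j → F) (ivf α.1) (ivf β.1) k = 0) : Kill k := by
  intro V W _ _ _ _ _ _ x y hV hW
  have h1 := endo_expand (φ := fun x : V →ₗ[F] V => ∑ u : W →ₗ[F] V, ev k (blk x u y)) rfl (K_conj_l hk y)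
    (fun x hx => Finset.sum_eq_zero fun u _ => ev_blk_zero_l hx) x
  have h2 := fun α : Ch F (Module.finrank F V) => endo_expand (φ := fun z : W →ₗ[F] W => dR V (ivf α.1) k z) rfl (dR_conj hk)
    dR_zero y
  rw [h1]
  refine mul_eq_zero_of_right _ (Finset.sum_eq_zero fun α _ => ?_)
  rw [show ∑ x, ev (ivf α.1) x * ∑ u : W →ₗ[F] V, ev k (blk x u y) = 0 from ?_, zero_mul]
  have h3 := h2 α
  rw [dR] at h3
  simp_rw [Finset.mul_sum] 
  rw [h3]
  refine mul_eq_zero_of_right _ (Finset.sum_eq_zero fun β _ => ?_)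
  rw [← S3_eq_dR, S3_congr (LinearEquiv.ofFinrankEq V (Fin (Module.finrank F V) → F) (by simp))
    (LinearEquiv.ofFinrankEq W (Fin (Module.finrank F W) → F) (by simp)) α.isCl.ivf β.isCl.ivf hk,
    h _ _ α β hV hW, zero_mul]

theorem kill_of' {d : ℕ} {k : GL (Fin d) F → ℂ} (hk : IsCl k)
    (h : ∀ (i j : ℕ) (α : Ch F i) (β : Ch F j), 0 < i → 0 < j →
      S3 (Fin i → F) (Fin j → F) α.1 β.1 k = 0) : Kill k := by
  intro V W _ _ _ _ _ _ x y hV hW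
  have h1 := endo_expand' (φ := fun x : V →ₗ[F] V => ∑ u : W →ₗ[F] V, ev k (blk x u y)) rfl (K_conj_l hk y)
    (fun x hx => Finset.sum_eq_zero fun u _ => ev_blk_zero_l hx) x
  have h2 := fun α : Ch F (Module.finrank F V) => endo_expand' (φ := fun z : W →ₗ[F] W => dR V α.1 k z) rfl (dR_conj hk)
    dR_zero y
  rw [h1]
  refine mul_eq_zero_of_right _ (Finset.sum_eq_zero fun α _ => ?_)
  rw [show ∑ x, ev α.1 x * ∑ u : W →ₗ[F] V, ev k (blk x u y) = 0 from ?_, zero_mul]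
  have h3 := h2 α
  rw [dR] at h3
  simp_rw [Finset.mul_sum] 
  rw [h3]
  refine mul_eq_zero_of_right _ (Finset.sum_eq_zero fun β _ => ?_)
  rw [← S3_eq_dR, S3_congr (LinearEquiv.ofFinrankEq V (Fin (Module.finrank F V) → F) (by simp))
    (LinearEquiv.ofFinrankEq W (Fin (Module.finrank F W) → F) (by simp)) α.isCl β.isCl hk,
    h _ _ α β hV hW, zero_mul]

theorem Cusp.kill {d : ℕ} {ρ : Ch F d} (h : Cusp ρ) : Kill ρ.1 :=
  kill_of ρ.isCl fun i j α β hi hj => by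
    rw [S3_M' α β ρ (by simp) (by simp), h.2 i j α β hi hj]; simp

theorem Cusp.kill' {d : ℕ} {ρ : Ch F d} (h : Cusp ρ) : Kill (ivf ρ.1) :=
  kill_of' ρ.isCl.ivf fun i j α β hi hj => by
    rw [S3_M α β ρ (by simp) (by simp), h.2 i j α β hi hj]; simp

theorem split_exists (A : Submodule F V) : ∃ (p : V →ₗ[F] A) (s : (V ⧸ A) →ₗ[F] V),
    (∀ v, (p v : V) + s (A.mkQ v) = v) ∧ (∀ a : A, p a = a) ∧ (∀ c, A.mkQ (s c) = c) ∧ ∀ c, p (s c) = 0 := by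
  obtain ⟨p, hp⟩ := A.subtype.exists_leftInverse_of_injective (by simp)
  have hp' : ∀ a : A, p a = a := fun a => LinearMap.congr_fun hp a
  refine ⟨p, A.liftQ (LinearMap.id - A.subtype ∘ₗ p) ?_, ?_, hp', ?_, ?_⟩
  · intro a ha
    simp [hp' ⟨a, ha⟩]
  · intro v; simp
  · intro c
    obtain ⟨v, rfl⟩ := A.mkQ_surjective c
    simp
  · intro c
    obtain ⟨v, rfl⟩ := A.mkQ_surjective c
    simp [hp']

/-- the splitting equivalence -/
noncomputable def splE (A : Submodule F V) (p : V →ₗ[F] A) (s : (V ⧸ A) →ₗ[F] V)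
    (h1 : ∀ v, (p v : V) + s (A.mkQ v) = v) (h2 : ∀ a : A, p a = a) (h3 : ∀ c, A.mkQ (s c) = c) (h4 : ∀ c, p (s c) = 0) : V ≃ₗ[F] A × (V ⧸ A) :=
  LinearEquiv.ofLinearMap (p.prod A.mkQ) (A.subtype.coprod s)
    (by
      apply LinearMap.ext; rintro ⟨a, c⟩
      have : A.mkQ (a : V) = 0 := by simp
      change (p (a + s c), A.mkQ (a + s c)) = (a, c)
      rw [map_add, map_add, h2, h3, h4, this, add_zero, zero_add])
    (by apply LinearMap.ext; intro v; simpa using h1 v)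

theorem kill_sub {d : ℕ} {k : GL (Fin d) F → ℂ} (hk : IsCl k) (hK : Kill k) (A : Submodule F V)
    (hb : A ≠ ⊥) (ht : A ≠ ⊤) (z : V →ₗ[F] V) (hz : A ≤ A.comap z) :
    ∑ n : (V ⧸ A) →ₗ[F] A, ev k (z + A.subtype ∘ₗ n ∘ₗ A.mkQ) = 0 := by
  obtain ⟨p, s, h1, h2, h3, h4⟩ := split_exists A
  have h0 := hK A (V ⧸ A) (z.restrict hz) (A.mapQ A z hz) ?_ ?_
  · rw [← h0]
    refine Fintype.sum_bijective (fun n : (V ⧸ A) →ₗ[F] A => p ∘ₗ z ∘ₗ s + n) (Equiv.addLeft _).bijective _ _ fun n => ?_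
    refine ev_conj hk (splE A p s h1 h2 h3 h4) fun v => ?_
    change (p (z v + (n (A.mkQ v) : V)), A.mkQ (z v + (n (A.mkQ v) : V))) =
      (z.restrict hz (p v) + (p (z (s (A.mkQ v))) + n (A.mkQ v)), A.mkQ (z v))
    refine Prod.ext ?_ (by simp)
    simp only [map_add, h2]
    rw [← add_assoc]
    congr 1
    conv_lhs => rw [← h1 v]
    rw [map_add, map_add]
    congr 1
    exact h2 (z.restrict hz (p v))
  · exact Module.finrank_pos_iff.2 ((Submodule.nontrivial_iff_ne_bot).2 hb)
  · exact Module.finrank_pos_iff.2 (Submodule.Quotient.nontrivial_iff.2 ht)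

open Classical in
/-- contribution of a subspace -/
noncomputable def term {m d : ℕ} (α : GL (Fin m) F → ℂ) (ρ : GL (Fin d) F → ℂ) (W : Submodule F V)
    (x : V →ₗ[F] V) : ℂ :=
  if h : W ≤ W.comap x then ev α (x.restrict h) * ev ρ (W.mapQ W x h) else 0

theorem term_stable {m d : ℕ} {α : GL (Fin m) F → ℂ} {ρ : GL (Fin d) F → ℂ} {W : Submodule F V}
    {x : V →ₗ[F] V} (h : term α ρ W x ≠ 0) : W ≤ W.comap x := by
  by_contra h'
  exact h (by rw [term, dif_neg h'])

theorem term_of {m d : ℕ} {α : GL (Fin m) F → ℂ} {ρ : GL (Fin d) F → ℂ} (hα : IsCl α) (hρ : IsCl ρ)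
    {W : Submodule F V} {x : V →ₗ[F] V} (i : B →ₗ[F] V) (p : V →ₗ[F] C) (hi : Function.Injective i)
    (hp : Function.Surjective p) (hiW : LinearMap.range i = W) (hpW : LinearMap.ker p = W)
    {a : B →ₗ[F] B} {c : C →ₗ[F] C} (ha : ∀ b, x (i b) = i (a b)) (hc : ∀ v, p (x v) = c (p v)) :
    term α ρ W x = ev α a * ev ρ c := by
  have hs : W ≤ W.comap x := by
    intro w hw
    rw [← hpW, LinearMap.mem_ker] at hw
    rw [Submodule.mem_comap, ← hpW, LinearMap.mem_ker, hc, hw, map_zero]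
  rw [term, dif_pos hs]
  have hm : ∀ b, i b ∈ W := fun b => hiW ▸ LinearMap.mem_range_self i b
  let e1 : B ≃ₗ[F] W := LinearEquiv.ofBijective (i.codRestrict W hm) ⟨fun b b' h => hi (congrArg Subtype.val h), fun w => by
    obtain ⟨b, hb⟩ : w.1 ∈ LinearMap.range i := hiW ▸ w.2
    exact ⟨b, Subtype.ext hb⟩⟩
  let e2 : (V ⧸ W) ≃ₗ[F] C := LinearEquiv.ofBijective (W.liftQ p hpW.ge) ⟨by
    rw [← LinearMap.ker_eq_bot, Submodule.ker_liftQ_eq_bot _ _ _ hpW.le], fun c => by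
    obtain ⟨v, hv⟩ := hp c
    exact ⟨W.mkQ v, hv⟩⟩
  rw [ev_conj hα e1 (x := a) (y := x.restrict hs) fun b => Subtype.ext (ha b).symm,
    ev_conj hρ e2 (x := W.mapQ W x hs) (y := c) fun v => by
      obtain ⟨v, rfl⟩ := W.mkQ_surjective v
      exact hc v]

theorem term_congr {m d : ℕ} {α : GL (Fin m) F → ℂ} {ρ : GL (Fin d) F → ℂ} {W : Submodule F V}
    {x x' : V →ₗ[F] V} (h1 : ∀ w ∈ W, x' w = x w) (h2 : ∀ v, x' v - x v ∈ W) :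
    term α ρ W x' = term α ρ W x := by
  have hs : W ≤ W.comap x' ↔ W ≤ W.comap x := by
    constructor
    · intro h w hw; have := h hw; rw [Submodule.mem_comap] at this ⊢; rwa [← h1 w hw]
    · intro h w hw; have := h hw; rw [Submodule.mem_comap] at this ⊢; rwa [h1 w hw]
  by_cases h : W ≤ W.comap x
  · rw [term, term, dif_pos h, dif_pos (hs.2 h)]
    congr 2
    · apply LinearMap.ext; intro w; exact Subtype.ext (h1 w w.2)
    · apply LinearMap.ext; intro v
      obtain ⟨v, rfl⟩ := W.mkQ_surjective v
      exact (Submodule.Quotient.eq W).2 (h2 v)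
  · rw [term, term, dif_neg h, dif_neg (fun h' => h (hs.1 h'))]

theorem term_conj {m d : ℕ} {α : GL (Fin m) F → ℂ} {ρ : GL (Fin d) F → ℂ} (hα : IsCl α) (hρ : IsCl ρ)
    (E : V ≃ₗ[F] Z) (W : Submodule F V) {x : V →ₗ[F] V} {y : Z →ₗ[F] Z} (h : ∀ v, E (x v) = y (E v)) :
    term α ρ W x = term α ρ (W.map E.toLinearMap) y := by
  by_cases hs : W ≤ W.comap x
  · rw [term_of hα hρ (W := W.map E.toLinearMap) (x := y) (E.toLinearMap ∘ₗ W.subtype) (W.mkQ ∘ₗ E.symm.toLinearMap)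
      (a := x.restrict hs) (c := W.mapQ W x hs), term, dif_pos hs]
    · intro a b hab; simpa using hab
    · intro c; obtain ⟨v, rfl⟩ := W.mkQ_surjective c; exact ⟨E v, by simp⟩
    · rw [LinearMap.range_comp, Submodule.range_subtype]
    · rw [LinearMap.ker_comp, Submodule.ker_mkQ]; ext z; simp [Submodule.mem_map_equiv]
    · intro b; exact (h b).symm
    · intro v
      obtain ⟨v, rfl⟩ := E.surjective v
      rw [← h]; simp
  · rw [term, dif_neg hs]
    symm
    by_contra h0
    refine hs fun w hw => ?_
    have := term_stable h0 (Submodule.mem_map_of_mem hw : E.toLinearMap w ∈ _)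
    rw [Submodule.mem_comap] at this ⊢
    change y (E w) ∈ _ at this
    rw [← h] at this
    obtain ⟨w', hw', h'⟩ := this
    rwa [← E.injective h']

theorem term_bij {m d : ℕ} {α : GL (Fin m) F → ℂ} {ρ : GL (Fin d) F → ℂ} {W : Submodule F V}
    {x : V →ₗ[F] V} (h : term α ρ W x ≠ 0) : Function.Bijective x ∧ Module.finrank F W = m ∧ Module.finrank F (V ⧸ W) = d := by
  have hs := term_stable h
  rw [term, dif_pos hs] at h
  have h1 := ev_dim (left_ne_zero_of_mul h)
  have h2 := ev_dim (right_ne_zero_of_mul h)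
  refine ⟨?_, h1.1, h2.1⟩
  have : Function.Injective x := by
    rw [← LinearMap.ker_eq_bot, LinearMap.ker_eq_bot']
    intro v hv
    have : W.mkQ v = 0 := h2.2.1 (by
      rw [map_zero]
      change W.mkQ (x v) = 0
      rw [hv, map_zero])
    rw [Submodule.mkQ_apply, Submodule.Quotient.mk_eq_zero] at this
    have := h1.2.1 (a₁ := ⟨v, this⟩) (a₂ := 0) (Subtype.ext (by simpa using hv))
    simpa using this
  exact ⟨this, LinearMap.injective_iff_surjective.1 this⟩

theorem term_blk {m d : ℕ} {α : GL (Fin m) F → ℂ} {ρ : GL (Fin d) F → ℂ} (hα : IsCl α) (hρ : IsCl ρ)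
    (x : B →ₗ[F] B) (u : C →ₗ[F] B) (y : C →ₗ[F] C) :
    term α ρ (LinearMap.ker (LinearMap.snd F B C)) (blk x u y) = ev α x * ev ρ y := by
  refine term_of hα hρ (LinearMap.inl F B C) (LinearMap.snd F B C) LinearMap.inl_injective
    LinearMap.snd_surjective (LinearMap.range_inl F B C) rfl (fun b => by simp) (fun v => by simp)

theorem sum_term_prod {m d n : ℕ} {α : GL (Fin m) F → ℂ} {ρ : GL (Fin d) F → ℂ} (hα : IsCl α) (hρ : IsCl ρ)
    (k : GL (Fin n) F → ℂ) :
    ∑ x : (B × C) →ₗ[F] (B × C), ev k x * term α ρ (LinearMap.ker (LinearMap.snd F B C)) x = S3 B C α ρ k := by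
  rw [sum_coprod]
  simp_rw [sum_prodmap]
  unfold S3
  refine Finset.sum_congr rfl fun a _ => ?_
  rw [Finset.sum_eq_single 0]
  · rw [Finset.sum_comm]
    refine Finset.sum_congr rfl fun y _ => Finset.sum_congr rfl fun u _ => ?_
    rw [show (a.prod 0).coprod (u.prod y) = blk a u y from ?_, term_blk hα hρ]
    · ring
    · apply LinearMap.ext; intro v; simp
  · intro c _ hc
    refine Finset.sum_eq_zero fun u _ => Finset.sum_eq_zero fun y _ => mul_eq_zero_of_right _ ?_
    by_contra h0
    apply hc
    apply LinearMap.ext; intro w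
    have h1 : ((w, 0) : B × C) ∈ LinearMap.ker (LinearMap.snd F B C) := by simp
    have h2 := term_stable h0 h1
    rw [Submodule.mem_comap, LinearMap.mem_ker] at h2
    simpa using h2
  · intro h; exact absurd (Finset.mem_univ _) h

theorem sum_term {m d n : ℕ} {α : GL (Fin m) F → ℂ} {ρ : GL (Fin d) F → ℂ} (hα : IsCl α) (hρ : IsCl ρ)
    {k : GL (Fin n) F → ℂ} (hk : IsCl k) (W : Submodule F V) :
    ∑ x : V →ₗ[F] V, ev k x * term α ρ W x = S3 W (V ⧸ W) α ρ k := by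
  obtain ⟨p, s, h1, h2, h3, h4⟩ := split_exists W
  let E := splE W p s h1 h2 h3 h4
  have hW : W.map E.toLinearMap = LinearMap.ker (LinearMap.snd F W (V ⧸ W)) := by
    ext z
    rw [Submodule.mem_map_equiv, LinearMap.mem_ker]
    obtain ⟨v, rfl⟩ := E.surjective z
    rw [LinearEquiv.symm_apply_apply]
    change _ ↔ W.mkQ v = 0
    simp
  have : ∀ x : V →ₗ[F] V, ev k x * term α ρ W x =
      ev k (E.toLinearMap ∘ₗ x ∘ₗ E.symm.toLinearMap) * term α ρ (LinearMap.ker (LinearMap.snd F W (V ⧸ W))) (E.toLinearMap ∘ₗ x ∘ₗ E.symm.toLinearMap) := by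
    intro x
    rw [← hW, ← term_conj hα hρ E W (x := x) (fun v => by simp), ← ev_conj hk E (x := x) (fun v => by simp)]
  simp_rw [this]
  rw [sum_hom E E (fun x => ev k x * term α ρ (LinearMap.ker (LinearMap.snd F W (V ⧸ W))) x)]
  exact sum_term_prod hα hρ k
end PartB4
set_option linter.unusedSectionVars false
set_option linter.style.haveILetI false

section PartB5
variable {F : Type} [Field F] [Fintype F] [DecidableEq F]
variable {V : Type} [AddCommGroup V] [Module F V] [Finite V]
variable {Z : Type} [AddCommGroup Z] [Module F Z] [Finite Z]

noncomputable instance subFt : Fintype (Submodule F V) := Fintype.ofFinite _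

/-- induced class function -/
noncomputable def ind {m d : ℕ} (α : GL (Fin m) F → ℂ) (ρ : GL (Fin d) F → ℂ) (x : V →ₗ[F] V) : ℂ :=
  ∑ W : Submodule F V, term α ρ W x

theorem ind_conj {m d : ℕ} {α : GL (Fin m) F → ℂ} {ρ : GL (Fin d) F → ℂ} (hα : IsCl α) (hρ : IsCl ρ)
    (E : V ≃ₗ[F] V) (x : V →ₗ[F] V) : ind α ρ (E.toLinearMap ∘ₗ x ∘ₗ E.symm.toLinearMap) = ind α ρ x := by
  symm
  refine Fintype.sum_bijective (fun W : Submodule F V => W.map E.toLinearMap) ?_ _ _ fun W =>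
    term_conj hα hρ E W (fun v => by simp)
  exact (Submodule.orderIsoMapComap E).bijective

theorem exists_map_eq {W W' : Submodule F V} (h : Module.finrank F W = Module.finrank F W') :
    ∃ E : V ≃ₗ[F] V, W.map E.toLinearMap = W' := by
  obtain ⟨p, s, h1, h2, h3, h4⟩ := split_exists W
  obtain ⟨p', s', h1', h2', h3', h4'⟩ := split_exists W'
  have hq : Module.finrank F (V ⧸ W) = Module.finrank F (V ⧸ W') := by
    have := W.finrank_quotient_add_finrank
    have := W'.finrank_quotient_add_finrank
    omega
  let E := ((splE W p s h1 h2 h3 h4).trans ((LinearEquiv.ofFinrankEq _ _ h).prodCongr (LinearEquiv.ofFinrankEq _ _ hq))).trans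
    (splE W' p' s' h1' h2' h3' h4').symm
  refine ⟨E, ?_⟩
  apply Submodule.eq_of_le_of_finrank_eq
  · rintro _ ⟨w, hw, rfl⟩
    change (splE W' p' s' h1' h2' h3' h4').symm (LinearEquiv.ofFinrankEq _ _ h (p w), LinearEquiv.ofFinrankEq _ _ hq (W.mkQ w)) ∈ W'
    have : W.mkQ w = 0 := by simpa using hw
    rw [this, map_zero]
    change ((LinearEquiv.ofFinrankEq _ _ h (p w) : W') : V) + s' 0 ∈ W'
    rw [map_zero, add_zero]
    exact Subtype.mem _
  · rw [← h]; exact LinearEquiv.finrank_map_eq E W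

theorem one_cl {n : ℕ} : IsCl (fun _ : GL (Fin n) F => (1 : ℂ)) := fun _ _ => rfl

theorem ev_one {n : ℕ} {x : V →ₗ[F] V} (hn : Module.finrank F V = n) (hx : Function.Bijective x) :
    ev (fun _ : GL (Fin n) F => (1 : ℂ)) x = 1 := by
  let e : V ≃ₗ[F] (Fin n → F) := LinearEquiv.ofFinrankEq _ _ (by simpa using hn)
  obtain ⟨g, rfl⟩ := exists_lin e hx
  rw [ev_lin one_cl]

theorem lin_bij {n : ℕ} (e : V ≃ₗ[F] (Fin n → F)) (h : GL (Fin n) F) : Function.Bijective (lin e h) := by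
  refine Function.bijective_iff_has_inverse.2 ⟨lin e h⁻¹, fun v => ?_, fun v => ?_⟩
  · rw [← Module.End.mul_apply, ← map_mul]; simp
  · rw [← Module.End.mul_apply, ← map_mul]; simp

open Classical in
theorem stab_card {m d : ℕ} (W : Submodule F V) (hW : Module.finrank F W = m)
    (hV : Module.finrank F V = m + d) (e : V ≃ₗ[F] (Fin (m + d) → F)) :
    Nat.card {g : GL (Fin (m + d)) F // W.map (lin e g) = W} = cst F m d := by
  have hq : Module.finrank F (V ⧸ W) = d := by
    have := W.finrank_quotient_add_finrank
    omega
  have h1 := sum_term (one_cl (F := F) (n := m)) (one_cl (F := F) (n := d)) (one_cl (F := F) (n := m + d)) W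
  rw [sum_ev one_cl e, S3_group one_cl one_cl (LinearEquiv.ofFinrankEq W (Fin m → F) (by simpa using hW))
    (LinearEquiv.ofFinrankEq (V ⧸ W) (Fin d → F) (by simpa using hq))] at h1
  have h2 : ∀ g, term (fun _ : GL (Fin m) F => (1 : ℂ)) (fun _ : GL (Fin d) F => (1 : ℂ)) W (lin e g) =
      if W.map (lin e g) = W then 1 else 0 := by
    intro g
    have hb := lin_bij e g
    split_ifs with h
    · have hs : W ≤ W.comap (lin e g) := Submodule.map_le_iff_le_comap.1 h.le
      rw [term, dif_pos hs, ev_one hW, ev_one hq, one_mul]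
      · have : Function.Surjective (W.mapQ W (lin e g) hs) := by
          intro c
          obtain ⟨v, rfl⟩ := W.mkQ_surjective c
          obtain ⟨v, rfl⟩ := hb.2 v
          exact ⟨W.mkQ v, rfl⟩
        exact ⟨LinearMap.injective_iff_surjective.2 this, this⟩
      · have : Function.Injective ((lin e g).restrict hs) := fun a b hab => Subtype.ext (hb.1 (congrArg Subtype.val hab))
        exact ⟨this, LinearMap.injective_iff_surjective.1 this⟩
    · rw [term, dif_neg]
      intro hs
      apply h
      apply Submodule.eq_of_le_of_finrank_eq (Submodule.map_le_iff_le_comap.2 hs)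
      exact LinearEquiv.finrank_map_eq (LinearEquiv.ofBijective (lin e g) hb) W
  have h3 : ∀ a b (u : (V ⧸ W) →ₗ[F] W), ev (fun _ : GL (Fin (m + d)) F => (1 : ℂ)) (blk (lin (LinearEquiv.ofFinrankEq W (Fin m → F) (by simpa using hW)) a)
    u (lin (LinearEquiv.ofFinrankEq (V ⧸ W) (Fin d → F) (by simpa using hq)) b)) = 1 := by
    intro a b u
    apply ev_one
    · rw [Module.finrank_prod, hW, hq]
    · have : Function.Injective (blk (lin (LinearEquiv.ofFinrankEq W (Fin m → F) (by simpa using hW)) a)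
        u (lin (LinearEquiv.ofFinrankEq (V ⧸ W) (Fin d → F) (by simpa using hq)) b)) := by
        rw [← LinearMap.ker_eq_bot, LinearMap.ker_eq_bot']
        rintro ⟨v, w⟩ hv
        rw [blk_apply, Prod.mk_eq_zero] at hv
        have hw : w = 0 := (lin_bij _ b).1 (by rw [map_zero]; exact hv.2)
        subst hw
        have hw : v = 0 := (lin_bij _ a).1 (by rw [map_zero]; simpa using hv.1)
        subst hw
        rfl
      exact ⟨this, LinearMap.injective_iff_surjective.1 this⟩
  simp_rw [h2, h3] at h1
  simp only [one_mul, Finset.sum_const, Finset.card_univ, nsmul_eq_mul, mul_one, Finset.sum_boole] at h1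
  rw [Nat.card_eq_fintype_card, Fintype.card_subtype]
  have h4 : Nat.card ((V ⧸ W) →ₗ[F] W) = Nat.card ((Fin d → F) →ₗ[F] (Fin m → F)) :=
    Nat.card_congr (LinearEquiv.arrowCongr (LinearEquiv.ofFinrankEq (V ⧸ W) (Fin d → F) (by simpa using hq))
      (LinearEquiv.ofFinrankEq W (Fin m → F) (by simpa using hW))).toEquiv
  rw [cst, ← h4]
  simp only [Nat.card_eq_fintype_card]
  rw [mul_assoc]
  exact_mod_cast h1

open Classical in
theorem grass_card {m d : ℕ} (hV : Module.finrank F V = m + d) :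
    (Finset.univ.filter fun W : Submodule F V => Module.finrank F W = m).card * cst F m d = Nat.card (GL (Fin (m + d)) F) := by
  let e : V ≃ₗ[F] (Fin (m + d) → F) := LinearEquiv.ofFinrankEq _ _ (by simpa using hV)
  obtain ⟨W0, hW0⟩ : ∃ W0 : Submodule F V, Module.finrank F W0 = m := by
    let E : V ≃ₗ[F] (Fin m → F) × (Fin d → F) := LinearEquiv.ofFinrankEq _ _ (by simpa using hV)
    refine ⟨LinearMap.range (E.symm.toLinearMap ∘ₗ LinearMap.inl F (Fin m → F) (Fin d → F)), ?_⟩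
    rw [LinearMap.finrank_range_of_inj]
    · simp
    · exact E.symm.injective.comp LinearMap.inl_injective
  rw [Nat.card_eq_fintype_card, ← Finset.card_univ,
    Finset.card_eq_sum_card_fiberwise (f := fun g => W0.map (lin e g)) (t := Finset.univ.filter fun W : Submodule F V => Module.finrank F W = m)]
  · rw [Finset.sum_const_nat]
    intro W hW
    have hW : Module.finrank F W = m := by simpa using hW
    obtain ⟨E, hE⟩ := exists_map_eq (hW0.trans hW.symm)
    obtain ⟨h, hh⟩ := exists_lin e E.bijective (x := E.toLinearMap)
    rw [hh] at hE
    rw [← stab_card (d := d) W0 hW0 hV e, Nat.card_eq_fintype_card, Fintype.card_subtype]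
    symm
    refine Finset.card_bij' (fun g _ => h * g) (fun g _ => h⁻¹ * g) ?_ ?_ ?_ ?_
    · intro g hg
      have hg : W0.map (lin e g) = W0 := by simpa using hg
      simp only [Finset.mem_filter, Finset.mem_univ, true_and, map_mul]
      rw [Module.End.mul_eq_comp, Submodule.map_comp, hg, hE]
    · intro g hg
      have hg : W0.map (lin e g) = W := by simpa using hg
      simp only [Finset.mem_filter, Finset.mem_univ, true_and, map_mul]
      rw [Module.End.mul_eq_comp, Submodule.map_comp, hg, ← hE, ← Submodule.map_comp, ← Module.End.mul_eq_comp, ← map_mul, inv_mul_cancel, map_one]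
      exact Submodule.map_id _
    · intro g _; simp
    · intro g _; simp
  · intro g _
    simp only [Finset.coe_filter, Finset.mem_univ, true_and, Set.mem_ofPred_eq]
    exact (LinearEquiv.finrank_map_eq (LinearEquiv.ofBijective (lin e g) (lin_bij e g)) W0).trans hW0

theorem sum_ind {m d n : ℕ} (α : Ch F m) (ρ : Ch F d) (χ : Ch F n) (hn : n = m + d) (hV : Module.finrank F V = n) :
    ∑ x : V →ₗ[F] V, ev (ivf χ.1) x * ind α.1 ρ.1 x = Nat.card (GL (Fin n) F) * M α ρ χ := by
  classical
  subst hn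
  simp_rw [ind, Finset.mul_sum]
  rw [Finset.sum_comm]
  simp_rw [sum_term α.isCl ρ.isCl χ.isCl.ivf]
  rw [← grass_card hV, ← Finset.sum_filter_add_sum_filter_not _ (fun W : Submodule F V => Module.finrank F W = m),
    Finset.sum_congr (s₁ := Finset.univ.filter fun W : Submodule F V => Module.finrank F W = m) rfl
      (g := fun _ => (cst F m d * M α ρ χ : ℂ)), Finset.sum_eq_zero (s := Finset.univ.filter fun W : Submodule F V => ¬ Module.finrank F W = m)]
  · simp; ring
  · intro W hW
    have hW : ¬ Module.finrank F W = m := by simpa using hW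
    unfold S3
    refine Finset.sum_eq_zero fun x _ => Finset.sum_eq_zero fun y _ => Finset.sum_eq_zero fun u _ => ?_
    rw [mul_assoc]
    refine mul_eq_zero_of_left ?_ _
    by_contra h0
    exact hW (ev_dim h0).1
  · intro W hW
    have hW : Module.finrank F W = m := by simpa using hW
    refine S3_M α ρ χ hW ?_
    have := W.finrank_quotient_add_finrank
    omega

theorem ind_expand {m d n : ℕ} (α : Ch F m) (ρ : Ch F d) (hn : n = m + d) (hV : Module.finrank F V = n) (x : V →ₗ[F] V) :
    ind α.1 ρ.1 x = ∑ χ : Ch F n, (M α ρ χ : ℂ) * ev χ.1 x := by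
  rw [endo_expand hV (φ := fun x : V →ₗ[F] V => ind α.1 ρ.1 x) (ind_conj α.isCl ρ.isCl)
    (fun x hx => Finset.sum_eq_zero fun W _ => by
      by_contra h0; exact hx (term_bij h0).1) x, Finset.mul_sum]
  refine Finset.sum_congr rfl fun χ _ => ?_
  rw [sum_ind α ρ χ hn hV, ← mul_assoc, ← mul_assoc, inv_mul_cancel₀ cardC_ne, one_mul]
end PartB5
set_option linter.unusedSectionVars false
set_option linter.style.haveILetI false

section PartB6
variable {F : Type} [Field F] [Fintype F] [DecidableEq F]
variable {Y : Type} [AddCommGroup Y] [Module F Y] [Finite Y]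
variable {Z : Type} [AddCommGroup Z] [Module F Z] [Finite Z]

theorem avg_zero {G N : Type} [AddCommGroup G] [Fintype G] [Fintype N] [Nonempty N] (j : N → G) (Φ : G → ℂ)
    (h : ∀ t, ∑ n, Φ (t + j n) = 0) : ∑ t, Φ t = 0 := by
  have h1 : ∑ n : N, ∑ t, Φ (t + j n) = 0 := by
    rw [Finset.sum_comm]; exact Finset.sum_eq_zero fun t _ => h t
  have h2 : ∀ n : N, ∑ t, Φ (t + j n) = ∑ t, Φ t := fun n =>
    Fintype.sum_bijective (fun t => t + j n) (Equiv.addRight (j n)).bijective _ _ fun t => rfl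
  simp_rw [h2] at h1
  simpa using h1

variable {m d d' : ℕ} {α : GL (Fin m) F → ℂ} {ρ : GL (Fin d) F → ℂ} {r : GL (Fin d') F → ℂ}

/-- the sum over the unipotent part for a fixed subspace -/
noncomputable def TW (r : GL (Fin d') F → ℂ) (α : GL (Fin m) F → ℂ) (ρ : GL (Fin d) F → ℂ) (y : Y →ₗ[F] Y)
    (W : Submodule F (Y × Z)) : ℂ :=
  ∑ z : Z →ₗ[F] Z, ∑ u : Z →ₗ[F] Y, ev r z * term α ρ W (blk y u z)

theorem TW_a (hr : IsCl r) (hK : Kill r) (y : Y →ₗ[F] Y) (W : Submodule F (Y × Z))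
    (h1 : W.map (LinearMap.snd F Y Z) ≠ ⊥) (h2 : W.map (LinearMap.snd F Y Z) ≠ ⊤) : TW r α ρ y W = 0 := by
  set A := W.map (LinearMap.snd F Y Z) with hA
  let p : W →ₗ[F] A := (LinearMap.snd F Y Z).restrict fun w hw => Submodule.mem_map_of_mem hw
  obtain ⟨σ, hσ⟩ := LinearMap.exists_rightInverse_of_surjective p (LinearMap.range_eq_top.2 (by
    rintro ⟨a, w, hw, rfl⟩
    exact ⟨⟨w, hw⟩, rfl⟩))
  have hσ' : ∀ a : A, (σ a : Y × Z).2 = a := fun a => congrArg Subtype.val (LinearMap.congr_fun hσ a)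
  let j : ((Z ⧸ A) →ₗ[F] A) → (Z →ₗ[F] Y × Z) := fun n => W.subtype ∘ₗ σ ∘ₗ n ∘ₗ A.mkQ
  unfold TW
  rw [← Fintype.sum_prod_type']
  refine avg_zero (fun n => (LinearMap.snd F Y Z ∘ₗ j n, LinearMap.fst F Y Z ∘ₗ j n)) _ fun t => ?_
  obtain ⟨z, u⟩ := t
  have e1 : ∀ n, term α ρ W (blk y (u + LinearMap.fst F Y Z ∘ₗ j n) (z + LinearMap.snd F Y Z ∘ₗ j n)) = term α ρ W (blk y u z) := by
    intro n
    have hd : ∀ v : Y × Z, blk y (u + LinearMap.fst F Y Z ∘ₗ j n) (z + LinearMap.snd F Y Z ∘ₗ j n) v = blk y u z v + j n v.2 := by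
      intro v
      refine Prod.ext ?_ ?_ 
      · simp [add_assoc]
      · simp
    refine term_congr (fun w hw => ?_) (fun v => ?_)
    · rw [hd]
      have : A.mkQ w.2 = 0 := by
        rw [Submodule.mkQ_apply, Submodule.Quotient.mk_eq_zero]; exact Submodule.mem_map_of_mem (f := LinearMap.snd F Y Z) hw
      have : j n w.2 = 0 := by
        change ((σ (n (A.mkQ w.2)) : W) : Y × Z) = 0
        rw [this, map_zero, map_zero]; rfl
      rw [this, add_zero]
    · rw [hd, add_sub_cancel_left]
      exact (σ (n (A.mkQ v.2))).2
  simp only [Prod.mk_add_mk, e1, ← Finset.sum_mul]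
  by_cases h0 : term α ρ W (blk y u z) = 0
  · rw [h0, mul_zero]
  · refine mul_eq_zero_of_left ?_ _
    have hs := term_stable h0
    rw [← kill_sub hr hK A h1 h2 z ?_]
    · refine Finset.sum_congr rfl fun n _ => ?_
      congr 2
      apply LinearMap.ext; intro c
      exact hσ' _
    · rintro _ ⟨w, hw, rfl⟩
      exact ⟨_, hs hw, by simp⟩

theorem TW_b (hα : IsCl α) (hρ : IsCl ρ) (hK : Kill ρ) (y : Y →ₗ[F] Y) (W : Submodule F (Y × Z)) (hZ : 0 < Module.finrank F Z)
    (h1 : W.map (LinearMap.snd F Y Z) = ⊥) (h2 : W ≠ LinearMap.ker (LinearMap.snd F Y Z)) : TW r α ρ y W = 0 := by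
  set B := W.comap (LinearMap.inl F Y Z) with hB
  have hmem : ∀ v : Y × Z, v ∈ W ↔ v.1 ∈ B ∧ v.2 = 0 := by
    rintro ⟨a, c⟩
    constructor
    · intro h
      have : c = 0 := by
        have : c ∈ W.map (LinearMap.snd F Y Z) := ⟨(a, c), h, rfl⟩
        rwa [h1, Submodule.mem_bot] at this
      subst this
      exact ⟨h, rfl⟩
    · rintro ⟨h, h'⟩
      simp only at h h'
      subst h'
      exact h
  have hBt : B ≠ ⊤ := by
    intro h
    apply h2
    ext v
    rw [hmem, h]; simp
  obtain ⟨p, s, -, -, hs, -⟩ := split_exists B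
  have hB0 : 0 < Module.finrank F (Y ⧸ B) := Module.finrank_pos_iff.2 (Submodule.Quotient.nontrivial_iff.2 hBt)
  refine Finset.sum_eq_zero fun z _ => ?_
  rw [← Finset.mul_sum]
  refine mul_eq_zero_of_right _ ?_
  by_cases hst : B ≤ B.comap y
  · have key : ∀ u : Z →ₗ[F] Y, term α ρ W (blk y u z) = ev α (y.restrict hst) * ev ρ (blk (B.mapQ B y hst) (B.mkQ ∘ₗ u) z) := by
      intro u
      refine term_of hα hρ (LinearMap.inl F Y Z ∘ₗ B.subtype) (B.mkQ.prodMap LinearMap.id) ?_ ?_ ?_ ?_ ?_ ?_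
      · exact LinearMap.inl_injective.comp Subtype.val_injective
      · rintro ⟨a, c⟩
        obtain ⟨a, rfl⟩ := B.mkQ_surjective a
        exact ⟨(a, c), rfl⟩
      · ext v
        rw [hmem]
        constructor
        · rintro ⟨b, rfl⟩; exact ⟨b.2, rfl⟩
        · rintro ⟨h, h'⟩; exact ⟨⟨v.1, h⟩, Prod.ext rfl h'.symm⟩
      · ext v
        rw [hmem, LinearMap.mem_ker, LinearMap.prodMap_apply, Prod.mk_eq_zero]
        simp
      · intro b
        refine Prod.ext ?_ ?_ <;> simp
      · intro v
        refine Prod.ext ?_ ?_ 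
        · simp
        · simp
    simp_rw [key, ← Finset.mul_sum]
    refine mul_eq_zero_of_right _ ?_
    refine avg_zero (fun n : Z →ₗ[F] (Y ⧸ B) => s ∘ₗ n) _ fun u => ?_
    rw [← hK (Y ⧸ B) Z (B.mapQ B y hst) z hB0 hZ]
    refine Fintype.sum_bijective (fun n => B.mkQ ∘ₗ u + n) (Equiv.addLeft _).bijective _ _ fun n => ?_
    congr 2
    apply LinearMap.ext; intro c
    simp only [LinearMap.comp_apply, LinearMap.add_apply, map_add, hs]
  · refine Finset.sum_eq_zero fun u _ => ?_
    by_contra h0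
    refine hst fun b hb => ?_
    have h3 := term_stable h0 ((hmem (b, 0)).2 ⟨hb, rfl⟩)
    rw [Submodule.mem_comap, hmem] at h3
    simpa using h3.1

theorem sum_alg {X U : Type} [Fintype X] [Fintype U] (a b : X → ℂ) (c : ℂ) :
    ∑ z : X, ∑ _u : U, a z * (c * b z) = Nat.card U * (∑ z, a z * b z) * c := by
  rw [Finset.mul_sum, Finset.sum_mul]
  refine Finset.sum_congr rfl fun z _ => ?_
  rw [Finset.sum_const, Finset.card_univ, nsmul_eq_mul, Nat.card_eq_fintype_card]
  ring

theorem TW_ker (hα : IsCl α) (hρ : IsCl ρ) (y : Y →ₗ[F] Y) :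
    TW (Z := Z) r α ρ y (LinearMap.ker (LinearMap.snd F Y Z)) =
      Nat.card (Z →ₗ[F] Y) * (∑ z : Z →ₗ[F] Z, ev r z * ev ρ z) * ev α y := by
  unfold TW
  refine (Finset.sum_congr rfl fun z _ => Finset.sum_congr rfl fun u _ => ?_).trans
    (sum_alg (fun z : Z →ₗ[F] Z => ev r z) (fun z => ev ρ z) (ev α y))
  rw [term_blk hα hρ]

open Classical in
theorem TW_c2 (hα : IsCl α) (hρ : IsCl ρ) (y : Y →ₗ[F] Y) (B : Submodule F Y) :
    TW (Z := Z) r α ρ y (B.prod ⊤) =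
      if h : B ≤ B.comap y then dL Z r α (y.restrict h) * ev ρ (B.mapQ B y h) else 0 := by
  have hst : ∀ (u : Z →ₗ[F] Y) (z : Z →ₗ[F] Z), term α ρ (B.prod ⊤) (blk y u z) ≠ 0 →
      B ≤ B.comap y ∧ ∀ c, u c ∈ B := by
    intro u z h0
    have hs := term_stable h0
    refine ⟨fun b hb => ?_, fun c => ?_⟩
    · have := hs (show ((b, 0) : Y × Z) ∈ _ from ⟨hb, trivial⟩)
      rw [Submodule.mem_comap, Submodule.mem_prod] at this
      simpa using this
    · have := hs (show ((0, c) : Y × Z) ∈ _ from ⟨B.zero_mem, trivial⟩)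
      rw [Submodule.mem_comap, Submodule.mem_prod] at this
      simpa using this
  split_ifs with h
  · unfold TW dL
    rw [Finset.sum_mul]
    refine Finset.sum_congr rfl fun z _ => ?_
    rw [Finset.sum_mul, ← Finset.sum_subset (Finset.subset_univ (Finset.univ.image fun u' : Z →ₗ[F] B => B.subtype ∘ₗ u'))]
    · rw [Finset.sum_image]
      · refine Finset.sum_congr rfl fun u _ => ?_
        rw [term_of hα hρ (W := B.prod ⊤) (x := blk y (B.subtype ∘ₗ u) z) (B.subtype.prodMap LinearMap.id) (B.mkQ ∘ₗ LinearMap.fst F Y Z)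
          (a := blk (y.restrict h) u z) (c := B.mapQ B y h), mul_assoc]
        · rintro ⟨a, c⟩ ⟨a', c'⟩ hh
          have h1 := congrArg Prod.fst hh
          have h2 := congrArg Prod.snd hh
          simp only [LinearMap.prodMap_apply] at h1 h2
          exact Prod.ext (Subtype.ext h1) h2
        · intro c
          obtain ⟨a, rfl⟩ := B.mkQ_surjective c
          exact ⟨(a, 0), rfl⟩
        · ext v
          constructor
          · rintro ⟨b, rfl⟩; exact ⟨b.1.2, trivial⟩
          · rintro ⟨hb, -⟩; exact ⟨(⟨v.1, hb⟩, v.2), rfl⟩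
        · ext v
          simp [Submodule.mem_prod]
        · intro b
          rfl
        · intro v
          change B.mkQ (y v.1 + (u v.2 : Y)) = B.mkQ (y v.1)
          simp
      · intro a _ b _ hab
        apply LinearMap.ext; intro c
        exact Subtype.ext (LinearMap.congr_fun hab c)
    · intro u _ hu
      refine mul_eq_zero_of_right _ ?_
      by_contra h0
      refine hu ?_
      rw [Finset.mem_image]
      exact ⟨u.codRestrict B (hst u z h0).2, Finset.mem_univ _, rfl⟩
  · refine Finset.sum_eq_zero fun z _ => Finset.sum_eq_zero fun u _ => mul_eq_zero_of_right _ ?_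
    by_contra h0
    exact h (hst u z h0).1

theorem TW_c1 (hα : IsCl α) (hρ : IsCl ρ) (y : Y →ₗ[F] Y) (B : Submodule F Y) (t : Z →ₗ[F] (Y ⧸ B)) :
    TW r α ρ y (LinearMap.ker (B.mkQ ∘ₗ LinearMap.fst F Y Z - t ∘ₗ LinearMap.snd F Y Z)) =
      TW (Z := Z) r α ρ y (B.prod ⊤) := by
  obtain ⟨p, s', -, -, hs, -⟩ := split_exists B
  set s : Z →ₗ[F] Y := s' ∘ₗ t with hsdef
  have hst : ∀ c, B.mkQ (s c) = t c := fun c => hs _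
  let E : (Y × Z) ≃ₗ[F] (Y × Z) := LinearEquiv.ofLinearMap
    (blk LinearMap.id (-s) LinearMap.id) (blk LinearMap.id s LinearMap.id)
    (by apply LinearMap.ext; intro v; simp) (by apply LinearMap.ext; intro v; simp)
  have hE : (LinearMap.ker (B.mkQ ∘ₗ LinearMap.fst F Y Z - t ∘ₗ LinearMap.snd F Y Z)).map E.toLinearMap = B.prod ⊤ := by
    ext v
    rw [Submodule.mem_map_equiv]
    obtain ⟨v, rfl⟩ := E.surjective v
    rw [LinearEquiv.symm_apply_apply, LinearMap.mem_ker, Submodule.mem_prod]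
    change B.mkQ v.1 - t v.2 = 0 ↔ v.1 + -(s v.2) ∈ B ∧ _
    rw [← hst, ← map_sub, ← sub_eq_add_neg, Submodule.mkQ_apply, Submodule.Quotient.mk_eq_zero]
    simp
  unfold TW
  refine Finset.sum_congr rfl fun z _ => ?_
  refine Fintype.sum_bijective (fun u : Z →ₗ[F] Y => u + (y ∘ₗ s - s ∘ₗ z)) (Equiv.addRight _).bijective _ _ fun u => ?_
  congr 1
  rw [← hE]
  refine term_conj hα hρ E _ fun v => ?_
  change ((y v.1 + u v.2) + -(s (z v.2)), z v.2) = (y (v.1 + -(s v.2)) + (u v.2 + (y (s v.2) - s (z v.2))), z v.2)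
  refine Prod.ext ?_ rfl
  simp only [map_add, map_neg]
  abel

open Classical in
theorem sum_c (φ : Submodule F (Y × Z) → ℂ) (ψ : Submodule F Y → ℂ)
    (h : ∀ (B : Submodule F Y) (t : Z →ₗ[F] (Y ⧸ B)),
      φ (LinearMap.ker (B.mkQ ∘ₗ LinearMap.fst F Y Z - t ∘ₗ LinearMap.snd F Y Z)) = ψ B) :
    ∑ W ∈ Finset.univ.filter (fun W : Submodule F (Y × Z) => W.map (LinearMap.snd F Y Z) = ⊤), φ W =
      ∑ B : Submodule F Y, Nat.card (Z →ₗ[F] (Y ⧸ B)) * ψ B := by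
  have : ∑ B : Submodule F Y, (Nat.card (Z →ₗ[F] (Y ⧸ B)) : ℂ) * ψ B = ∑ p : (B : Submodule F Y) × (Z →ₗ[F] (Y ⧸ B)), ψ p.1 := by
    rw [Fintype.sum_sigma]
    refine Finset.sum_congr rfl fun B _ => ?_
    simp [Nat.card_eq_fintype_card]
  rw [this]
  symm
  have hmem : ∀ (p : (B : Submodule F Y) × (Z →ₗ[F] (Y ⧸ B))) (a : Y) (c : Z),
      (a, c) ∈ LinearMap.ker (p.1.mkQ ∘ₗ LinearMap.fst F Y Z - p.2 ∘ₗ LinearMap.snd F Y Z) ↔ p.1.mkQ a = p.2 c := by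
    intro p a c
    rw [LinearMap.mem_ker, LinearMap.sub_apply, sub_eq_zero]; rfl
  refine Finset.sum_bij (fun p _ => LinearMap.ker (p.1.mkQ ∘ₗ LinearMap.fst F Y Z - p.2 ∘ₗ LinearMap.snd F Y Z)) ?_ ?_ ?_ ?_
  · intro p _
    rw [Finset.mem_filter]
    refine ⟨Finset.mem_univ _, ?_⟩
    rw [eq_top_iff]
    intro c _
    obtain ⟨a, ha⟩ := p.1.mkQ_surjective (p.2 c)
    exact ⟨(a, c), (hmem p a c).2 ha, rfl⟩
  · rintro ⟨B, t⟩ _ ⟨B', t'⟩ _ hh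
    have hBB : B = B' := by
      ext b
      have h1 := hmem ⟨B, t⟩ b 0
      have h2 := hmem ⟨B', t'⟩ b 0
      rw [map_zero, Submodule.mkQ_apply, Submodule.Quotient.mk_eq_zero] at h1 h2
      exact h1.symm.trans ((by rw [hh] : _ ↔ _).trans h2)
    subst hBB
    congr 1
    apply LinearMap.ext; intro c
    obtain ⟨a, ha⟩ := B.mkQ_surjective (t c)
    have h1 := (hmem ⟨B, t⟩ a c).2 ha
    rw [hh] at h1
    rw [← ha]
    exact (hmem ⟨B, t'⟩ a c).1 h1
  · intro W hW
    have hW : W.map (LinearMap.snd F Y Z) = ⊤ := by simpa using hW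
    let p : W →ₗ[F] Z := LinearMap.snd F Y Z ∘ₗ W.subtype
    obtain ⟨σ, hσ⟩ := LinearMap.exists_rightInverse_of_surjective p (by
      rw [LinearMap.range_comp, Submodule.range_subtype, hW])
    have hσ' : ∀ c : Z, (σ c : Y × Z).2 = c := fun c => LinearMap.congr_fun hσ c
    refine ⟨⟨W.comap (LinearMap.inl F Y Z), Submodule.mkQ _ ∘ₗ LinearMap.fst F Y Z ∘ₗ W.subtype ∘ₗ σ⟩, Finset.mem_univ _, ?_⟩
    ext ⟨a, c⟩
    rw [hmem]
    change Submodule.mkQ _ a = Submodule.mkQ _ (σ c : Y × Z).1 ↔ _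
    rw [Submodule.mkQ_apply, Submodule.mkQ_apply, Submodule.Quotient.eq, Submodule.mem_comap]
    have : (LinearMap.inl F Y Z) (a - (σ c : Y × Z).1) = (a, c) - (σ c : Y × Z) := by
      refine Prod.ext rfl ?_
      simp [hσ']
    rw [this, Submodule.sub_mem_iff_left _ (σ c).2]
  · intro p _
    exact (h p.1 p.2).symm
end PartB6
set_option linter.unusedSectionVars false
set_option linter.style.haveILetI false

section PartB7
variable {F : Type} [Field F] [Fintype F] [DecidableEq F]
variable {Y : Type} [AddCommGroup Y] [Module F Y] [Finite Y]
variable {Z : Type} [AddCommGroup Z] [Module F Z] [Finite Z]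

theorem card_hom : Nat.card (Z →ₗ[F] Y) = Nat.card F ^ (Module.finrank F Z * Module.finrank F Y) := by
  rw [Module.natCard_eq_pow_finrank (K := F), Module.finrank_linearMap]

theorem card_hom_quot (B : Submodule F Y) :
    Nat.card (Z →ₗ[F] (Y ⧸ B)) * Nat.card (Z →ₗ[F] B) = Nat.card (Z →ₗ[F] Y) := by
  rw [card_hom, card_hom, card_hom, ← pow_add, ← mul_add, Submodule.finrank_quotient_add_finrank]

open Classical in
theorem T_eq {m d d' : ℕ} {α : GL (Fin m) F → ℂ} {ρ : GL (Fin d) F → ℂ} {r : GL (Fin d') F → ℂ}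
    (hα : IsCl α) (hρ : IsCl ρ) (hr : IsCl r) (hKρ : Kill ρ) (hKr : Kill r) (hZ : 0 < Module.finrank F Z)
    (y : Y →ₗ[F] Y) :
    ∑ W : Submodule F (Y × Z), TW r α ρ y W = Nat.card (Z →ₗ[F] Y) * (∑ z : Z →ₗ[F] Z, ev r z * ev ρ z) * ev α y
      + ∑ B : Submodule F Y, Nat.card (Z →ₗ[F] (Y ⧸ B)) * TW (Z := Z) r α ρ y (B.prod ⊤) := by
  haveI : Nontrivial Z := Module.finrank_pos_iff.1 hZ
  rw [← TW_ker hα hρ, ← sum_c (fun W => TW r α ρ y W) (fun B => TW r α ρ y (B.prod ⊤)) (TW_c1 hα hρ y)]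
  have hk : (LinearMap.ker (LinearMap.snd F Y Z)).map (LinearMap.snd F Y Z) = ⊥ := by
    rw [eq_bot_iff, Submodule.map_le_iff_le_comap, Submodule.comap_bot]
  have hnm : LinearMap.ker (LinearMap.snd F Y Z) ∉ Finset.univ.filter (fun W : Submodule F (Y × Z) => W.map (LinearMap.snd F Y Z) = ⊤) := by
    rw [Finset.mem_filter, hk]
    exact fun h => bot_ne_top h.2
  rw [← Finset.sum_insert hnm]
  symm
  refine Finset.sum_subset (Finset.subset_univ _) fun W _ hW => ?_
  rw [Finset.mem_insert, Finset.mem_filter, not_or] at hW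
  by_cases h1 : W.map (LinearMap.snd F Y Z) = ⊥
  · exact TW_b hα hρ hKρ y W hZ h1 hW.1
  · exact TW_a hr hKr y W h1 fun h => hW.2 ⟨Finset.mem_univ _, h⟩

theorem dL_expand {b m d' : ℕ} (ρ' : Ch F d') (α : Ch F m) (hb : Module.finrank F Y = b)
    (hZ : Module.finrank F Z = d') (x : Y →ₗ[F] Y) :
    dL Z (ivf ρ'.1) α.1 x = Nat.card (GL (Fin d') F) * Nat.card (Z →ₗ[F] Y) * ∑ δ : Ch F b, (M δ ρ' α : ℂ) * ev δ.1 x := by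
  rw [endo_expand hb (φ := fun x : Y →ₗ[F] Y => dL Z (ivf ρ'.1) α.1 x) (dL_conj α.isCl) (fun x hx => dL_zero x hx)]
  simp_rw [← S3_eq_dL, S3_M' _ ρ' α hb hZ]
  rw [Finset.mul_sum, Finset.mul_sum]
  refine Finset.sum_congr rfl fun δ _ => ?_
  have h1 := cardC_ne (G := GL (Fin b) F)
  have h2 : Nat.card ((Fin d' → F) →ₗ[F] (Fin b → F)) = Nat.card (Z →ₗ[F] Y) := by
    rw [card_hom, card_hom, hZ, hb]; simp
  rw [cst, h2]
  push_cast
  field_simp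

theorem per_B {m d d' : ℕ} (α : Ch F m) (ρ : Ch F d) (ρ' : Ch F d')
    (hZ : Module.finrank F Z = d') (y : Y →ₗ[F] Y) (B : Submodule F Y) :
    (Nat.card (Z →ₗ[F] (Y ⧸ B)) : ℂ) * TW (Z := Z) (ivf ρ'.1) α.1 ρ.1 y (B.prod ⊤) =
      Nat.card (GL (Fin d') F) * Nat.card (Z →ₗ[F] Y) * ∑ δ : Ch F (m - d'), (M δ ρ' α : ℂ) * term δ.1 ρ.1 B y := by
  rw [TW_c2 α.isCl ρ.isCl]
  split_ifs with h
  · have ht : ∀ δ : Ch F (m - d'), term δ.1 ρ.1 B y = ev δ.1 (y.restrict h) * ev ρ.1 (B.mapQ B y h) := fun δ => by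
      rw [term, dif_pos h]
    simp_rw [ht]
    by_cases hb : Module.finrank F B = m - d'
    · rw [dL_expand ρ' α hb hZ, ← card_hom_quot B]
      push_cast
      simp_rw [← mul_assoc, ← Finset.sum_mul]
      ring
    · rw [Finset.sum_eq_zero (s := Finset.univ) (f := fun δ : Ch F (m - d') => _)]
      · rw [dL_expand ρ' α rfl hZ, Finset.sum_eq_zero]
        · ring
        · intro δ _
          have : M δ ρ' α = 0 := by
            by_contra h0
            have := M_deg h0
            omega
          rw [this]; simp
      · intro δ _
        have : ev δ.1 (y.restrict h) = 0 := by
          by_contra h0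
          exact hb (ev_dim h0).1
        rw [this]; ring
  · rw [Finset.sum_eq_zero]
    · ring
    · intro δ _
      rw [term, dif_neg h, mul_zero]

theorem T_final {m d d' : ℕ} (α : Ch F m) (ρ : Ch F d) (ρ' : Ch F d') (hρ : Cusp ρ) (hρ' : Cusp ρ')
    (hZ : Module.finrank F Z = d') (y : Y →ₗ[F] Y) :
    ∑ z : Z →ₗ[F] Z, ∑ u : Z →ₗ[F] Y, ev (ivf ρ'.1) z * ind α.1 ρ.1 (blk y u z) =
      Nat.card (Z →ₗ[F] Y) * (∑ z : Z →ₗ[F] Z, ev (ivf ρ'.1) z * ev ρ.1 z) * ev α.1 y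
      + Nat.card (GL (Fin d') F) * Nat.card (Z →ₗ[F] Y) * ∑ δ : Ch F (m - d'), (M δ ρ' α : ℂ) * ind δ.1 ρ.1 y := by
  have h1 : ∑ z : Z →ₗ[F] Z, ∑ u : Z →ₗ[F] Y, ev (ivf ρ'.1) z * ind α.1 ρ.1 (blk y u z) =
      ∑ W : Submodule F (Y × Z), TW (ivf ρ'.1) α.1 ρ.1 y W := by
    unfold ind TW
    simp_rw [Finset.mul_sum]
    rw [Finset.sum_comm (s := (Finset.univ : Finset (Submodule F (Y × Z))))]
    refine Finset.sum_congr rfl fun z _ => ?_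
    exact Finset.sum_comm
  rw [h1, T_eq α.isCl ρ.isCl ρ'.isCl.ivf hρ.kill hρ'.kill' (by rw [hZ]; exact hρ'.1)]
  congr 1
  simp_rw [per_B α ρ ρ' hZ, ← Finset.mul_sum]
  congr 1
  unfold ind
  simp_rw [Finset.mul_sum]
  exact Finset.sum_comm

theorem orth_ev {m : ℕ} (β α : Ch F m) (hV : Module.finrank F Y = m) :
    ∑ y : Y →ₗ[F] Y, ev (ivf β.1) y * ev α.1 y = if α = β then (Nat.card (GL (Fin m) F) : ℂ) else 0 := by
  let e : Y ≃ₗ[F] (Fin m → F) := LinearEquiv.ofFinrankEq _ _ (by simpa using hV)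
  rw [sum_ev β.isCl.ivf e]
  simp_rw [ev_lin α.isCl]
  have := α.2.orth β.2
  simp_rw [mul_comm (ivf _ _)]
  rw [show (∑ g, α.1 g * ivf β.1 g) = ∑ g, α.1 g * β.1 g⁻¹ from rfl, this]
  simp only [Subtype.ext_iff]

theorem Heis0 {m d m' d' n : ℕ} (α : Ch F m) (ρ : Ch F d) (β : Ch F m') (ρ' : Ch F d')
    (hρ : Cusp ρ) (hρ' : Cusp ρ') (hn : n = m + d) (hn' : n = m' + d') :
    (Nat.card (GL (Fin m') F) * Nat.card (GL (Fin d') F) : ℂ) * ∑ χ : Ch F n, (M α ρ χ : ℂ) * M β ρ' χ =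
      (∑ z : (Fin d' → F) →ₗ[F] (Fin d' → F), ev (ivf ρ'.1) z * ev ρ.1 z) *
        (∑ y : (Fin m' → F) →ₗ[F] (Fin m' → F), ev (ivf β.1) y * ev α.1 y) +
      Nat.card (GL (Fin m') F) * Nat.card (GL (Fin d') F) * ∑ δ : Ch F (m - d'), (M δ ρ' α : ℂ) * M δ ρ β := by
  set Y := Fin m' → F
  set Z := Fin d' → F
  have hY : Module.finrank F Y = m' := by simp [Y]
  have hZ : Module.finrank F Z = d' := by simp [Z]
  have hYZ : Module.finrank F (Y × Z) = n := by rw [Module.finrank_prod, hY, hZ, hn']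
  have key : ∑ y : Y →ₗ[F] Y, ev (ivf β.1) y * ∑ z : Z →ₗ[F] Z, ∑ u : Z →ₗ[F] Y, ev (ivf ρ'.1) z * ind α.1 ρ.1 (blk y u z) =
      cst F m' d' * ∑ χ : Ch F n, (M α ρ χ : ℂ) * M β ρ' χ := by
    simp_rw [ind_expand α ρ hn hYZ, Finset.mul_sum]
    have : ∀ χ : Ch F n, (cst F m' d' : ℂ) * ((M α ρ χ : ℂ) * M β ρ' χ) = 
        ∑ y : Y →ₗ[F] Y, ∑ z : Z →ₗ[F] Z, ∑ u : Z →ₗ[F] Y, ev (ivf β.1) y * (ev (ivf ρ'.1) z * (M α ρ χ * ev χ.1 (blk y u z))) := by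
      intro χ
      rw [mul_left_comm, ← S3_M' (V := Y) (W := Z) β ρ' χ hY hZ, S3]
      simp_rw [Finset.mul_sum]
      refine Finset.sum_congr rfl fun y _ => Finset.sum_congr rfl fun z _ => Finset.sum_congr rfl fun u _ => ?_
      ring
    simp_rw [this]
    rw [Finset.sum_comm (s := (Finset.univ : Finset (Ch F n)))]
    refine Finset.sum_congr rfl fun y _ => ?_
    rw [Finset.sum_comm (s := (Finset.univ : Finset (Ch F n)))]
    refine Finset.sum_congr rfl fun z _ => ?_
    exact Finset.sum_comm
  simp_rw [T_final α ρ ρ' hρ hρ' hZ, mul_add, Finset.sum_add_distrib] at key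
  have k2 : ∑ y : Y →ₗ[F] Y, ev (ivf β.1) y * (Nat.card (GL (Fin d') F) * Nat.card (Z →ₗ[F] Y) * ∑ δ : Ch F (m - d'), (M δ ρ' α : ℂ) * ind δ.1 ρ.1 y)
      = Nat.card (GL (Fin d') F) * Nat.card (Z →ₗ[F] Y) * (Nat.card (GL (Fin m') F) * ∑ δ : Ch F (m - d'), (M δ ρ' α : ℂ) * M δ ρ β) := by
    simp_rw [mul_left_comm (ev (ivf β.1) _), ← Finset.mul_sum]
    congr 1
    simp_rw [Finset.mul_sum]
    rw [Finset.sum_comm]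
    refine Finset.sum_congr rfl fun δ _ => ?_
    by_cases h0 : M δ ρ' α = 0
    · simp [h0]
    · have := M_deg h0
      simp_rw [mul_left_comm (ev (ivf β.1) _), ← Finset.mul_sum]
      rw [sum_ind δ ρ β (by omega) hY]
      ring
  have k1 : ∑ y : Y →ₗ[F] Y, ev (ivf β.1) y * (Nat.card (Z →ₗ[F] Y) * (∑ z : Z →ₗ[F] Z, ev (ivf ρ'.1) z * ev ρ.1 z) * ev α.1 y)
      = Nat.card (Z →ₗ[F] Y) * ((∑ z : Z →ₗ[F] Z, ev (ivf ρ'.1) z * ev ρ.1 z) * ∑ y : Y →ₗ[F] Y, ev (ivf β.1) y * ev α.1 y) := by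
    simp_rw [mul_left_comm (ev (ivf β.1) _), ← Finset.mul_sum]
    ring
  rw [k1, k2] at key
  have h0 : (Nat.card (Z →ₗ[F] Y) : ℂ) ≠ 0 := by
    rw [Nat.cast_ne_zero]; exact Nat.card_pos.ne'
  apply mul_left_cancel₀ h0
  rw [mul_add, ← sub_eq_zero]
  rw [← sub_eq_zero, cst] at key
  push_cast at key
  rw [← neg_eq_zero, ← key]
  ring

theorem H1 {m d : ℕ} (ρ : Ch F d) (hρ : Cusp ρ) (α β : Ch F m) [Decidable (α = β)] :
    ∑ χ : Ch F (m + d), M α ρ χ * M β ρ χ = (if α = β then 1 else 0) + ∑ δ : Ch F (m - d), M δ ρ α * M δ ρ β := by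
  have h := Heis0 α ρ β ρ hρ hρ rfl rfl
  rw [orth_ev ρ ρ (by simp), orth_ev β α (by simp), if_pos rfl] at h
  have h1 := cardC_ne (G := GL (Fin m) F)
  have h2 := cardC_ne (G := GL (Fin d) F)
  have : ((∑ χ : Ch F (m + d), M α ρ χ * M β ρ χ : ℕ) : ℂ) = (((if α = β then 1 else 0) + ∑ δ : Ch F (m - d), M δ ρ α * M δ ρ β : ℕ) : ℂ) := by
    push_cast
    apply mul_left_cancel₀ (mul_ne_zero h1 h2)
    rw [h]
    split_ifs <;> ring
  exact_mod_cast this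

theorem H2 {m d m' d' n : ℕ} (ρ : Ch F d) (hρ : Cusp ρ) (ρ' : Ch F d') (hρ' : Cusp ρ') (α : Ch F m) (β : Ch F m')
    (hn : n = m + d) (hn' : n = m' + d') (hne : (⟨d, ρ⟩ : Σ d, Ch F d) ≠ ⟨d', ρ'⟩) :
    ∑ χ : Ch F n, M α ρ χ * M β ρ' χ = ∑ δ : Ch F (m - d'), M δ ρ' α * M δ ρ β := by
  have h := Heis0 α ρ β ρ' hρ hρ' hn hn'
  have hP : (∑ z : (Fin d' → F) →ₗ[F] (Fin d' → F), ev (ivf ρ'.1) z * ev ρ.1 z) = 0 := by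
    by_cases hd : d = d'
    · subst hd
      rw [orth_ev ρ' ρ (by simp), if_neg]
      rintro rfl
      exact hne rfl
    · refine Finset.sum_eq_zero fun z _ => mul_eq_zero_of_right _ ?_
      by_contra h0
      have := (ev_dim h0).1
      simp at this
      exact hd this.symm
  rw [hP, zero_mul, zero_add] at h
  have := mul_left_cancel₀ (mul_ne_zero (cardC_ne (G := GL (Fin m') F)) (cardC_ne (G := GL (Fin d') F))) h
  exact_mod_cast this
end PartB7
set_option linter.unusedSectionVars false
set_option linter.style.haveILetI false

section PartB8
variable {F : Type} [Field F] [Fintype F] [DecidableEq F]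

instance chNonempty (n : ℕ) : Nonempty (Ch F n) := by
  have h : 0 < Nat.card (Ch F n) := by
    rw [card_irr_eq]
    exact Nat.card_pos
  exact (Nat.card_pos_iff.1 h).1

theorem M_zero_left {d : ℕ} (δ : Ch F 0) (ρ χ : Ch F d) : M δ ρ χ ≠ 0 ↔ ρ = χ := by
  have h := S3_M (V := Fin 0 → F) (W := Fin d → F) δ ρ χ (by simp) (by simp)
  have h2 : S3 (Fin 0 → F) (Fin d → F) δ.1 ρ.1 (ivf χ.1) = δ.1 1 * ∑ y : (Fin d → F) →ₗ[F] (Fin d → F), ev (ivf χ.1) y * ev ρ.1 y := by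
    have hsub : Subsingleton ((Fin 0 → F) →ₗ[F] (Fin 0 → F)) := ⟨fun a b => LinearMap.ext fun v => Subsingleton.elim _ _⟩
    have hsub' : Subsingleton ((Fin d → F) →ₗ[F] (Fin 0 → F)) := ⟨fun a b => LinearMap.ext fun v => Subsingleton.elim _ _⟩
    rw [S3, Fintype.sum_subsingleton _ (LinearMap.id : (Fin 0 → F) →ₗ[F] (Fin 0 → F)), Finset.mul_sum]
    refine Finset.sum_congr rfl fun y _ => ?_
    rw [Fintype.sum_subsingleton _ (0 : (Fin d → F) →ₗ[F] (Fin 0 → F))]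
    have e1 : ev δ.1 (LinearMap.id : (Fin 0 → F) →ₗ[F] (Fin 0 → F)) = δ.1 1 := by
      have := ev_lin δ.isCl (LinearEquiv.refl F (Fin 0 → F)) 1
      rw [map_one] at this
      exact this
    have e2 : ev (ivf χ.1) (blk (LinearMap.id : (Fin 0 → F) →ₗ[F] (Fin 0 → F)) 0 y) = ev (ivf χ.1) y := by
      let E : ((Fin 0 → F) × (Fin d → F)) ≃ₗ[F] (Fin d → F) := LinearEquiv.ofBijective (LinearMap.snd F (Fin 0 → F) (Fin d → F))
        ⟨fun a b hab => Prod.ext (Subsingleton.elim _ _) hab, LinearMap.snd_surjective⟩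
      exact ev_conj χ.isCl.ivf E fun v => by
        change (blk (LinearMap.id : (Fin 0 → F) →ₗ[F] (Fin 0 → F)) 0 y v).2 = y v.2
        rw [blk_apply]
    rw [e1, e2]; ring
  rw [h2, orth_ev χ ρ (by simp)] at h
  have hc := cst_pos (F := F) 0 d
  obtain ⟨k, hk, hk'⟩ := δ.2.deg_pos
  have h3 := cardC_ne (G := GL (Fin d) F)
  constructor
  · intro h0
    by_contra hne
    rw [if_neg hne, mul_zero] at h
    have : (cst F 0 d * M δ ρ χ : ℕ) = 0 := by exact_mod_cast h.symm
    rcases Nat.mul_eq_zero.1 this with h | h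
    · omega
    · exact h0 h
  · rintro rfl h0
    rw [if_pos rfl, h0, hk'] at h
    simp only [Nat.cast_zero, mul_zero] at h
    rcases mul_eq_zero.1 h with h | h
    · have : k = 0 := by exact_mod_cast h
      omega
    · exact h3 h

/-- the key commutation for two different cuspidals -/
theorem cusp_comm {d d' : ℕ} {ρ : Ch F d} {ρ' : Ch F d'} (hρ : Cusp ρ) (hρ' : Cusp ρ')
    (hne : (⟨d, ρ⟩ : Σ d, Ch F d) ≠ ⟨d', ρ'⟩) (γ : Ch F (d + d')) (h : M ρ ρ' γ ≠ 0) : M ρ' ρ γ ≠ 0 := by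
  classical
  have h1 := H1 ρ' hρ' ρ ρ
  have h2 := H2 (n := d + d') ρ' hρ' ρ hρ ρ ρ' rfl (by omega) hne.symm
  rw [if_pos rfl, Finset.sum_eq_zero (s := Finset.univ) (f := fun δ : Ch F (d - d') => M δ ρ' ρ * M δ ρ' ρ)] at h1
  · have hpos : 0 < ∑ χ : Ch F (d + d'), M ρ ρ' χ * M ρ' ρ χ := by
      rw [h2]
      have hdd : d - d = 0 := by omega
      obtain ⟨δ⟩ := chNonempty (F := F) (d - d)
      refine Finset.sum_pos' (fun _ _ => Nat.zero_le _) ⟨δ, Finset.mem_univ _, ?_⟩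
      revert δ
      rw [hdd]
      intro δ
      exact Nat.mul_pos (Nat.pos_of_ne_zero ((M_zero_left δ ρ ρ).2 rfl)) (Nat.pos_of_ne_zero ((M_zero_left δ ρ' ρ').2 rfl))
    obtain ⟨χ, -, hχ⟩ := Finset.exists_ne_zero_of_sum_ne_zero hpos.ne'
    have hχ1 := left_ne_zero_of_mul hχ
    have hχ2 := right_ne_zero_of_mul hχ
    by_cases hγ : γ = χ
    · rw [hγ]; exact hχ2
    · exfalso
      have h3 : ∑ χ' ∈ {γ, χ}, M ρ ρ' χ' * M ρ ρ' χ' ≤ ∑ χ' : Ch F (d + d'), M ρ ρ' χ' * M ρ ρ' χ' :=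
        Finset.sum_le_sum_of_subset (Finset.subset_univ _)
      rw [h1, Finset.sum_pair hγ] at h3
      have := Nat.mul_pos (Nat.pos_of_ne_zero h) (Nat.pos_of_ne_zero h)
      have := Nat.mul_pos (Nat.pos_of_ne_zero hχ1) (Nat.pos_of_ne_zero hχ1)
      omega
  · intro δ _
    by_contra h0
    have h0 := left_ne_zero_of_mul h0
    have hdeg := M_deg h0
    by_cases hd : d - d' = 0
    · have : d = d' := by omega
      subst this
      revert δ
      rw [hd]
      intro δ _ _ h0
      rw [M_zero_left] at h0
      exact hne (by rw [h0])
    · exact h0 (hρ.2 _ _ δ ρ' (by omega) hρ'.1)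

abbrev XX (F : Type) [Field F] [Fintype F] [DecidableEq F] := Σ n, Ch F n

def RR (r a c : XX F) : Prop := M a.2 r.2 c.2 ≠ 0

def CC (r : XX F) : Prop := Cusp r.2

theorem RR_deg {r a c : XX F} (h : RR r a c) : c.1 = a.1 + r.1 := M_deg h

theorem RR_assoc (a b c x : XX F) :
    (∃ g, RR g a x ∧ RR c b g) ↔ (∃ z, RR b a z ∧ RR c z x) := by
  have h := M_assoc a.2 b.2 c.2 x.2
  constructor
  · rintro ⟨g, h1, h2⟩
    obtain ⟨n, g⟩ := g
    have hd : n = b.1 + c.1 := RR_deg h2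
    subst hd
    obtain ⟨z, h3, h4⟩ := h.1 ⟨g, h1, h2⟩
    exact ⟨⟨_, z⟩, h3, h4⟩
  · rintro ⟨z, h1, h2⟩
    obtain ⟨n, z⟩ := z
    have hd : n = a.1 + b.1 := RR_deg h1
    subst hd
    obtain ⟨g, h3, h4⟩ := h.2 ⟨z, h1, h2⟩
    exact ⟨⟨_, g⟩, h3, h4⟩

theorem RR_swap {r r' b a c : XX F} (hr : CC r) (hr' : CC r') (hne : r ≠ r') (h1 : RR r b a) (h2 : RR r' a c) :
    ∃ z, RR r' b z ∧ RR r z c := by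
  obtain ⟨g, h3, h4⟩ := (RR_assoc b r r' c).2 ⟨a, h1, h2⟩
  refine (RR_assoc b r' r c).1 ⟨g, h3, ?_⟩
  obtain ⟨n, g⟩ := g
  have hd : n = r.1 + r'.1 := RR_deg h4
  subst hd
  exact cusp_comm hr hr' hne g h4

def Pth : List (XX F) → XX F → XX F → Prop
  | [], a, c => a = c
  | r :: w, a, c => ∃ z, RR r a z ∧ Pth w z c

theorem Pth_append (w w' : List (XX F)) (a c : XX F) : Pth (w ++ w') a c ↔ ∃ b, Pth w a b ∧ Pth w' b c := by
  induction w generalizing a with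
  | nil => simp [Pth]
  | cons r w ih =>
    simp only [List.cons_append, Pth, ih]
    constructor
    · rintro ⟨z, h1, b, h2, h3⟩; exact ⟨b, ⟨z, h1, h2⟩, h3⟩
    · rintro ⟨b, ⟨z, h1, h2⟩, h3⟩; exact ⟨z, h1, b, h2, h3⟩

theorem Pth_exists (k : ℕ) : ∀ (g a c : XX F), g.1 = k → 0 < k → RR g a c →
    ∃ w : List (XX F), (∀ r ∈ w, CC r) ∧ (w.map Sigma.fst).sum = k ∧ Pth w a c := by
  induction k using Nat.strong_induction_on with
  | _ k ih =>
    intro g a c hg hk h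
    by_cases hC : CC g
    · exact ⟨[g], by simpa using hC, by simpa using hg, c, h, rfl⟩
    · have : ∃ b b' : XX F, 0 < b.1 ∧ 0 < b'.1 ∧ RR b' b g := by
        by_contra hcon
        refine hC ⟨by omega, fun i j α β hi hj => ?_⟩
        by_contra h0
        exact hcon ⟨⟨i, α⟩, ⟨j, β⟩, hi, hj, h0⟩
      obtain ⟨b, b', hb, hb', hbb⟩ := this
      have hd := RR_deg hbb
      obtain ⟨z, h1, h2⟩ := (RR_assoc a b b' c).1 ⟨g, h, hbb⟩
      obtain ⟨w1, p1, p2, p3⟩ := ih b.1 (by omega) b a z rfl hb h1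
      obtain ⟨w2, q1, q2, q3⟩ := ih b'.1 (by omega) b' z c rfl hb' h2
      refine ⟨w1 ++ w2, ?_, ?_, (Pth_append _ _ _ _).2 ⟨z, p3, q3⟩⟩
      · intro r hr
        rcases List.mem_append.1 hr with hr | hr
        · exact p1 r hr
        · exact q1 r hr
      · rw [List.map_append, List.sum_append, p2, q2]; omega

def Lv (r : XX F) : ℕ → XX F → Prop
  | 0, _ => True
  | s + 1, c => ∃ a, RR r a c ∧ Lv r s a

theorem Lv_swap {r r' : XX F} (hr : CC r) (hr' : CC r') (hne : r ≠ r') (s : ℕ) :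
    ∀ (a c : XX F), Lv r s a → RR r' a c → Lv r s c := by
  induction s with
  | zero => intro a c _ _; trivial
  | succ s ih =>
    rintro a c ⟨b, hb, hs⟩ h
    obtain ⟨z, h1, h2⟩ := RR_swap hr hr' hne hb h
    exact ⟨z, h2, ih b z hs h1⟩

open Classical in
theorem Lv_of_Pth {r : XX F} (hr : CC r) (w : List (XX F)) (hw : ∀ x ∈ w, CC x) :
    ∀ (t : ℕ) (a c : XX F), Pth w a c → Lv r t a → Lv r (w.count r + t) c := by
  induction w with
  | nil => rintro t a c rfl h; simpa using h
  | cons x w ih =>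
    rintro t a c ⟨z, h1, h2⟩ h
    have ihw := ih fun y hy => hw y (List.mem_cons_of_mem _ hy)
    by_cases hx : x = r
    · subst hx
      have := ihw (t + 1) z c h2 ⟨a, h1, h⟩
      rw [List.count_cons_self, add_assoc, add_comm 1 t]
      exact this
    · rw [List.count_cons_of_ne hx]
      exact ihw t z c h2 (Lv_swap hr (hw x List.mem_cons_self) (Ne.symm hx) t a z h h1)

end PartB8
set_option linter.unusedSectionVars false
set_option linter.style.haveILetI false

section PartC1
variable {C : ℕ → Type} [∀ n, Fintype (C n)]

open Classical in
structure HeisD (N : ∀ m n, C m → C n → ℕ) (d : ℕ) (L : ℕ → ∀ n, C n → Prop) : Prop where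
  dpos : 0 < d
  deg : ∀ m n (a : C m) (c : C n), N m n a c ≠ 0 → n = m + d
  heis : ∀ m (a b : C m), ∑ c : C (m + d), N _ _ a c * N _ _ b c = (if a = b then 1 else 0) + ∑ e : C (m - d), N _ _ e a * N _ _ e b
  L0 : ∀ n (c : C n), L 0 n c
  L1 : ∀ s n (c : C n), L (s + 1) n c ↔ ∃ m, ∃ a : C m, N m n a c ≠ 0 ∧ L s m a

variable {N : ∀ m n, C m → C n → ℕ} {d : ℕ} {L : ℕ → ∀ n, C n → Prop}

def dd (N : ∀ m n, C m → C n → ℕ) (d : ℕ) {n : ℕ} (c : C n) : ℕ := ∑ a : C (n - d), N _ _ a c * N _ _ a c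

theorem dd_eq {m : ℕ} (c : C (m + d)) : dd N d c = ∑ a : C m, N _ _ a c * N _ _ a c := by
  unfold dd
  have : m + d - d = m := by omega
  rw [this]

namespace HeisD
variable (H : HeisD N d L)
include H

theorem up {m : ℕ} (a : C m) : ∑ c : C (m + d), N _ _ a c * N _ _ a c = 1 + dd N d a := by
  rw [H.heis, if_pos rfl]; rfl

theorem common_down {m n : ℕ} {a b : C m} {c : C n} (hab : a ≠ b) (ha : N _ _ a c ≠ 0) (hb : N _ _ b c ≠ 0) :
    ∃ e : C (m - d), N _ _ e a ≠ 0 ∧ N _ _ e b ≠ 0 := by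
  have := H.deg _ _ _ _ ha
  subst this
  have h := H.heis m a b
  rw [if_neg hab, zero_add] at h
  have hpos : 0 < ∑ c : C (m + d), N _ _ a c * N _ _ b c :=
    Finset.sum_pos' (fun _ _ => Nat.zero_le _) ⟨c, Finset.mem_univ _, Nat.mul_pos (Nat.pos_of_ne_zero ha) (Nat.pos_of_ne_zero hb)⟩
  rw [h] at hpos
  obtain ⟨e, -, he⟩ := Finset.exists_ne_zero_of_sum_ne_zero hpos.ne'
  exact ⟨e, left_ne_zero_of_mul he, right_ne_zero_of_mul he⟩

theorem common_up {m k : ℕ} {a b : C m} {e : C k} (hab : a ≠ b) (ha : N _ _ e a ≠ 0) (hb : N _ _ e b ≠ 0) :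
    ∃ c : C (m + d), N _ _ a c ≠ 0 ∧ N _ _ b c ≠ 0 := by
  have h1 := H.deg _ _ _ _ ha
  have h2 : k = m - d := by omega
  subst h2
  have h := H.heis m a b
  rw [if_neg hab, zero_add] at h
  have hpos : 0 < ∑ e : C (m - d), N _ _ e a * N _ _ e b :=
    Finset.sum_pos' (fun _ _ => Nat.zero_le _) ⟨e, Finset.mem_univ _, Nat.mul_pos (Nat.pos_of_ne_zero ha) (Nat.pos_of_ne_zero hb)⟩
  rw [← h] at hpos
  obtain ⟨c, -, hc⟩ := Finset.exists_ne_zero_of_sum_ne_zero hpos.ne'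
  exact ⟨c, left_ne_zero_of_mul hc, right_ne_zero_of_mul hc⟩

theorem down (s : ℕ) : ∀ {m n : ℕ} (a : C m) (c : C n), L (s + 1) n c → N _ _ a c ≠ 0 → L s m a := by
  induction s with
  | zero => intro m n a c _ _; exact H.L0 _ _
  | succ s ih =>
    intro m n a c hc hac
    obtain ⟨m', b, hbc, hb⟩ := (H.L1 _ _ _).1 hc
    have : m' = m := by
      have := H.deg _ _ _ _ hac
      have := H.deg _ _ _ _ hbc
      omega
    subst this
    by_cases hab : a = b
    · rw [hab]; exact hb
    · obtain ⟨e, h1, h2⟩ := H.common_down hab hac hbc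
      exact (H.L1 _ _ _).2 ⟨_, e, h1, ih e b hb h2⟩

theorem dd_pos {n : ℕ} {c : C n} (hc : L 1 n c) : 1 ≤ dd N d c := by
  obtain ⟨m, a, h, -⟩ := (H.L1 _ _ _).1 hc
  have := H.deg _ _ _ _ h
  subst this
  rw [dd_eq]
  have := Finset.single_le_sum (s := Finset.univ) (f := fun a : C m => N _ _ a c * N _ _ a c) (fun _ _ => Nat.zero_le _) (Finset.mem_univ a)
  have h2 := Nat.mul_pos (Nat.pos_of_ne_zero h) (Nat.pos_of_ne_zero h)
  omega

theorem L_one (s : ℕ) {n : ℕ} {c : C n} (hc : L (s + 1) n c) : L 1 n c := by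
  obtain ⟨m, a, h, -⟩ := (H.L1 _ _ _).1 hc
  exact (H.L1 _ _ _).2 ⟨m, a, h, H.L0 _ _⟩

theorem L_deg (s : ℕ) : ∀ {n : ℕ} {c : C n}, L s n c → s * d ≤ n := by
  induction s with
  | zero => intro n c _; simp
  | succ s ih =>
    intro n c hc
    obtain ⟨m, a, h, h'⟩ := (H.L1 _ _ _).1 hc
    have := H.deg _ _ _ _ h
    have := ih h'
    rw [add_mul]; omega
end HeisD

open Classical in
noncomputable def Ls (L : ℕ → ∀ n, C n → Prop) (s n : ℕ) : Finset (C n) := Finset.univ.filter (L s n)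
noncomputable def An (L : ℕ → ∀ n, C n → Prop) (s n : ℕ) : ℕ := (Ls L s n).card
noncomputable def En (N : ∀ m n, C m → C n → ℕ) (d : ℕ) (L : ℕ → ∀ n, C n → Prop) (s n : ℕ) : ℕ :=
  ∑ c ∈ Ls L s n, dd N d c
open Classical in
noncomputable def On (N : ∀ m n, C m → C n → ℕ) (d : ℕ) (L : ℕ → ∀ n, C n → Prop) (s n : ℕ) : ℕ :=
  ((Ls L s n).filter fun c => dd N d c = 1).card

theorem mem_Ls {s n : ℕ} {c : C n} : c ∈ Ls L s n ↔ L s n c := by simp [Ls]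

namespace HeisD
variable (H : HeisD N d L)
include H

/-- rewriting sums over edges -/
theorem edge_sum (s m : ℕ) (φ : C m → C (m + d) → ℕ) (hφ : ∀ a c, N _ _ a c = 0 → φ a c = 0) :
    ∑ c ∈ Ls L (s + 1) (m + d), ∑ a : C m, φ a c = ∑ a ∈ Ls L s m, ∑ c : C (m + d), φ a c := by
  have e1 : ∑ c ∈ Ls L (s + 1) (m + d), ∑ a : C m, φ a c = ∑ c ∈ Ls L (s + 1) (m + d), ∑ a ∈ Ls L s m, φ a c := by
    refine Finset.sum_congr rfl fun c hc => ?_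
    symm
    refine Finset.sum_subset (Finset.subset_univ _) fun a _ ha => ?_
    apply hφ
    by_contra h
    exact ha (mem_Ls.2 (H.down s a c (mem_Ls.1 hc) h))
  rw [e1, Finset.sum_comm]
  refine Finset.sum_congr rfl fun a ha => ?_
  refine Finset.sum_subset (Finset.subset_univ _) fun c _ hc => ?_
  apply hφ
  by_contra h
  exact hc (mem_Ls.2 ((H.L1 _ _ _).2 ⟨m, a, h, mem_Ls.1 ha⟩))

theorem E_succ (s m : ℕ) : En N d L (s + 1) (m + d) = An L s m + En N d L s m := by
  unfold En An
  simp_rw [dd_eq]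
  rw [H.edge_sum s m (fun a c => N _ _ a c * N _ _ a c) (fun a c h => by simp [h])]
  simp_rw [H.up]
  rw [Finset.sum_add_distrib]; simp

theorem A_le_E (s n : ℕ) : An L (s + 1) n ≤ En N d L (s + 1) n := by
  unfold An En
  rw [Finset.card_eq_sum_ones]
  exact Finset.sum_le_sum fun c hc => H.dd_pos (H.L_one s (mem_Ls.1 hc))

theorem E_zero (n : ℕ) : En N d L 0 n = En N d L 1 n := by
  unfold En
  symm
  refine Finset.sum_subset (fun c _ => mem_Ls.2 (H.L0 _ _)) fun c _ hc => ?_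
  refine Finset.sum_eq_zero fun a _ => ?_
  by_contra h
  exact hc (mem_Ls.2 ((H.L1 _ _ _).2 ⟨_, a, left_ne_zero_of_mul h, H.L0 _ _⟩))

theorem two_A (s n : ℕ) : 2 * An L (s + 1) n ≤ En N d L (s + 1) n + On N d L (s + 1) n := by
  classical
  unfold An En On
  rw [Finset.card_filter, ← Finset.sum_add_distrib, mul_comm, ← smul_eq_mul, ← Finset.sum_const]
  refine Finset.sum_le_sum fun c hc => ?_
  have := H.dd_pos (H.L_one s (mem_Ls.1 hc))
  split_ifs <;> omega

theorem sum_two {ι : Type} [Fintype ι] (f : ι → ℕ) {a b : ι} (hab : a ≠ b) (ha : f a ≠ 0) (hb : f b ≠ 0) :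
    2 ≤ ∑ i, f i * f i := by
  classical
  have h3 : ∑ i ∈ {a, b}, f i * f i ≤ ∑ i, f i * f i :=
    Finset.sum_le_sum_of_subset (Finset.subset_univ _)
  rw [Finset.sum_pair hab] at h3
  have := Nat.mul_pos (Nat.pos_of_ne_zero ha) (Nat.pos_of_ne_zero ha)
  have := Nat.mul_pos (Nat.pos_of_ne_zero hb) (Nat.pos_of_ne_zero hb)
  omega

/-- an element with a single down (deep enough) has an up with two downs -/
theorem exists_up (s m : ℕ) (a : C m) (ha : L (s + 2) m a) (h1 : dd N d a = 1) :
    ∃ c : C (m + d), N _ _ a c ≠ 0 ∧ dd N d c ≠ 1 := by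
  obtain ⟨k, b, hb, hb'⟩ := (H.L1 _ _ _).1 ha
  have := H.deg _ _ _ _ hb
  subst this
  have h2 := H.dd_pos (H.L_one s hb')
  have h3 := H.up b
  have h4 : N _ _ b a * N _ _ b a ≤ 1 := by
    rw [← h1, dd_eq]
    exact Finset.single_le_sum (s := Finset.univ) (f := fun b : C k => N _ _ b a * N _ _ b a) (fun _ _ => Nat.zero_le _) (Finset.mem_univ b)
  have : ∃ a' : C (k + d), a' ≠ a ∧ N _ _ b a' ≠ 0 := by
    by_contra hcon
    push Not at hcon
    rw [Finset.sum_eq_single a (fun x _ h => by rw [hcon x h, mul_zero]) (fun h => absurd (Finset.mem_univ _) h)] at h3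
    omega
  obtain ⟨a', hne, ha'⟩ := this
  obtain ⟨c, hc, hc'⟩ := H.common_up hne.symm hb ha'
  refine ⟨c, hc, ?_⟩
  rw [dd_eq]
  have := H.sum_two (fun x => N (k + d) _ x c) hne.symm hc hc'
  intro h
  rw [h] at this
  omega

theorem O_succ (s m : ℕ) : On N d L (s + 3) (m + d) + On N d L (s + 2) m ≤ En N d L (s + 3) (m + d) := by
  classical
  have e0 : On N d L (s + 3) (m + d) ≤ ∑ a ∈ Ls L (s + 2) m, ∑ c : C (m + d), if dd N d c = 1 then N _ _ a c * N _ _ a c else 0 := by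
    rw [← H.edge_sum (s + 2) m (fun a c => if dd N d c = 1 then N _ _ a c * N _ _ a c else 0) (fun a c h => by simp [h])]
    unfold On
    rw [Finset.card_filter]
    refine Finset.sum_le_sum fun c _ => ?_
    split_ifs with h
    · rw [← dd_eq, h]
    · simp
  have e1 : En N d L (s + 3) (m + d) = ∑ a ∈ Ls L (s + 2) m, ∑ c : C (m + d), N _ _ a c * N _ _ a c := by
    unfold En
    simp_rw [dd_eq]
    rw [H.edge_sum (s + 2) m (fun a c => N _ _ a c * N _ _ a c) (fun a c h => by simp [h])]
  rw [e1]
  refine (Nat.add_le_add_right e0 _).trans ?_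
  unfold On
  rw [Finset.card_filter, ← Finset.sum_add_distrib]
  refine Finset.sum_le_sum fun a ha => ?_
  split_ifs with h
  · obtain ⟨c, hc, hc'⟩ := H.exists_up s m a (mem_Ls.1 ha) h
    rw [← Nat.lt_iff_add_one_le]
    refine Finset.sum_lt_sum (fun x _ => by split_ifs <;> simp) ⟨c, Finset.mem_univ _, ?_⟩
    rw [if_neg hc']
    exact Nat.mul_pos (Nat.pos_of_ne_zero hc) (Nat.pos_of_ne_zero hc)
  · rw [add_zero]
    exact Finset.sum_le_sum fun x _ => by split_ifs <;> simp

theorem E_rec (s m : ℕ) : 2 * En N d L (s + 4) (m + d + d) ≤ 2 * En N d L (s + 3) (m + d) + 3 * En N d L (s + 2) m := by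
  have h1 := H.E_succ (s + 3) (m + d)
  have h2 := H.two_A (s + 2) (m + d)
  have h3 := H.O_succ s m
  have h4 := H.E_succ (s + 2) m
  have h5 := H.two_A (s + 1) m
  simp only [add_assoc] at *
  norm_num at *
  omega

theorem E_bound (K : ℕ → ℝ) (hK : ∀ m, (Fintype.card (C m) : ℝ) ≤ K m) (hK2 : ∀ m, 2 * K m ≤ K (m + d)) (s : ℕ) :
    ∀ m, (En N d L s (m + s * d) : ℝ) ≤ 8 * 1.9 ^ s * K m := by
  have hK0 : ∀ m, 0 ≤ K m := fun m => le_trans (Nat.cast_nonneg _) (hK m)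
  have hA0 : ∀ m, (An L 0 m : ℝ) ≤ K m := fun m => le_trans (by
    exact_mod_cast Finset.card_le_univ _) (hK m)
  have hE0 : ∀ m, (En N d L 0 m : ℝ) ≤ K m := by
    intro m
    induction m using Nat.strong_induction_on with
    | _ m ih =>
      by_cases hm : m < d
      · have : En N d L 0 m = 0 := by
          rw [H.E_zero]
          refine Finset.sum_eq_zero fun c hc => ?_
          have := H.L_deg 1 (mem_Ls.1 hc)
          omega
        rw [this]; simpa using hK0 m
      · obtain ⟨k, rfl⟩ : ∃ k, m = k + d := ⟨m - d, by omega⟩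
        have hd := H.dpos
        have := ih k (by omega)
        rw [H.E_zero, H.E_succ]
        push_cast
        linarith [hK2 k, hA0 k]
  have hs : ∀ s m, (En N d L (s + 1) (m + d) : ℝ) = An L s m + En N d L s m := fun s m => by
    rw [H.E_succ]; push_cast; rfl
  have hAE : ∀ s m, (An L (s + 1) m : ℝ) ≤ En N d L (s + 1) m := fun s m => by exact_mod_cast H.A_le_E s m
  have hE1 : ∀ m, (En N d L 1 (m + d) : ℝ) ≤ 2 * K m := fun m => by
    rw [hs]; linarith [hA0 m, hE0 m]
  have hE2 : ∀ m, (En N d L 2 (m + d + d) : ℝ) ≤ 4 * K m := fun m => by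
    rw [hs]; linarith [hAE 0 (m + d), hE1 m]
  have hE3 : ∀ m, (En N d L 3 (m + d + d + d) : ℝ) ≤ 8 * K m := fun m => by
    rw [hs]; linarith [hAE 1 (m + d + d), hE2 m]
  induction s using Nat.strong_induction_on with
  | _ s ih =>
    intro m
    match s, ih with
    | 0, _ => 
      have := hE0 m
      have := hK0 m
      simp only [zero_mul, add_zero, pow_zero]; linarith
    | 1, _ =>
      have := hE1 m
      have := hK0 m
      simp only [one_mul, pow_one]; linarith
    | 2, _ =>
      have := hE2 m
      have := hK0 m
      rw [show m + 2 * d = m + d + d by ring]; norm_num; linarith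
    | 3, _ =>
      have := hE3 m
      have := hK0 m
      rw [show m + 3 * d = m + d + d + d by ring]; norm_num; linarith
    | s + 4, ih =>
      have h1 := ih (s + 3) (by omega) m
      have h2 := ih (s + 2) (by omega) m
      have h3 := H.E_rec s (m + (s + 2) * d)
      have e1 : m + (s + 2) * d + d + d = m + (s + 4) * d := by ring
      have e2 : m + (s + 2) * d + d = m + (s + 3) * d := by ring
      rw [e1, e2] at h3
      have h3' : 2 * (En N d L (s + 4) (m + (s + 4) * d) : ℝ) ≤ 2 * En N d L (s + 3) (m + (s + 3) * d) + 3 * En N d L (s + 2) (m + (s + 2) * d) := by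
        exact_mod_cast h3
      have h4 : 0 ≤ (1.9 : ℝ) ^ s * K m := mul_nonneg (by positivity) (hK0 m)
      rw [pow_add] at h1 h2 ⊢
      norm_num at h1 h2 h4 ⊢
      nlinarith

theorem A_bound (K : ℕ → ℝ) (hK : ∀ m, (Fintype.card (C m) : ℝ) ≤ K m) (hK2 : ∀ m, 2 * K m ≤ K (m + d)) (s m : ℕ) :
    (An L s (m + s * d) : ℝ) ≤ 8 * 1.9 ^ s * K m := by
  cases s with
  | zero =>
    have h0 : 0 ≤ K m := le_trans (Nat.cast_nonneg _) (hK m)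
    have : (An L 0 m : ℝ) ≤ K m := le_trans (by exact_mod_cast Finset.card_le_univ _) (hK m)
    simp only [zero_mul, add_zero, pow_zero]; linarith
  | succ s =>
    exact le_trans (by exact_mod_cast H.A_le_E s _) (H.E_bound K hK hK2 (s + 1) m)
end HeisD
end PartC1
set_option linter.unusedSectionVars false
set_option linter.style.haveILetI false

section PartP1
variable {F : Type} [Field F] [Fintype F] [DecidableEq F]
variable {V : Type} [AddCommGroup V] [Module F V] [Finite V]
variable {V' : Type} [AddCommGroup V'] [Module F V'] [Finite V']
variable {W : Type} [AddCommGroup W] [Module F W] [Finite W]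
variable {B : Type} [Group B] [Fintype B]

theorem isChr_lin (β : B →* ℂ) : IsChr B (fun b => β b) := by
  have := isChr_of_rep (G := B) (V := ℂ) ((algebraMap ℂ (Module.End ℂ ℂ)).toMonoidHom.comp β)
  convert this using 1
  ext b
  change β b = LinearMap.trace ℂ ℂ (algebraMap ℂ (Module.End ℂ ℂ) (β b))
  rw [Algebra.algebraMap_eq_smul_one]
  simp

theorem exists_lin_eq {v v' : V} (hv : v ≠ 0) (hv' : v' ≠ 0) : ∃ E : V ≃ₗ[F] V, E v = v' := by
  obtain ⟨E, hE⟩ := exists_map_eq (F := F) (W := F ∙ v) (W' := F ∙ v') (by rw [finrank_span_singleton hv, finrank_span_singleton hv'])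
  have h1 : E v ∈ F ∙ v' := by
    rw [← hE]
    exact Submodule.mem_map_of_mem (Submodule.mem_span_singleton_self v)
  obtain ⟨c, hc⟩ := Submodule.mem_span_singleton.1 h1
  have hc0 : c ≠ 0 := by
    rintro rfl
    rw [zero_smul] at hc
    exact hv (E.map_eq_zero_iff.1 hc.symm)
  refine ⟨E.trans (LinearEquiv.smulOfNeZero F V c⁻¹ (inv_ne_zero hc0)), ?_⟩
  change c⁻¹ • E v = v'
  rw [← hc, smul_smul, inv_mul_cancel₀ hc0, one_smul]

variable {n : ℕ}

open Classical in
noncomputable def HH (k : GL (Fin n) F → ℂ) (σ : B →* Module.End F W) (β : B →* ℂ) (e : W) (v : V) : ℂ :=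
  ∑ b, ∑ u : W →ₗ[F] V, if u e = v then β b * ev k (blk LinearMap.id u (σ b)) else 0

theorem HH_const {k : GL (Fin n) F → ℂ} (hk : IsCl k) (σ : B →* Module.End F W) (β : B →* ℂ) (e : W) {v v' : V}
    (hv : v ≠ 0) (hv' : v' ≠ 0) : HH k σ β e v = HH k σ β e v' := by
  obtain ⟨E, hE⟩ := exists_lin_eq (F := F) hv hv'
  classical
  unfold HH
  refine Finset.sum_congr rfl fun b _ => ?_
  refine Eq.trans ?_ (sum_hom E (LinearEquiv.refl F W) (fun u => if u e = v' then β b * ev k (blk LinearMap.id u (σ b)) else 0))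
  refine Finset.sum_congr rfl fun u _ => ?_
  have h1 : (E.toLinearMap ∘ₗ u ∘ₗ (LinearEquiv.refl F W).symm.toLinearMap) e = v' ↔ u e = v := by
    change E (u e) = v' ↔ _
    rw [← hE, E.injective.eq_iff]
  have h2 : ev k (blk LinearMap.id u (σ b)) = ev k (blk LinearMap.id (E.toLinearMap ∘ₗ u ∘ₗ (LinearEquiv.refl F W).symm.toLinearMap) (σ b)) := by
    refine ev_conj hk (E.prodCongr (LinearEquiv.refl F W)) fun v => ?_
    refine Prod.ext ?_ rfl
    change E (v.1 + u v.2) = E v.1 + E (u v.2)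
    rw [map_add]
  rw [← h2]
  by_cases h : u e = v
  · rw [if_pos h, if_pos (h1.2 h)]
  · rw [if_neg h, if_neg fun h' => h (h1.1 h')]

theorem sum_HH [Fintype V] (k : GL (Fin n) F → ℂ) (σ : B →* Module.End F W) (β : B →* ℂ) (e : W) (c : V → ℂ) :
    ∑ v, c v * HH k σ β e v = ∑ b, ∑ u : W →ₗ[F] V, c (u e) * (β b * ev k (blk LinearMap.id u (σ b))) := by
  classical
  unfold HH
  simp_rw [Finset.mul_sum]
  rw [Finset.sum_comm]
  refine Finset.sum_congr rfl fun b _ => ?_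
  rw [Finset.sum_comm]
  refine Finset.sum_congr rfl fun u _ => ?_
  rw [Finset.sum_eq_single (u e) (fun v _ h => by rw [if_neg (Ne.symm h), mul_zero]) (fun h => absurd (Finset.mem_univ _) h), if_pos rfl]

theorem sum_HH2 [Fintype V] {k : GL (Fin n) F → ℂ} (hk : IsCl k) (σ : B →* Module.End F W) (β : B →* ℂ) (e : W) (c : V → ℂ)
    {v0 : V} (hv0 : v0 ≠ 0) :
    ∑ v, c v * HH k σ β e v = c 0 * HH k σ β e (0 : V) + ((∑ v, c v) - c 0) * HH k σ β e v0 := by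
  classical
  have : ∀ v : V, c v * HH k σ β e v = c v * HH k σ β e v0 + if v = 0 then c 0 * (HH k σ β e (0 : V) - HH k σ β e v0) else 0 := by
    intro v
    split_ifs with h
    · rw [h]; ring
    · rw [HH_const hk σ β e h hv0, add_zero]
  rw [Finset.sum_congr rfl fun v _ => this v, Finset.sum_add_distrib, ← Finset.sum_mul, Finset.sum_ite_eq' Finset.univ (0 : V), if_pos (Finset.mem_univ _)]
  ring

/-- trivial action of the one-element group on the line -/
abbrev tr1 (F : Type) [Field F] : Unit →* Module.End F F := 1

def nb (ψ : AddChar F ℂ) (σ : B →* Module.End F W) (β : B →* ℂ) (e : W) (he : ∀ b, σ b e = e) : Pb (tr1 F) σ →* ℂ where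
  toFun p := ψ (-(p.u e)) * β p.b
  map_one' := by
    change ψ (-((0 : W →ₗ[F] F) e)) * β 1 = 1
    simp
  map_mul' p q := by
    change ψ (-(q.u e + p.u (σ q.b e))) * β (p.b * q.b) = _
    rw [he, neg_add, AddChar.map_add_eq_mul, map_mul]
    ring

noncomputable instance pbFt {A : Type} [Group A] [Fintype A] (τ : A →* Module.End F V) (σ : B →* Module.End F W) : Fintype (Pb τ σ) :=
  Fintype.ofEquiv _ (Pb.equiv τ σ).symm

theorem sum_pb (σ : B →* Module.End F W) (φ : Pb (tr1 F) σ → ℂ) :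
    ∑ p, φ p = ∑ b, ∑ l : W →ₗ[F] F, φ ⟨(), b, l⟩ := by
  rw [← Fintype.sum_prod_type']
  symm
  exact Fintype.sum_bijective (fun t : B × (W →ₗ[F] F) => (⟨(), t.1, t.2⟩ : Pb (tr1 F) σ))
    (Function.bijective_iff_has_inverse.2 ⟨fun p => (p.b, p.u), fun _ => rfl, fun _ => rfl⟩) _ _ fun _ => rfl

theorem HH_new [Fintype V] {k : GL (Fin n) F → ℂ} (hk : IsCl k) (σ : B →* Module.End F W) (β : B →* ℂ) (e : W) (he : ∀ b, σ b e = e)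
    (ψ : AddChar F ℂ) (E : V ≃ₗ[F] (V' × F)) :
    HH (V := V') k (Pb.toEnd (tr1 F) σ) (nb ψ σ β e he) ((1, 0) : F × W) 0 = ∑ v : V, ψ (-(E v).2) * HH k σ β e v := by
  classical
  rw [sum_HH k σ β e (fun v : V => ψ (-(E v).2)), HH, sum_pb]
  apply Finset.sum_congr rfl
  intro b _
  rw [← sum_hom E.symm (LinearEquiv.refl F W) (fun u : W →ₗ[F] V => ψ (-(E (u e)).2) * (β b * ev k (blk LinearMap.id u (σ b)))),
    sum_prodmap (V := V') (W := F) (Z := W)]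
  refine Eq.trans ?_ Finset.sum_comm
  refine Finset.sum_congr rfl fun l _ => ?_
  rw [sum_coprod (W := F) (Z := W) (V := V'), Finset.sum_eq_single (0 : F →ₗ[F] V')]
  · refine Finset.sum_congr rfl fun u _ => ?_
    rw [if_pos (by simp)]
    have h2 : ev k (blk LinearMap.id ((0 : F →ₗ[F] V').coprod u) (Pb.toEnd (tr1 F) σ ⟨(), b, l⟩)) =
        ev k (blk LinearMap.id (E.symm.toLinearMap ∘ₗ (u.prod l) ∘ₗ (LinearEquiv.refl F W).symm.toLinearMap) (σ b)) := by
      let T : (V' × (F × W)) ≃ₗ[F] (V × W) := ((LinearEquiv.prodAssoc F V' F W).symm).trans (E.symm.prodCongr (LinearEquiv.refl F W))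
      refine ev_conj hk T fun v => ?_
      refine Prod.ext ?_ rfl
      change E.symm (v.1 + ((0 : F →ₗ[F] V') v.2.1 + u v.2.2), v.2.1 + l v.2.2) = E.symm (v.1, v.2.1) + E.symm (u v.2.2, l v.2.2)
      rw [← map_add, LinearMap.zero_apply, zero_add]
      rfl
    rw [h2]
    change ψ (-(l e)) * β b * _ = ψ (-((E (E.symm (u e, l e))).2)) * (β b * _)
    rw [LinearEquiv.apply_symm_apply, mul_assoc]
  · intro c _ hc
    refine Finset.sum_eq_zero fun u _ => ?_
    rw [if_neg]
    intro h
    apply hc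
    ext
    simpa using h
  · intro h
    exact absurd (Finset.mem_univ _) h

noncomputable def AA (V : Type) [AddCommGroup V] [Module F V] [Finite V] (k : GL (Fin n) F → ℂ) (σ : B →* Module.End F W) (β : B →* ℂ) (e : W) : ℂ :=
  Nat.card V * HH (V := V) k σ β e 0 / (Nat.card B * Nat.card (W →ₗ[F] V))

noncomputable def DD (V : Type) [AddCommGroup V] [Module F V] [Finite V] (k : GL (Fin n) F → ℂ) (σ : B →* Module.End F W) (β : B →* ℂ) : ℂ :=
  (∑ b, ∑ u : W →ₗ[F] V, β b * ev k (blk LinearMap.id u (σ b))) / (Nat.card B * Nat.card (W →ₗ[F] V))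

theorem exists_psi (F : Type) [Field F] [Fintype F] : ∃ ψ : AddChar F ℂ, ψ 1 ≠ 1 :=
  AddChar.exists_apply_ne_zero.2 one_ne_zero

theorem sum_psi [Fintype V] (ψ : AddChar F ℂ) (hψ : ψ 1 ≠ 1) (E : V ≃ₗ[F] (V' × F)) : ∑ v, ψ (-(E v).2) = 0 := by
  let Ψ : AddChar V ℂ := ψ.compAddMonoidHom (-(LinearMap.snd F V' F ∘ₗ E.toLinearMap)).toAddMonoidHom
  have h : Ψ ≠ 1 := by
    intro h
    have h1 : Ψ (E.symm (0, -1)) = 1 := by rw [h]; rfl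
    apply hψ
    rw [← h1]
    change ψ 1 = ψ (-(E (E.symm (0, -1))).2)
    rw [LinearEquiv.apply_symm_apply]; simp
  exact AddChar.sum_eq_zero_iff_ne_zero.2 h

theorem A_step {k : GL (Fin n) F → ℂ} (hk : IsCl k) (σ : B →* Module.End F W) (β : B →* ℂ) (e : W) (he : ∀ b, σ b e = e)
    (ψ : AddChar F ℂ) (hψ : ψ 1 ≠ 1) (E : V ≃ₗ[F] (V' × F)) :
    AA V k σ β e = DD V k σ β + (Nat.card V - 1) * AA V' k (Pb.toEnd (tr1 F) σ) (nb ψ σ β e he) ((1, 0) : F × W) := by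
  haveI : Fintype V := Fintype.ofFinite V
  have hv0 : E.symm (0, 1) ≠ 0 := by
    intro h
    have := congrArg E h
    rw [LinearEquiv.apply_symm_apply, map_zero, Prod.mk_eq_zero] at this
    exact one_ne_zero this.2
  have h1 := HH_new hk σ β e he ψ E
  rw [sum_HH2 hk σ β e _ hv0, sum_psi ψ hψ] at h1
  have h2 := sum_HH k σ β e (fun _ : V => (1 : ℂ))
  rw [sum_HH2 hk σ β e _ hv0] at h2
  simp only [one_mul, Finset.sum_const, Finset.card_univ, nsmul_eq_mul, mul_one, map_zero, Prod.snd_zero, neg_zero, AddChar.map_zero_eq_one, zero_sub] at h1 h2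
  unfold AA DD
  rw [← h2, h1]
  have c1 : Nat.card (Pb (tr1 F) σ) = Nat.card B * Nat.card (W →ₗ[F] F) := by
    rw [Nat.card_congr (Pb.equiv (tr1 F) σ), Nat.card_prod, Nat.card_prod]; simp
  have c2 : Nat.card (W →ₗ[F] V) * Nat.card V' = Nat.card (W →ₗ[F] F) * Nat.card ((F × W) →ₗ[F] V') := by
    rw [card_hom, card_hom, card_hom, Module.natCard_eq_pow_finrank (K := F) (V := V'), ← pow_add, ← pow_add, E.finrank_eq, Module.finrank_prod, Module.finrank_prod, Module.finrank_self]
    congr 1; ring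
  have c2' : (Nat.card (W →ₗ[F] V) : ℂ) * Nat.card V' = Nat.card (W →ₗ[F] F) * Nat.card ((F × W) →ₗ[F] V') := by exact_mod_cast c2
  have n1 : (Nat.card B : ℂ) ≠ 0 := Nat.cast_ne_zero.2 Nat.card_pos.ne'
  have n2 : (Nat.card (W →ₗ[F] V) : ℂ) ≠ 0 := Nat.cast_ne_zero.2 Nat.card_pos.ne'
  have n3 : (Nat.card (W →ₗ[F] F) : ℂ) ≠ 0 := Nat.cast_ne_zero.2 Nat.card_pos.ne'
  have n4 : (Nat.card ((F × W) →ₗ[F] V') : ℂ) ≠ 0 := Nat.cast_ne_zero.2 Nat.card_pos.ne'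
  have n5 : (Nat.card V' : ℂ) ≠ 0 := Nat.cast_ne_zero.2 Nat.card_pos.ne'
  rw [c1]
  push_cast
  have e3 : ∀ x : ℂ, (Nat.card V' : ℂ) * x / (Nat.card B * Nat.card (W →ₗ[F] F) * Nat.card ((F × W) →ₗ[F] V')) = x / (Nat.card B * Nat.card (W →ₗ[F] V)) := by
    intro x
    rw [mul_assoc (Nat.card B : ℂ), ← c2']
    field_simp
  rw [e3, Nat.card_eq_fintype_card (α := V)]
  field_simp
  ring
end PartP1
set_option linter.unusedSectionVars false
set_option linter.style.haveILetI false

section PartP2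
variable {F : Type} [Field F] [Fintype F] [DecidableEq F]
variable {V : Type} [AddCommGroup V] [Module F V] [Finite V]
variable {V' : Type} [AddCommGroup V'] [Module F V'] [Finite V']
variable {W : Type} [AddCommGroup W] [Module F W] [Finite W]
variable {B : Type} [Group B] [Fintype B]
variable {n r w : ℕ}

theorem dR_ne {α : Ch F r} {χ : Ch F n} (hV : Module.finrank F V = r) (hW : Module.finrank F W = w)
    {y : W →ₗ[F] W} (h : dR V α.1 (ivf χ.1) y ≠ 0) : ∃ γ : Ch F w, M α γ χ ≠ 0 := by
  rw [endo_expand' hW (φ := dR V α.1 (ivf χ.1)) (fun E x => dR_conj χ.isCl.ivf E x) dR_zero] at h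
  obtain ⟨γ, -, h⟩ := Finset.exists_ne_zero_of_sum_ne_zero (right_ne_zero_of_mul h)
  refine ⟨γ, fun h0 => left_ne_zero_of_mul h ?_⟩
  rw [← S3_eq_dR, S3_M α γ χ hV hW, h0]
  simp

theorem ev_id (α : Ch F r) (hV : Module.finrank F V = r) : ev (V := V) (ivf α.1) LinearMap.id = α.1 1 := by
  let e : V ≃ₗ[F] (Fin r → F) := LinearEquiv.ofFinrankEq _ _ (by simpa using hV)
  have : (LinearMap.id : V →ₗ[F] V) = lin e 1 := by rw [map_one]; rfl
  rw [this, ev_lin α.isCl.ivf]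
  change α.1 1⁻¹ = _
  rw [inv_one]

theorem DD_decomp (χ : Ch F n) (hV : Module.finrank F V = r) (hW : Module.finrank F W = w) (hn : r + w = n)
    (σ : B →* Module.End F W) (β : B →* ℂ) :
    ∃ m : Ch F r → ℕ, DD V (ivf χ.1) σ β = ∑ α, m α * α.1 1 ∧
      ∀ α, m α ≠ 0 → ∃ γ : Ch F w, M α γ χ ≠ 0 := by
  let e : V ≃ₗ[F] (Fin r → F) := LinearEquiv.ofFinrankEq _ _ (by simpa using hV)
  let φ : (V →ₗ[F] V) → ℂ := fun y => ∑ b, ∑ u : W →ₗ[F] V, β b * ev (ivf χ.1) (blk y u (σ b))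
  have hc : ∀ (E : V ≃ₗ[F] V) (x : V →ₗ[F] V), φ (E.toLinearMap ∘ₗ x ∘ₗ E.symm.toLinearMap) = φ x := by
    intro E x
    refine Finset.sum_congr rfl fun b _ => ?_
    rw [← sum_hom E (LinearEquiv.refl F W) (fun u => β b * ev (ivf χ.1) (blk (E.toLinearMap ∘ₗ x ∘ₗ E.symm.toLinearMap) u (σ b)))]
    refine Finset.sum_congr rfl fun u _ => ?_
    congr 1
    symm
    refine ev_conj χ.isCl.ivf (E.prodCongr (LinearEquiv.refl F W)) fun v => ?_
    simp
  have hz : ∀ x : V →ₗ[F] V, ¬ Function.Bijective x → φ x = 0 := by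
    intro x hx
    refine Finset.sum_eq_zero fun b _ => Finset.sum_eq_zero fun u _ => ?_
    rw [ev_blk_zero_l hx, mul_zero]
  have hm : ∀ α : Ch F r, ∃ m : ℕ, ((Nat.card (GL (Fin r) F) : ℂ) * (Nat.card B : ℂ) * (Nat.card (W →ₗ[F] V) : ℂ))⁻¹ *
      ∑ x, ev α.1 x * φ x = m := by
    intro α
    obtain ⟨m, hm⟩ := pb_nat (lin e) σ α.2.isChr (isChr_lin β) χ.2.isChr (by rw [Module.finrank_prod, hV, hW, hn])
    refine ⟨m, ?_⟩
    rw [← hm, sum_ev α.isCl e]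
    congr 1
    refine Finset.sum_congr rfl fun a _ => ?_
    simp only [φ, Finset.mul_sum, mul_assoc]
  choose m hm using hm
  refine ⟨m, ?_, ?_⟩
  · have h1 : DD V (ivf χ.1) σ β = φ LinearMap.id / (Nat.card B * Nat.card (W →ₗ[F] V)) := rfl
    rw [h1, endo_expand' hV hc hz, mul_div_assoc, Finset.sum_div, Finset.mul_sum]
    refine Finset.sum_congr rfl fun α _ => ?_
    rw [← hm, ev_id α hV, mul_inv, mul_inv, div_eq_mul_inv, mul_inv]
    ring
  · intro α hα
    have h1 : ∑ x, ev α.1 x * φ x ≠ 0 := by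
      intro h0
      have := hm α
      rw [h0, mul_zero] at this
      exact hα (by exact_mod_cast this.symm)
    have h2 : ∑ x, ev α.1 x * φ x = ∑ b, β b * dR V α.1 (ivf χ.1) (σ b) := by
      simp only [φ, dR, Finset.mul_sum]
      rw [Finset.sum_comm]
      exact Finset.sum_congr rfl fun b _ => Finset.sum_congr rfl fun x _ => Finset.sum_congr rfl fun u _ => by ring
    rw [h2] at h1
    obtain ⟨b, -, h⟩ := Finset.exists_ne_zero_of_sum_ne_zero h1
    exact dR_ne hV hW (right_ne_zero_of_mul h)
end PartP2
set_option linter.unusedSectionVars false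
set_option linter.style.haveILetI false

section PartP3
variable {F : Type} [Field F] [Fintype F] [DecidableEq F]
variable {n : ℕ}

theorem DD_bad {V : Type} [AddCommGroup V] [Module F V] [Finite V] {W : Type} [AddCommGroup W] [Module F W] [Finite W]
    {B : Type} [Group B] [Fintype B] {r : ℕ} (χ : Ch F n) (hV : Module.finrank F V = r) (hW : Module.finrank F W = n - r) (hn : r ≤ n)
    (σ : B →* Module.End F W) (β : B →* ℂ) (L : ℂ) (h : ¬ IsIntegral ℤ (L * DD V (ivf χ.1) σ β)) :
    ∃ α : Ch F r, ∃ γ : Ch F (n - r), M α γ χ ≠ 0 ∧ ¬ IsIntegral ℤ (L * α.1 1) := by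
  obtain ⟨m, h1, h2⟩ := DD_decomp χ hV hW (by omega) σ β
  by_contra hcon
  push Not at hcon
  apply h
  rw [h1, Finset.mul_sum]
  refine IsIntegral.sum _ fun α _ => ?_
  by_cases hm : m α = 0
  · rw [hm]; simp [isIntegral_zero]
  · obtain ⟨γ, hγ⟩ := h2 α hm
    have := hcon α γ hγ
    rw [mul_left_comm]
    exact (isIntegral_algebraMap (R := ℤ) (x := (m α : ℤ))).mul this

theorem AA_bad (χ : Ch F n) (ℓ e b : ℕ) (hℓ : ∀ i, e ∣ i → ℓ ∣ Fintype.card F ^ i - 1) (r : ℕ) :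
    ∀ (V : Type) [AddCommGroup V] [Module F V] [Finite V] (W : Type) [AddCommGroup W] [Module F W] [Finite W]
    (B : Type) [Group B] [Fintype B] (_ : Module.finrank F V = r) (_ : Module.finrank F W = n - r) (_ : r ≤ n)
    (σ : B →* Module.End F W) (β : B →* ℂ) (e0 : W) (_ : ∀ b, σ b e0 = e0) (c : ℕ)
    (_ : ¬ IsIntegral ℤ ((ℓ : ℂ) ^ c / (ℓ : ℂ) ^ b * AA V (ivf χ.1) σ β e0)),
    ∃ j ≤ r, ∃ α : Ch F j, ∃ γ : Ch F (n - j), M α γ χ ≠ 0 ∧ ¬ IsIntegral ℤ ((ℓ : ℂ) ^ (c + r / e - j / e) / (ℓ : ℂ) ^ b * α.1 1) := by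
  induction r with
  | zero =>
    intro V _ _ _ W _ _ _ B _ _ hV hW hr σ β e0 he c hbad
    have hs : Subsingleton V := Module.finrank_zero_iff.1 hV
    have : AA V (ivf χ.1) σ β e0 = DD V (ivf χ.1) σ β := by
      unfold AA DD HH
      have h1 : Nat.card V = 1 := by
        rw [Nat.card_eq_one_iff_unique]; exact ⟨hs, ⟨0⟩⟩
      rw [h1]
      simp
    rw [this] at hbad
    obtain ⟨α, γ, h1, h2⟩ := DD_bad χ hV hW hr σ β _ hbad
    exact ⟨0, le_rfl, α, γ, h1, by simpa using h2⟩
  | succ r ih =>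
    intro V _ _ _ W _ _ _ B _ _ hV hW hr σ β e0 he c hbad
    obtain ⟨ψ, hψ⟩ := exists_psi F
    let E : V ≃ₗ[F] ((Fin r → F) × F) := LinearEquiv.ofFinrankEq _ _ (by rw [hV, Module.finrank_prod]; simp)
    rw [A_step χ.isCl.ivf σ β e0 he ψ hψ E, mul_add] at hbad
    by_cases hD : IsIntegral ℤ ((ℓ : ℂ) ^ c / (ℓ : ℂ) ^ b * DD V (ivf χ.1) σ β)
    · have hA : ¬ IsIntegral ℤ ((ℓ : ℂ) ^ c / (ℓ : ℂ) ^ b * ((Nat.card V - 1) * AA (Fin r → F) (ivf χ.1) (Pb.toEnd (tr1 F) σ) (nb ψ σ β e0 he) ((1, 0) : F × W))) :=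
        fun h => hbad (hD.add h)
      have hcard : (Nat.card V : ℂ) - 1 = ((Fintype.card F ^ (r + 1) - 1 : ℕ) : ℂ) := by
        rw [Module.natCard_eq_pow_finrank (K := F) (V := V), hV, Nat.cast_sub (Nat.one_le_pow _ _ Fintype.card_pos), Nat.card_eq_fintype_card]
        simp
      have key : ∀ c', c' = c + (r + 1) / e - r / e → 
          ∃ j ≤ r, ∃ α : Ch F j, ∃ γ : Ch F (n - j), M α γ χ ≠ 0 ∧ ¬ IsIntegral ℤ ((ℓ : ℂ) ^ (c' + r / e - j / e) / (ℓ : ℂ) ^ b * α.1 1) := by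
        intro c' hc'
        refine ih (Fin r → F) (F × W) (Pb (tr1 F) σ) (finrank_fin r) ?_ (by omega) (Pb.toEnd (tr1 F) σ) (nb ψ σ β e0 he) (1, 0) ?_ c' ?_
        · rw [Module.finrank_prod, hW, Module.finrank_self]; omega
        · intro p
          change ((1 : Module.End F F) (1 : F) + p.u 0, σ p.b 0) = _
          simp
        · intro hint
          apply hA
          rw [hcard]
          set X := AA (Fin r → F) (ivf χ.1) (Pb.toEnd (tr1 F) σ) (nb ψ σ β e0 he) ((1, 0) : F × W)
          by_cases hd : e ∣ r + 1
          · obtain ⟨t, ht⟩ := hℓ _ hd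
            have : c' = c + 1 := by
              rw [hc', Nat.succ_div, if_pos hd]; omega
            rw [this] at hint
            rw [ht]
            have e1 : (ℓ : ℂ) ^ c / (ℓ : ℂ) ^ b * (((ℓ * t : ℕ) : ℂ) * X) = (t : ℂ) * ((ℓ : ℂ) ^ (c + 1) / (ℓ : ℂ) ^ b * X) := by
              push_cast; ring
            rw [e1]
            exact (isIntegral_algebraMap (R := ℤ) (x := (t : ℤ))).mul hint
          · have : c' = c := by
              rw [hc', Nat.succ_div, if_neg hd]; omega
            rw [this] at hint
            rw [mul_left_comm]
            exact (isIntegral_algebraMap (R := ℤ) (x := ((Fintype.card F ^ (r + 1) - 1 : ℕ) : ℤ))).mul hint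
      obtain ⟨j, hj, α, γ, h1, h2⟩ := key _ rfl
      refine ⟨j, by omega, α, γ, h1, ?_⟩
      have hle : r / e ≤ (r + 1) / e := Nat.div_le_div_right (by omega)
      rwa [show c + (r + 1) / e - r / e + r / e - j / e = c + (r + 1) / e - j / e by omega] at h2
    · obtain ⟨α, γ, h1, h2⟩ := DD_bad χ hV hW hr σ β _ hD
      refine ⟨r + 1, le_rfl, α, γ, h1, ?_⟩
      rwa [Nat.add_sub_cancel]

theorem chi_bad (χ : Ch F (n + 1)) (ℓ e b : ℕ) (hℓ : ∀ i, e ∣ i → ℓ ∣ Fintype.card F ^ i - 1) 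
    (h : ¬ IsIntegral ℤ (χ.1 1 / (ℓ : ℂ) ^ b)) :
    ∃ j ≤ n, ∃ α : Ch F j, ∃ γ : Ch F (n + 1 - j), M α γ χ ≠ 0 ∧
      ¬ IsIntegral ℤ ((ℓ : ℂ) ^ (n / e - j / e) / (ℓ : ℂ) ^ b * α.1 1) := by
  have hV := finrank_fin (F := F) n
  have h1 : AA (Fin n → F) (ivf χ.1) (tr1 F) 1 (1 : F) = χ.1 1 := by
    unfold AA HH
    have h2 : ∀ u : F →ₗ[F] (Fin n → F), u 1 = 0 ↔ u = 0 := fun u => by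
      constructor
      · intro h; ext; simp [h]
      · rintro rfl; rfl
    simp only [h2, Finset.univ_unique, Finset.sum_singleton, Finset.sum_ite_eq', Finset.mem_univ, if_true]
    have h3 : blk (LinearMap.id : (Fin n → F) →ₗ[F] (Fin n → F)) 0 ((tr1 F) default) = LinearMap.id := by
      apply LinearMap.ext; intro v
      simp
    rw [h3, ev_id χ (by rw [Module.finrank_prod, hV, Module.finrank_self]), card_hom, hV, Module.finrank_self, Module.natCard_eq_pow_finrank (K := F) (V := Fin n → F), hV]
    have : (Nat.card F : ℂ) ≠ 0 := Nat.cast_ne_zero.2 Nat.card_pos.ne'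
    simp
  have := AA_bad χ ℓ e b hℓ n (Fin n → F) F Unit hV (by rw [Module.finrank_self]; omega) (by omega) (tr1 F) 1 1 (by simp) 0
    (by rw [h1]; intro h'; apply h; rw [pow_zero] at h'; convert h' using 1; ring)
  simpa using this
end PartP3
set_option linter.unusedSectionVars false
set_option linter.style.haveILetI false

section PartE1
variable {F : Type} [Field F] [Fintype F] [DecidableEq F]

theorem deg_int {n : ℕ} (χ : Ch F n) : IsIntegral ℤ (χ.1 1) := by
  obtain ⟨k, -, hk⟩ := χ.2.deg_pos
  rw [hk]
  exact isIntegral_algebraMap (R := ℤ) (x := (k : ℤ))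

theorem chain (ℓ e : ℕ) (hℓ0 : ℓ ≠ 0) (he : 0 < e) (hℓ : ∀ i, e ∣ i → ℓ ∣ Fintype.card F ^ i - 1) (n : ℕ) :
    ∀ (b : ℕ) (χ : Ch F n), ¬ IsIntegral ℤ (χ.1 1 / (ℓ : ℂ) ^ b) →
    ∃ (w : List (XX F)) (a : XX F), (∀ r ∈ w, CC r) ∧ Pth w a ⟨n, χ⟩ ∧
      n ≤ 2 * e * (w.countP (fun r => r.1 ≤ 2 * e) + b) := by
  have hℓc : (ℓ : ℂ) ≠ 0 := Nat.cast_ne_zero.2 hℓ0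
  induction n using Nat.strong_induction_on with
  | _ n ih =>
    intro b χ hχ
    rcases n with _ | n
    · exact ⟨[], ⟨0, χ⟩, by simp, rfl, by simp⟩
    obtain ⟨j, hj, α, γ, hM, hα⟩ := chi_bad χ ℓ e b hℓ hχ
    set c := n / e - j / e with hc
    have hcb : c < b := by
      by_contra hcon
      push Not at hcon
      apply hα
      rw [← pow_sub₀ _ hℓc hcon |> fun h => (show (ℓ : ℂ) ^ (c - b) = (ℓ : ℂ) ^ c / (ℓ : ℂ) ^ b by rw [h, div_eq_mul_inv])]
      have := (isIntegral_algebraMap (R := ℤ) (A := ℂ) (x := ((ℓ ^ (c - b) : ℕ) : ℤ))).mul (deg_int α)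
      simpa using this
    have hα' : ¬ IsIntegral ℤ (α.1 1 / (ℓ : ℂ) ^ (b - c)) := by
      intro h
      apply hα
      convert h using 1
      have : (ℓ : ℂ) ^ b = (ℓ : ℂ) ^ (b - c) * (ℓ : ℂ) ^ c := by rw [← pow_add]; congr 1; omega
      rw [this]
      field_simp
    obtain ⟨w, a, hw1, hw2, hw3⟩ := ih j (by omega) (b - c) α hα'
    obtain ⟨w', hw1', hs, hw2'⟩ := Pth_exists (n + 1 - j) ⟨_, γ⟩ ⟨_, α⟩ ⟨_, χ⟩ rfl (by omega) hM
    refine ⟨w ++ w', a, ?_, (Pth_append _ _ _ _).2 ⟨_, hw2, hw2'⟩, ?_⟩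
    · intro r hr
      rcases List.mem_append.1 hr with h | h
      · exact hw1 r h
      · exact hw1' r h
    · rw [List.countP_append]
      set S := w.countP (fun r => r.1 ≤ 2 * e)
      set S' := w'.countP (fun r => r.1 ≤ 2 * e) with hS'
      set k := n + 1 - j with hk
      have key : k ≤ 2 * e * (S' + c) := by
        by_cases hke : k ≤ 2 * e
        · have : 1 ≤ S' := by
            rw [Nat.one_le_iff_ne_zero, ← Nat.pos_iff_ne_zero, hS', List.countP_pos_iff]
            obtain ⟨x, hx⟩ : ∃ x, x ∈ w' := by
              apply List.exists_mem_of_ne_nil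
              rintro rfl
              simp at hs
              omega
            refine ⟨x, hx, ?_⟩
            have h2 : x.1 ≤ (w'.map Sigma.fst).sum := List.le_sum_of_mem (List.mem_map_of_mem hx)
            simp only [decide_eq_true_eq]
            omega
          calc k ≤ 2 * e * 1 := by omega
            _ ≤ _ := Nat.mul_le_mul_left _ (by omega)
        · push Not at hke
          have h1 : j / e + (k - 1) / e ≤ n / e := by
            have : n = j + (k - 1) := by omega
            rw [this]
            exact Nat.div_add_div_le_add_div
          have h2 : (k - 1) / e ≤ c := by omega
          have h3 : 2 ≤ (k - 1) / e := by
            rw [Nat.le_div_iff_mul_le he]; omega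
          have h4 : k - 1 < e * ((k - 1) / e + 1) := by
            have := Nat.lt_mul_div_succ (k - 1) he
            simpa using this
          set t := (k - 1) / e
          calc k ≤ e * (t + 1) := by omega
            _ ≤ e * (2 * (S' + c)) := Nat.mul_le_mul_left _ (by omega)
            _ = _ := by ring
      have e1 : 2 * e * (S + S' + b) = 2 * e * (S + (b - c)) + 2 * e * (S' + c) := by
        rw [← mul_add]; congr 1; omega
      omega

/-- all characters of degree at most `D` -/
noncomputable def TT (F : Type) [Field F] [Fintype F] [DecidableEq F] (D : ℕ) : Finset (XX F) :=
  (Finset.range (D + 1)).sigma fun _ => Finset.univ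

theorem mem_TT {D : ℕ} {r : XX F} : r ∈ TT F D ↔ r.1 ≤ D := by
  simp [TT]

open Classical in
theorem countP_TT (D : ℕ) (w : List (XX F)) : w.countP (fun r => r.1 ≤ D) = ∑ r ∈ TT F D, w.count r := by
  induction w with
  | nil => simp
  | cons x w ih =>
    simp only [List.countP_cons, List.count_cons, Finset.sum_add_distrib, ih]
    congr 1
    simp [mem_TT]

theorem Lv_mono {r c : XX F} {s t : ℕ} (h : s ≤ t) : Lv r t c → Lv r s c := by
  induction s generalizing t c with
  | zero => intro _; trivial
  | succ s ih =>
    obtain ⟨t, rfl⟩ : ∃ u, t = u + 1 := ⟨t - 1, by omega⟩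
    rintro ⟨a, h1, h2⟩
    exact ⟨a, h1, ih (by omega) h2⟩

theorem bad_Lv (ℓ e : ℕ) (hℓ0 : ℓ ≠ 0) (he : 0 < e) (hℓ : ∀ i, e ∣ i → ℓ ∣ Fintype.card F ^ i - 1) (n : ℕ)
    (b : ℕ) (χ : Ch F n) (hχ : ¬ IsIntegral ℤ (χ.1 1 / (ℓ : ℂ) ^ b)) (hn : 0 < n) (hb : 4 * e * b ≤ n) :
    ∃ ρ ∈ TT F (2 * e), CC ρ ∧ Lv ρ (n / (4 * e * (TT F (2 * e)).card)) ⟨n, χ⟩ := by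
  classical
  obtain ⟨w, a, h1, h2, h3⟩ := chain ℓ e hℓ0 he hℓ n b χ hχ
  rw [countP_TT] at h3
  set κ := (TT F (2 * e)).card with hκ
  set S := ∑ r ∈ TT F (2 * e), w.count r with hS
  have hSn : n ≤ 4 * e * S := by nlinarith
  have hne : ∃ r ∈ TT F (2 * e), w.count r ≠ 0 := by
    by_contra hcon
    push Not at hcon
    have : S = 0 := Finset.sum_eq_zero hcon
    rw [this] at hSn
    omega
  obtain ⟨ρ, hρ, hmax⟩ := Finset.exists_max_image (TT F (2 * e)) (fun r => w.count r) ⟨_, hne.choose_spec.1⟩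
  have hρ0 : 0 < w.count ρ := by
    obtain ⟨r, hr, hr0⟩ := hne
    have := hmax r hr
    omega
  have hC : CC ρ := h1 ρ (List.count_pos_iff.1 hρ0)
  refine ⟨ρ, hρ, hC, ?_⟩
  have hle : S ≤ κ * w.count ρ := by
    have := Finset.sum_le_card_nsmul _ _ _ hmax
    simpa using this
  have hL := Lv_of_Pth hC w h1 0 a ⟨n, χ⟩ h2 trivial
  refine Lv_mono ?_ hL
  apply Nat.div_le_of_le_mul
  calc n ≤ 4 * e * S := hSn
    _ ≤ 4 * e * (κ * w.count ρ) := Nat.mul_le_mul_left _ hle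
    _ = _ := by rw [add_zero]; ring
end PartE1
set_option linter.unusedSectionVars false
set_option linter.style.haveILetI false

section PartE2
variable {F : Type} [Field F] [Fintype F] [DecidableEq F]

theorem heisCh {d : ℕ} (ρ : Ch F d) (hρ : Cusp ρ) :
    HeisD (C := Ch F) (fun _ _ a c => M a ρ c) d (fun s n c => Lv ⟨d, ρ⟩ s ⟨n, c⟩) where
  dpos := hρ.1
  deg _ _ _ _ h := M_deg h
  heis _ a b := @H1 _ _ _ _ _ _ ρ hρ a b (Classical.propDecidable _)
  L0 _ _ := trivial
  L1 s n c := by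
    constructor
    · rintro ⟨⟨m, a⟩, h1, h2⟩
      exact ⟨m, a, h1, h2⟩
    · rintro ⟨m, a, h1, h2⟩
      exact ⟨⟨m, a⟩, h1, h2⟩

theorem lv_count (x C : ℝ) (hx : 2 ≤ x) (hK : ∀ m, (Fintype.card (Ch F m) : ℝ) ≤ C * x ^ m)
    (ρ : XX F) (hρ : CC ρ) (s n : ℕ) : (An (C := Ch F) (fun s n c => Lv ρ s ⟨n, c⟩) s n : ℝ) ≤ 8 * C * x ^ n * 0.95 ^ s := by
  obtain ⟨d, ρ⟩ := ρ
  have H := heisCh ρ hρ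
  have hC : 0 ≤ C := by
    have := hK 0
    rw [pow_zero, mul_one] at this
    exact le_trans (Nat.cast_nonneg _) this
  have hd : 1 ≤ d := hρ.1
  by_cases hn : s * d ≤ n
  · obtain ⟨m, rfl⟩ : ∃ m, n = m + s * d := ⟨n - s * d, by omega⟩
    refine (H.A_bound (fun m => C * x ^ m) hK (fun m => ?_) s m).trans ?_
    · rw [pow_add]
      have h1 : x ^ 1 ≤ x ^ d := pow_le_pow_right₀ (by linarith) hd
      have h2 : 0 ≤ C * x ^ m := by positivity
      nlinarith
    · have h1 : (2 : ℝ) ^ s ≤ x ^ (s * d) := by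
        calc (2 : ℝ) ^ s ≤ x ^ s := pow_le_pow_left₀ (by norm_num) hx s
          _ ≤ _ := pow_le_pow_right₀ (by linarith) (by nlinarith)
      have h2 : (1.9 : ℝ) ^ s = 0.95 ^ s * 2 ^ s := by rw [← mul_pow]; norm_num
      rw [h2, pow_add]
      have h3 : 0 ≤ 8 * C * x ^ m * 0.95 ^ s := by positivity
      nlinarith [mul_le_mul_of_nonneg_left h1 h3]
  · have : An (C := Ch F) (fun s n c => Lv ⟨d, ρ⟩ s ⟨n, c⟩) s n = 0 := by
      rw [An, Finset.card_eq_zero, Finset.eq_empty_iff_forall_notMem]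
      intro c hc
      exact hn (H.L_deg s (mem_Ls.1 hc))
    rw [this]
    have : (0 : ℝ) < x := by linarith
    simp only [Nat.cast_zero]
    positivity

theorem bad_count (ℓ e : ℕ) (hℓ0 : ℓ ≠ 0) (he : 0 < e) (hℓ : ∀ i, e ∣ i → ℓ ∣ Fintype.card F ^ i - 1)
    (x C : ℝ) (hx : 2 ≤ x) (hK : ∀ m, (Fintype.card (Ch F m) : ℝ) ≤ C * x ^ m)
    (n b : ℕ) (hn : 0 < n) (hb : 4 * e * b ≤ n) :
    (Nat.card {χ : Ch F n // ¬ IsIntegral ℤ (χ.1 1 / (ℓ : ℂ) ^ b)} : ℝ) ≤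
      (TT F (2 * e)).card * (8 * C * x ^ n * 0.95 ^ (n / (4 * e * (TT F (2 * e)).card))) := by
  classical
  set s := n / (4 * e * (TT F (2 * e)).card)
  have h1 : (Finset.univ.filter fun χ : Ch F n => ¬ IsIntegral ℤ (χ.1 1 / (ℓ : ℂ) ^ b)) ⊆
      ((TT F (2 * e)).filter CC).biUnion fun ρ => Ls (C := Ch F) (fun s n c => Lv ρ s ⟨n, c⟩) s n := by
    intro χ hχ
    rw [Finset.mem_filter] at hχ
    obtain ⟨ρ, h1, h2, h3⟩ := bad_Lv ℓ e hℓ0 he hℓ n b χ hχ.2 hn hb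
    rw [Finset.mem_biUnion]
    exact ⟨ρ, Finset.mem_filter.2 ⟨h1, h2⟩, mem_Ls.2 h3⟩
  have h0 : 0 ≤ 8 * C * x ^ n * 0.95 ^ s := by
    have hC : 0 ≤ C := by
      have := hK 0
      rw [pow_zero, mul_one] at this
      exact le_trans (Nat.cast_nonneg _) this
    have : (0 : ℝ) < x := by linarith
    positivity
  rw [Nat.card_eq_fintype_card, Fintype.card_subtype]
  calc ((Finset.univ.filter fun χ : Ch F n => ¬ IsIntegral ℤ (χ.1 1 / (ℓ : ℂ) ^ b)).card : ℝ) 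
      ≤ ((∑ ρ ∈ (TT F (2 * e)).filter CC, (Ls (C := Ch F) (fun s n c => Lv ρ s ⟨n, c⟩) s n).card : ℕ) : ℝ) := by
        exact_mod_cast (Finset.card_le_card h1).trans Finset.card_biUnion_le
    _ ≤ ∑ ρ ∈ (TT F (2 * e)).filter CC, 8 * C * x ^ n * 0.95 ^ s := by
        push_cast
        exact Finset.sum_le_sum fun ρ hρ => lv_count x C hx hK ρ (Finset.mem_filter.1 hρ).2 s n
    _ ≤ _ := by
        rw [Finset.sum_const, nsmul_eq_mul]
        exact mul_le_mul_of_nonneg_right (by exact_mod_cast Finset.card_filter_le _ _) h0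
end PartE2
set_option linter.unusedSectionVars false
set_option linter.style.haveILetI false

section PartD1
open Polynomial
variable {F : Type} [Field F] [Fintype F] [DecidableEq F]

theorem aeval_torsion {V : Type} [AddCommGroup V] [Module F V] [Module.Finite F V] (T : V →ₗ[F] V) :
    Module.IsTorsion F[X] (Module.AEval' T) := by
  intro x
  refine ⟨⟨T.charpoly, mem_nonZeroDivisors_of_ne_zero T.charpoly_monic.ne_zero⟩, ?_⟩
  apply (Module.AEval'.of T).symm.injective
  change (Module.AEval.of F V T).symm (T.charpoly • x) = _
  rw [Module.AEval.of_symm_smul, LinearMap.aeval_self_charpoly]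
  simp

theorem struct_pi {V : Type} [AddCommGroup V] [Module F V] [Module.Finite F V] (T : V →ₗ[F] V) :
    ∃ (ι : Type) (_ : Fintype ι) (p : ι → F[X]) (e : ι → ℕ), (∀ i, Irreducible (p i)) ∧ (∀ i, (p i).Monic) ∧
      (∀ i, 0 < e i) ∧ Nonempty (Module.AEval' T ≃ₗ[F[X]] ∀ i, F[X] ⧸ Ideal.span {p i ^ e i}) := by
  classical
  obtain ⟨ι, _, p, hp, e, ⟨E⟩⟩ := Module.equiv_directSum_of_isTorsion (aeval_torsion T)
  refine ⟨{i // e i ≠ 0}, inferInstance, fun i => normalize (p i), fun i => e i, ?_, ?_, ?_, ⟨?_⟩⟩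
  · intro i; exact (normalize_associated (p i)).symm.irreducible (hp i)
  · intro i; exact monic_normalize (hp i).ne_zero
  · intro i; exact Nat.pos_of_ne_zero i.2
  · let E0 : Module.AEval' T ≃ₗ[F[X]] ∀ i, F[X] ⧸ F[X] ∙ p i ^ e i :=
      E.trans (DirectSum.linearEquivFunOnFintype F[X] ι _)
    have hs : ∀ i, e i = 0 → Subsingleton (F[X] ⧸ F[X] ∙ p i ^ e i) := by
      intro i hi
      rw [hi, pow_zero]
      exact Ideal.Quotient.subsingleton_iff.2 Ideal.span_singleton_one
    have h1 : ∀ i : {i // e i ≠ 0}, (F[X] ∙ p i.1 ^ e i.1) = Ideal.span {normalize (p i.1) ^ e i.1} := by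
      intro i
      exact Ideal.span_singleton_eq_span_singleton.2 ((normalize_associated (p i.1)).symm.pow_pow)
    let R : (∀ i, F[X] ⧸ F[X] ∙ p i ^ e i) →ₗ[F[X]] ∀ i : {i // e i ≠ 0}, F[X] ⧸ F[X] ∙ p i.1 ^ e i.1 :=
      LinearMap.pi fun i => LinearMap.proj i.1
    have hR : Function.Bijective R := by
      constructor
      · intro x y h
        funext i
        by_cases hi : e i = 0
        · haveI := hs i hi; exact Subsingleton.elim _ _
        · exact congrFun h ⟨i, hi⟩
      · intro y
        refine ⟨fun i => if hi : e i ≠ 0 then y ⟨i, hi⟩ else 0, ?_⟩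
        funext i
        change (if hi : e i.1 ≠ 0 then y ⟨i.1, hi⟩ else 0) = y i
        rw [dif_pos i.2]
    let E1 := LinearEquiv.ofBijective R hR
    let E2 : (∀ i : {i // e i ≠ 0}, F[X] ⧸ F[X] ∙ p i.1 ^ e i.1) ≃ₗ[F[X]]
        ∀ i : {i // e i ≠ 0}, F[X] ⧸ Ideal.span {normalize (p i.1) ^ e i.1} :=
      LinearEquiv.piCongrRight fun i => Submodule.quotEquivOfEq _ _ (h1 i)
    exact (E0.trans E1).trans E2

theorem pi_finrank {V : Type} [AddCommGroup V] [Module F V] [Module.Finite F V] (T : V →ₗ[F] V)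
    {ι : Type} [Fintype ι] {p : ι → F[X]} {e : ι → ℕ} (hp : ∀ i, (p i).Monic)
    (E : Module.AEval' T ≃ₗ[F[X]] ∀ i, F[X] ⧸ Ideal.span {p i ^ e i}) :
    ∑ i, e i * (p i).natDegree = Module.finrank F V := by
  have h1 := (E.restrictScalars F).finrank_eq
  have h2 := (Module.AEval'.of T).finrank_eq
  haveI : ∀ i, Module.Finite F (F[X] ⧸ Ideal.span {p i ^ e i}) := fun i => ((hp i).pow (e i)).finite_quotient
  rw [h2, h1, Module.finrank_pi_fintype]
  refine Finset.sum_congr rfl fun i _ => ?_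
  rw [finrank_quotient_span_eq_natDegree, natDegree_pow]

theorem pi_equiv {ι ι' : Type} [Fintype ι] [Fintype ι'] {p : ι → F[X]} {e : ι → ℕ} {p' : ι' → F[X]} {e' : ι' → ℕ}
    (σ : ι ≃ ι') (h1 : ∀ i, p' (σ i) = p i) (h2 : ∀ i, e' (σ i) = e i) :
    Nonempty ((∀ i, F[X] ⧸ Ideal.span {p i ^ e i}) ≃ₗ[F[X]] ∀ i, F[X] ⧸ Ideal.span {p' i ^ e' i}) := by
  let E1 : (∀ i, F[X] ⧸ Ideal.span {p i ^ e i}) ≃ₗ[F[X]] ∀ i, F[X] ⧸ Ideal.span {p' (σ i) ^ e' (σ i)} :=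
    LinearEquiv.piCongrRight fun i => Submodule.quotEquivOfEq _ _ (by rw [h1, h2])
  exact ⟨E1.trans (LinearEquiv.piCongrLeft F[X] (fun i => F[X] ⧸ Ideal.span {p' i ^ e' i}) σ)⟩

theorem conj_of_aeval {m : ℕ} (g h : GL (Fin m) F)
    (E : Module.AEval' (Matrix.toLin' g.1) ≃ₗ[F[X]] Module.AEval' (Matrix.toLin' h.1)) : IsConj g h := by
  let E' : (Fin m → F) ≃ₗ[F] (Fin m → F) :=
    ((Module.AEval'.of (Matrix.toLin' g.1)).trans (E.restrictScalars F)).trans (Module.AEval'.of (Matrix.toLin' h.1)).symm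
  have hE : ∀ v, E' (g.1 *ᵥ v) = h.1 *ᵥ E' v := by
    intro v
    change (Module.AEval'.of (Matrix.toLin' h.1)).symm (E (Module.AEval'.of (Matrix.toLin' g.1) (Matrix.toLin' g.1 v))) = _
    rw [← Module.AEval'.X_smul_of, E.map_smul, Module.AEval'.of_symm_X_smul]
    rfl
  obtain ⟨P, hP⟩ := exists_lin (LinearEquiv.refl F (Fin m → F)) (x := E'.toLinearMap) E'.bijective
  have hP' : ∀ v, P.1 *ᵥ v = E' v := fun v => (congrArg (fun t : Module.End F (Fin m → F) => t v) hP).symm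
  rw [isConj_iff]
  refine ⟨P, ?_⟩
  rw [mul_inv_eq_iff_eq_mul]
  apply Units.ext
  apply Matrix.toLin'.injective
  apply LinearMap.ext
  intro v
  simp only [Units.val_mul, Matrix.toLin'_apply]
  rw [← Matrix.mulVec_mulVec, ← Matrix.mulVec_mulVec, hP', hP', hE]
end PartD1
set_option linter.unusedSectionVars false
set_option linter.style.haveILetI false

section PartD2
open Polynomial
variable {F : Type} [Field F] [Fintype F] [DecidableEq F]

theorem nf_of {ι : Type} [Fintype ι] {p : ι → F[X]} {e : ι → ℕ} (hp : ∀ i, Irreducible (p i))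
    (hm : ∀ i, (p i).Monic) (k : ℕ) (P : F[X]) :
    (UniqueFactorizationMonoid.normalizedFactors (∏ i, if e i = k then p i else 1)).count P
      = Fintype.card {i // (p i, e i) = (P, k)} := by
  classical
  have h0 : (∏ i, if e i = k then p i else 1) = ((Finset.univ.filter (fun i => e i = k)).val.map p).prod := by
    rw [← Finset.prod_filter]; rfl
  rw [h0, UniqueFactorizationMonoid.normalizedFactors_prod_eq _ (by
    intro a ha
    obtain ⟨i, _, rfl⟩ := Multiset.mem_map.1 ha
    exact hp i), Multiset.map_map]
  have h1 : (normalize ∘ p) = p := by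
    funext i; exact (hm i).normalize_eq_self
  rw [h1, Multiset.count_map, Fintype.card_subtype, ← Finset.filter_val, Finset.card_val, Finset.filter_filter]
  congr 1
  ext i
  simp only [Finset.mem_filter, Finset.mem_univ, true_and, Prod.mk.injEq]
  exact ⟨fun h => ⟨h.2.symm, h.1⟩, fun h => ⟨h.2, h.1.symm⟩⟩

theorem exists_inv (m : ℕ) : ∃ H : GL (Fin m) F → Fin m → F[X], (∀ g j, (H g j).Monic) ∧
    (∀ g, ∑ j : Fin m, (j.1 + 1) * (H g j).natDegree = m) ∧ (∀ g h, H g = H h → IsConj g h) := by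
  classical
  choose ι fι p e hirr hmon hpos hE using fun g : GL (Fin m) F => struct_pi (Matrix.toLin' g.1)
  have hsum : ∀ g, ∑ i, e g i * (p g i).natDegree = m := by
    intro g
    obtain ⟨E⟩ := hE g
    rw [pi_finrank _ (hmon g) E, finrank_fin]
  have hle : ∀ g i, e g i ≤ m := by
    intro g i
    have h1 := Finset.single_le_sum (f := fun i => e g i * (p g i).natDegree) (fun _ _ => Nat.zero_le _) (Finset.mem_univ i)
    rw [hsum g] at h1
    have h2 : 0 < (p g i).natDegree := (hirr g i).natDegree_pos
    nlinarith
  refine ⟨fun g j => ∏ i, if e g i = j.1 + 1 then p g i else 1, ?_, ?_, ?_⟩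
  · intro g j
    apply monic_prod_of_monic
    intro i _
    split_ifs
    · exact hmon g i
    · exact monic_one
  · intro g
    have h1 : ∀ j : Fin m, (∏ i, if e g i = j.1 + 1 then p g i else 1).natDegree
        = ∑ i, if e g i = j.1 + 1 then (p g i).natDegree else 0 := by
      intro j
      rw [natDegree_prod_of_monic]
      · refine Finset.sum_congr rfl fun i _ => ?_
        split_ifs <;> simp
      · intro i _
        split_ifs
        · exact hmon g i
        · exact monic_one
    simp only [h1, Finset.mul_sum]
    rw [Finset.sum_comm]
    refine Eq.trans (Finset.sum_congr rfl fun i _ => ?_) (hsum g)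
    have hi := hpos g i
    have hi' := hle g i
    rw [Finset.sum_eq_single (⟨e g i - 1, by omega⟩ : Fin m)]
    · have : e g i = e g i - 1 + 1 := by omega
      rw [if_pos this]
      congr 1
      exact this.symm
    · intro j _ hj
      rw [if_neg, mul_zero]
      intro h
      apply hj
      apply Fin.ext
      change j.1 = e g i - 1
      omega
    · intro h; exact absurd (Finset.mem_univ _) h
  · intro g h hgh
    have hc : ∀ c : F[X] × ℕ, Nonempty ({i // (p g i, e g i) = c} ≃ {i // (p h i, e h i) = c}) := by
      rintro ⟨P, k⟩
      rw [← Fintype.card_eq]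
      by_cases hk : 0 < k ∧ k ≤ m
      · have h1 := congrFun hgh ⟨k - 1, by omega⟩
        have h2 : k - 1 + 1 = k := by omega
        simp only [h2] at h1
        rw [← nf_of (hirr g) (hmon g), ← nf_of (hirr h) (hmon h), h1]
      · have e1 : ∀ g', IsEmpty {i // (p g' i, e g' i) = (P, k)} := by
          intro g'
          refine ⟨?_⟩
          rintro ⟨i, hi⟩
          rw [Prod.mk.injEq] at hi
          have := hpos g' i
          have := hle g' i
          omega
        haveI := e1 g
        haveI := e1 h
        rw [Fintype.card_eq_zero, Fintype.card_eq_zero]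
    let σ : ι g ≃ ι h := Equiv.ofFiberEquiv (f := fun i => (p g i, e g i)) (g := fun i => (p h i, e h i))
      (fun c => (hc c).some)
    have hσ : ∀ i, (p h (σ i), e h (σ i)) = (p g i, e g i) := fun i =>
      Equiv.ofFiberEquiv_map (f := fun i => (p g i, e g i)) (g := fun i => (p h i, e h i)) (fun c => (hc c).some) i
    obtain ⟨E⟩ := pi_equiv (p := p g) (e := e g) (p' := p h) (e' := e h) σ
      (fun i => congrArg Prod.fst (hσ i)) (fun i => congrArg Prod.snd (hσ i))
    obtain ⟨E1⟩ := hE g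
    obtain ⟨E2⟩ := hE h
    exact conj_of_aeval g h ((E1.trans E).trans E2.symm)

theorem geo_bound (q y : ℝ) (hq : 1 ≤ q) (hy : 0 < y) (hqy : q * y < 1) (m : ℕ) :
    ∏ j : Fin m, (∑ k : Fin (m + 1), q ^ k.1 * (y ^ (j.1 + 1)) ^ k.1) ≤ Real.exp (q / (1 - q * y) * (1 - y)⁻¹) := by
  have hy1 : y < 1 := by nlinarith
  have hpos : 0 < 1 - q * y := by linarith
  have step : ∀ j : Fin m, (∑ k : Fin (m + 1), q ^ k.1 * (y ^ (j.1 + 1)) ^ k.1) ≤ Real.exp (q / (1 - q * y) * y ^ j.1) := by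
    intro j
    have hj : 0 < y ^ j.1 := by positivity
    have hj1 : y ^ j.1 ≤ 1 := pow_le_one₀ hy.le hy1.le
    set t := q * y ^ (j.1 + 1) with ht
    have ht0 : 0 < t := by positivity
    have htq : t ≤ q * y := by rw [ht, pow_succ]; nlinarith [mul_pos (by linarith : 0 < q) hy]
    have ht1 : t < 1 := by linarith
    have h1 : (∑ k : Fin (m + 1), q ^ k.1 * (y ^ (j.1 + 1)) ^ k.1) = ∑ k ∈ Finset.range (m + 1), t ^ k := by
      rw [← Fin.sum_univ_eq_sum_range (fun k => t ^ k)]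
      refine Finset.sum_congr rfl fun k _ => ?_
      rw [ht, mul_pow]
    rw [h1]
    have h2 : ∑ k ∈ Finset.range (m + 1), t ^ k ≤ (1 - t)⁻¹ := by
      rw [← tsum_geometric_of_lt_one ht0.le ht1]
      exact (summable_geometric_of_lt_one ht0.le ht1).sum_le_tsum _ (fun i _ => by positivity)
    have h3 : (1 - t)⁻¹ = t / (1 - t) + 1 := by
      have : 1 - t ≠ 0 := by linarith
      field_simp; ring
    have h4 : t / (1 - t) ≤ q / (1 - q * y) * y ^ j.1 := by
      rw [div_mul_eq_mul_div]
      apply div_le_div₀ (by positivity) _ hpos (by linarith)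
      rw [ht, pow_succ]
      have : 0 < q := by linarith
      apply mul_le_mul_of_nonneg_left _ this.le
      nlinarith
    have h5 := Real.add_one_le_exp (t / (1 - t))
    have h6 := Real.exp_le_exp.2 h4
    linarith
  calc _ ≤ ∏ j : Fin m, Real.exp (q / (1 - q * y) * y ^ j.1) := by
        refine Finset.prod_le_prod (fun j _ => ?_) (fun j _ => step j)
        refine Finset.sum_nonneg fun k _ => ?_
        have : 0 ≤ q := by linarith
        positivity
    _ = Real.exp (∑ j : Fin m, q / (1 - q * y) * y ^ j.1) := (Real.exp_sum _ _).symm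
    _ ≤ _ := by
        rw [Real.exp_le_exp, ← Finset.mul_sum]
        have : 0 < q := by linarith
        apply mul_le_mul_of_nonneg_left _ (by positivity)
        rw [Fin.sum_univ_eq_sum_range (fun k => y ^ k), ← tsum_geometric_of_lt_one hy.le hy1]
        exact (summable_geometric_of_lt_one hy.le hy1).sum_le_tsum _ (fun i _ => by positivity)

theorem cls_weight (m : ℕ) (y : ℝ) (hy : 0 < y) :
    (Nat.card (ConjClasses (GL (Fin m) F)) : ℝ) * y ^ m ≤
      ∏ j : Fin m, (∑ k : Fin (m + 1), (Fintype.card F : ℝ) ^ k.1 * (y ^ (j.1 + 1)) ^ k.1) := by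
  classical
  obtain ⟨H, hmon, hsum, hinj⟩ := exists_inv (F := F) m
  haveI : Fintype (ConjClasses (GL (Fin m) F)) := Fintype.ofFinite _
  have hdeg : ∀ g j, (H g j).natDegree < m + 1 := by
    intro g j
    have h1 := Finset.single_le_sum (f := fun j : Fin m => (j.1 + 1) * (H g j).natDegree) (fun _ _ => Nat.zero_le _) (Finset.mem_univ j)
    rw [hsum g] at h1
    nlinarith
  let cd : GL (Fin m) F → Fin m → (Σ k : Fin (m + 1), (Fin k.1 → F)) := fun g j =>
    ⟨⟨(H g j).natDegree, hdeg g j⟩, fun i => (H g j).coeff i.1⟩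
  have cinj : ∀ g h, cd g = cd h → H g = H h := by
    intro g h hh
    funext j
    have h1 := congrFun hh j
    have key : ∀ (a b : F[X]) (ha : a.natDegree < m + 1) (hb : b.natDegree < m + 1), a.Monic → b.Monic →
        (⟨⟨a.natDegree, ha⟩, fun i => a.coeff i.1⟩ : Σ k : Fin (m + 1), (Fin k.1 → F)) = ⟨⟨b.natDegree, hb⟩, fun i => b.coeff i.1⟩ → a = b := by
      intro a b ha hb hma hmb hab
      have hd : a.natDegree = b.natDegree := congrArg (fun s : (Σ k : Fin (m + 1), (Fin k.1 → F)) => s.1.1) hab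
      have hc : ∀ i, i < a.natDegree → a.coeff i = b.coeff i := by
        intro i hi
        have := congrArg (fun s : (Σ k : Fin (m + 1), (Fin k.1 → F)) => if h : i < s.1.1 then s.2 ⟨i, h⟩ else 0) hab
        simpa [hi, hd ▸ hi] using this
      ext i
      rcases lt_trichotomy i a.natDegree with hi | hi | hi
      · exact hc i hi
      · rw [hi]; conv_rhs => rw [hd]
        rw [hma.coeff_natDegree, hmb.coeff_natDegree]
      · rw [coeff_eq_zero_of_natDegree_lt hi, coeff_eq_zero_of_natDegree_lt (hd ▸ hi)]
    exact key _ _ _ _ (hmon g j) (hmon h j) h1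
  let φ : ConjClasses (GL (Fin m) F) → (Fin m → (Σ k : Fin (m + 1), (Fin k.1 → F))) := fun c => cd c.out
  have φinj : Function.Injective φ := by
    intro c c' h
    have := hinj _ _ (cinj _ _ h)
    rw [← ConjClasses.mk_eq_mk_iff_isConj] at this
    have e1 : ∀ c : ConjClasses (GL (Fin m) F), ConjClasses.mk c.out = c := fun c => Quotient.out_eq c
    rwa [e1, e1] at this
  let w : (Fin m → (Σ k : Fin (m + 1), (Fin k.1 → F))) → ℝ := fun s => ∏ j : Fin m, (y ^ (j.1 + 1)) ^ (s j).1.1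
  have hw : ∀ c, w (φ c) = y ^ m := by
    intro c
    change ∏ j : Fin m, (y ^ (j.1 + 1)) ^ (H c.out j).natDegree = _
    conv_rhs => rw [← hsum c.out]
    rw [← Finset.prod_pow_eq_pow_sum]
    refine Finset.prod_congr rfl fun j _ => ?_
    rw [pow_mul]
  have h1 : (Nat.card (ConjClasses (GL (Fin m) F)) : ℝ) * y ^ m = ∑ c, w (φ c) := by
    simp only [hw]
    rw [Finset.sum_const, Finset.card_univ, nsmul_eq_mul, Nat.card_eq_fintype_card]
  rw [h1]
  have h2 : ∑ c, w (φ c) ≤ ∑ s, w s := by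
    rw [← Finset.sum_image (f := w) (g := φ) (s := Finset.univ) (fun a _ b _ h => φinj h)]
    exact Finset.sum_le_sum_of_subset_of_nonneg (Finset.subset_univ _) (fun s _ _ => Finset.prod_nonneg fun j _ => by positivity)
  refine h2.trans (le_of_eq ?_)
  have h3 : ∀ j : Fin m, (∑ k : Fin (m + 1), (Fintype.card F : ℝ) ^ k.1 * (y ^ (j.1 + 1)) ^ k.1)
      = ∑ s : (Σ k : Fin (m + 1), (Fin k.1 → F)), (y ^ (j.1 + 1)) ^ s.1.1 := by
    intro j
    rw [Fintype.sum_sigma]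
    refine Finset.sum_congr rfl fun k _ => ?_
    change _ = ∑ _z : Fin k.1 → F, (y ^ (j.1 + 1)) ^ k.1
    rw [Finset.sum_const, Finset.card_univ, nsmul_eq_mul, Fintype.card_fun, Fintype.card_fin]
    push_cast; rfl
  simp only [h3]
  rw [Finset.prod_univ_sum, Fintype.piFinset_univ]

theorem ch_upper (x : ℝ) (hx : (Fintype.card F : ℝ) < x) :
    ∃ C : ℝ, 0 < C ∧ ∀ m, (Fintype.card (Ch F m) : ℝ) ≤ C * x ^ m := by
  have hq : (1 : ℝ) ≤ Fintype.card F := by exact_mod_cast Fintype.card_pos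
  have hx0 : 0 < x := by linarith
  refine ⟨_, Real.exp_pos ((Fintype.card F : ℝ) / (1 - Fintype.card F * x⁻¹) * (1 - x⁻¹)⁻¹), fun m => ?_⟩
  have h1 := cls_weight (F := F) m x⁻¹ (by positivity)
  have h2 := geo_bound (Fintype.card F) x⁻¹ hq (by positivity) (by
    rw [← div_eq_mul_inv, div_lt_one hx0]; exact hx) m
  have h3 := h1.trans h2
  rw [inv_pow, ← div_eq_mul_inv, div_le_iff₀ (by positivity)] at h3
  rw [← Nat.card_eq_fintype_card, card_irr_eq]
  exact h3
end PartD2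
set_option linter.unusedSectionVars false
set_option linter.style.haveILetI false

section PartD3
open Polynomial
variable {F : Type} [Field F] [Fintype F] [DecidableEq F]

theorem exists_charpoly (N : ℕ) (f : F[X]) (hf : f.Monic) (hN : f.natDegree = N) :
    ∃ A : Matrix (Fin N) (Fin N) F, A.charpoly = f := by
  subst hN
  refine ⟨Algebra.leftMulMatrix (AdjoinRoot.powerBasis' hf).basis (AdjoinRoot.powerBasis' hf).gen, ?_⟩
  refine (charpoly_leftMulMatrix (AdjoinRoot.powerBasis' hf)).trans ?_
  rw [AdjoinRoot.powerBasis'_gen, AdjoinRoot.minpoly_root hf.ne_zero, hf.leadingCoeff]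
  simp

theorem exists_gl (n : ℕ) (c : Fin (n + 1) → F) (h0 : c 0 ≠ 0) :
    ∃ A : GL (Fin (n + 1)) F, ∀ i : Fin (n + 1), A.1.charpoly.coeff i.1 = c i := by
  have hdeg : (∑ i : Fin (n + 1), monomial i.1 (c i)).degree < ((n + 1 : ℕ) : WithBot ℕ) := by
    refine (degree_sum_le _ _).trans_lt ?_
    rw [Finset.sup_lt_iff (WithBot.bot_lt_coe _)]
    intro i _
    refine (degree_monomial_le _ _).trans_lt ?_
    exact_mod_cast i.2
  have hmon : (X ^ (n + 1) + ∑ i : Fin (n + 1), monomial i.1 (c i)).Monic := monic_X_pow_add hdeg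
  have hnd : (X ^ (n + 1) + ∑ i : Fin (n + 1), monomial i.1 (c i)).natDegree = n + 1 := by
    rw [natDegree_add_eq_left_of_degree_lt (by rw [degree_X_pow]; exact hdeg), natDegree_X_pow]
  obtain ⟨A, hA⟩ := exists_charpoly (n + 1) _ hmon hnd
  have hc : ∀ i : Fin (n + 1), A.charpoly.coeff i.1 = c i := by
    intro i
    rw [hA, coeff_add, coeff_X_pow, if_neg (by have := i.2; omega), zero_add, finsetSum_coeff,
      Finset.sum_eq_single i]
    · rw [coeff_monomial, if_pos rfl]
    · intro j _ hj
      rw [coeff_monomial, if_neg (fun h => hj (Fin.ext h))]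
    · intro h; exact absurd (Finset.mem_univ _) h
  have hdet : A.det ≠ 0 := by
    rw [Matrix.det_eq_sign_charpoly_coeff]
    have := hc 0
    rw [Fin.val_zero] at this
    rw [this]
    exact mul_ne_zero (pow_ne_zero _ (neg_ne_zero.2 one_ne_zero)) h0
  exact ⟨Matrix.GeneralLinearGroup.mkOfDetNeZero A hdet, hc⟩

theorem ch_lower (N : ℕ) (hN : 0 < N) : (Fintype.card F : ℝ) ^ N / 2 ≤ Fintype.card (Ch F N) := by
  obtain ⟨n, rfl⟩ : ∃ n, N = n + 1 := ⟨N - 1, by omega⟩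
  choose A hA using fun u : Fˣ × (Fin n → F) => exists_gl n (Fin.cons (u.1 : F) u.2) (by simp)
  have hinj : Function.Injective (fun u => ConjClasses.mk (A u)) := by
    intro u v h
    have h : ConjClasses.mk (A u) = ConjClasses.mk (A v) := h
    rw [ConjClasses.mk_eq_mk_iff_isConj, isConj_iff] at h
    obtain ⟨P, hP⟩ := h
    have h1 : (A v).1.charpoly = (A u).1.charpoly := by
      rw [← hP]
      rw [Units.val_mul, Units.val_mul, Matrix.coe_units_inv]
      exact Matrix.charpoly_units_conj P (A u).1
    have h2 : ∀ i, (Fin.cons (u.1 : F) u.2 : Fin (n + 1) → F) i = (Fin.cons (v.1 : F) v.2 : Fin (n + 1) → F) i := by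
      intro i
      rw [← hA, ← hA, h1]
    apply Prod.ext
    · exact Units.ext (h2 0)
    · funext i
      have := h2 i.succ
      simpa using this
  have h1 := Nat.card_le_card_of_injective _ hinj
  rw [← card_irr_eq, Nat.card_eq_fintype_card, Nat.card_eq_fintype_card, Fintype.card_prod, Fintype.card_fun,
    Fintype.card_fin, Fintype.card_units] at h1
  have h2 : 1 < Fintype.card F := Fintype.one_lt_card
  have h3 : ((Fintype.card F : ℝ) - 1) * (Fintype.card F : ℝ) ^ n ≤ Fintype.card (Ch F (n + 1)) := by
    have : ((Fintype.card F - 1 : ℕ) : ℝ) = (Fintype.card F : ℝ) - 1 := by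
      rw [Nat.cast_sub h2.le]; simp
    rw [← this]
    exact_mod_cast h1
  have h4 : (2 : ℝ) ≤ Fintype.card F := by exact_mod_cast h2
  have h5 : (0 : ℝ) ≤ (Fintype.card F : ℝ) ^ n := by positivity
  rw [pow_succ]
  nlinarith
end PartD3
set_option linter.unusedSectionVars false
set_option linter.style.haveILetI false

section PartE3

theorem IsIrrChar.integral {G : Type} [Group G] [Fintype G] {χ : G → ℂ} (hχ : IsIrrChar G χ) (g : G) :
    IsIntegral ℤ (χ g) := by
  obtain ⟨V, _, rfl⟩ := hχ
  change IsIntegral ℤ (LinearMap.trace ℂ V (V.ρ g))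
  rw [Module.End.trace_eq_sum_roots_charpoly_of_splits (IsAlgClosed.splits _)]
  refine IsIntegral.multiset_sum ?_
  intro x hx
  have h1 : Module.End.HasEigenvalue (V.ρ g) x := by
    rw [Module.End.hasEigenvalue_iff_isRoot_charpoly]
    exact Polynomial.isRoot_of_mem_roots hx
  obtain ⟨v, hv⟩ := h1.exists_hasEigenvector
  have h2 := hv.pow_apply (Fintype.card G)
  rw [← map_pow, pow_card_eq_one, map_one] at h2
  have h3 : x ^ Fintype.card G = 1 := by
    have h4 : (x ^ Fintype.card G - 1) • v = 0 := by
      rw [sub_smul, ← h2]; simp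
    rcases smul_eq_zero.1 h4 with h | h
    · exact sub_eq_zero.1 h
    · exact absurd h hv.2
  refine IsIntegral.of_pow (n := Fintype.card G) Fintype.card_pos ?_
  rw [h3]; exact isIntegral_one

theorem nat_int (k : ℕ) : IsIntegral ℤ (k : ℂ) := isIntegral_algebraMap (R := ℤ) (x := (k : ℤ))

theorem bez (z : ℂ) (hz : IsIntegral ℤ z) (m u : ℕ) (hm : m ≠ 0) (h : Nat.Coprime u m)
    (h1 : IsIntegral ℤ (z * u / m)) : IsIntegral ℤ (z / m) := by
  have hb := Nat.isCoprime_iff_coprime.2 h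
  obtain ⟨s, t, hst⟩ := hb
  have hst' : (s : ℂ) * u + t * m = 1 := by exact_mod_cast hst
  have hm' : (m : ℂ) ≠ 0 := Nat.cast_ne_zero.2 hm
  have : z / m = s * (z * u / m) + t * z := by
    field_simp
    linear_combination -z * hst'
  rw [this]
  exact ((isIntegral_algebraMap (R := ℤ) (x := s)).mul h1).add ((isIntegral_algebraMap (R := ℤ) (x := t)).mul hz)

theorem bez2 (z : ℂ) (a b : ℕ) (ha : a ≠ 0) (hb : b ≠ 0) (h : Nat.Coprime a b)
    (h1 : IsIntegral ℤ (z / a)) (h2 : IsIntegral ℤ (z / b)) : IsIntegral ℤ (z / ((a * b : ℕ) : ℂ)) := by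
  have ha' : (a : ℂ) ≠ 0 := Nat.cast_ne_zero.2 ha
  have h3 : IsIntegral ℤ (z / a / b) := by
    refine bez (z / a) h1 b a hb h ?_
    rwa [div_mul_cancel₀ _ ha']
  rwa [Nat.cast_mul, ← div_div]

theorem dvd_of_deg {G : Type} [Group G] [Fintype G] {χ : G → ℂ} (hχ : IsIrrChar G χ) (g : G) (ℓ a b : ℕ)
    (hℓ : ℓ.Prime) (hb : padicValNat ℓ (Nat.card {x // IsConj g x}) + a ≤ b)
    (h : IsIntegral ℤ (χ 1 / (ℓ : ℂ) ^ b)) : IsIntegral ℤ (χ g / ((ℓ ^ a : ℕ) : ℂ)) := by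
  set K := Nat.card {x // IsConj g x} with hK
  have hK0 : K ≠ 0 := by
    haveI : Nonempty {x // IsConj g x} := ⟨⟨g, IsConj.refl g⟩⟩
    exact Nat.card_pos.ne'
  haveI := Fact.mk hℓ
  obtain ⟨u, hu⟩ := pow_padicValNat_dvd (p := ℓ) (n := K)
  have hcop : Nat.Coprime u (ℓ ^ a) := by
    apply Nat.Coprime.pow_right
    rw [Nat.coprime_comm, hℓ.coprime_iff_not_dvd]
    rintro ⟨w, hw⟩
    apply pow_succ_padicValNat_not_dvd (p := ℓ) hK0
    refine ⟨w, ?_⟩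
    rw [pow_succ, mul_assoc, ← hw, ← hu]
  refine bez (χ g) (hχ.integral g) _ u (pow_ne_zero _ hℓ.ne_zero) hcop ?_
  have h1 := ((hχ.central g).mul h).mul (nat_int (ℓ ^ (b - padicValNat ℓ K - a)))
  rw [← hK] at h1
  obtain ⟨k, hk, hk1⟩ := hχ.deg_pos
  have hχ1 : χ 1 ≠ 0 := by rw [hk1]; exact Nat.cast_ne_zero.2 hk.ne'
  have hℓ0 : (ℓ : ℂ) ≠ 0 := Nat.cast_ne_zero.2 hℓ.ne_zero
  have hKu : (K : ℂ) = (ℓ : ℂ) ^ padicValNat ℓ K * u := by exact_mod_cast hu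
  have hbb : (ℓ : ℂ) ^ b = (ℓ : ℂ) ^ (b - padicValNat ℓ K - a) * (ℓ : ℂ) ^ padicValNat ℓ K * (ℓ : ℂ) ^ a := by
    rw [← pow_add, ← pow_add]; congr 1; omega
  refine (congrArg (IsIntegral ℤ) ?_).mp h1
  symm
  rw [hbb, hKu]
  push_cast
  field_simp

theorem card_conj {G : Type} [Group G] [Fintype G] (g : G) :
    Nat.card {x // IsConj g x} * Nat.card (Subgroup.centralizer {g}) = Nat.card G := by
  rw [Subgroup.nat_card_centralizer_nat_card_stabilizer]
  have h2 : Nat.card {x // IsConj g x} = Nat.card (MulAction.orbit (ConjAct G) g) := by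
    apply Nat.card_congr
    apply Equiv.subtypeEquivRight
    intro x
    rw [ConjAct.mem_orbit_conjAct, isConj_comm]
  rw [h2]
  have h3 : Nat.card G = Nat.card (ConjAct G) := rfl
  rw [h3, ← Nat.card_congr (MulAction.orbitProdStabilizerEquivGroup (ConjAct G) g), Nat.card_prod]

variable {F : Type} [Field F] [Fintype F] [DecidableEq F]

noncomputable def botHom (n₀ n : ℕ) (h : n₀ ≤ n) :
    Matrix (Fin (n - n₀)) (Fin (n - n₀)) F →* Matrix (Fin n) (Fin n) F :=
  (Matrix.reindexAlgEquiv F F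
      ((finSumFinEquiv (m := n₀) (n := n - n₀)).trans
        (finCongr (Nat.add_sub_cancel' h)))).toAlgHom.toMonoidHom.comp
    { toFun := fun A => Matrix.fromBlocks 1 0 0 A
      map_one' := by simp [Matrix.fromBlocks_one]
      map_mul' := fun A B => by
        simp [Matrix.fromBlocks_multiply] }

theorem bot_comm (n₀ n : ℕ) (h : n₀ ≤ n) (A : Matrix (Fin n₀) (Fin n₀) F) (B : Matrix (Fin (n - n₀)) (Fin (n - n₀)) F) :
    blockOneHom F n₀ n h A * botHom n₀ n h B = botHom n₀ n h B * blockOneHom F n₀ n h A := by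
  change (Matrix.reindexAlgEquiv F F _ (Matrix.fromBlocks A 0 0 1)) * (Matrix.reindexAlgEquiv F F _ (Matrix.fromBlocks 1 0 0 B))
    = (Matrix.reindexAlgEquiv F F _ (Matrix.fromBlocks 1 0 0 B)) * (Matrix.reindexAlgEquiv F F _ (Matrix.fromBlocks A 0 0 1))
  rw [← map_mul, ← map_mul]
  simp [Matrix.fromBlocks_multiply]

theorem bot_inj (n₀ n : ℕ) (h : n₀ ≤ n) : Function.Injective (botHom (F := F) n₀ n h) := by
  intro A B hAB
  have h1 : Matrix.fromBlocks 1 0 0 A = Matrix.fromBlocks (1 : Matrix (Fin n₀) (Fin n₀) F) 0 0 B :=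
    (Matrix.reindexAlgEquiv F F ((finSumFinEquiv (m := n₀) (n := n - n₀)).trans
        (finCongr (Nat.add_sub_cancel' h)))).injective hAB
  exact (Matrix.fromBlocks_inj.1 h1).2.2.2

theorem cl_dvd (n₀ n : ℕ) (g : GL (Fin n₀) F) :
    Nat.card {x // IsConj (glEmbed (Nat.le_add_right n₀ n) g) x} * Nat.card (GL (Fin n) F) ∣
      Nat.card (GL (Fin (n₀ + n)) F) := by
  rw [← card_conj (glEmbed (Nat.le_add_right n₀ n) g)]
  apply Nat.mul_dvd_mul_left
  have e1 : Nat.card (GL (Fin n) F) = Nat.card (GL (Fin (n₀ + n - n₀)) F) := by rw [Nat.add_sub_cancel_left]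
  rw [e1]
  let φ : GL (Fin (n₀ + n - n₀)) F →* Subgroup.centralizer {glEmbed (Nat.le_add_right n₀ n) g} :=
    (Units.map (botHom n₀ (n₀ + n) (Nat.le_add_right n₀ n))).codRestrict _ (by
      intro B
      rw [Subgroup.mem_centralizer_singleton_iff]
      apply Units.ext
      exact (bot_comm n₀ (n₀ + n) (Nat.le_add_right n₀ n) g.1 B.1).symm)
  apply Subgroup.card_dvd_of_injective φ
  intro A B hAB
  have h2 := congrArg (fun t : Subgroup.centralizer {glEmbed (Nat.le_add_right n₀ n) g} => t.1.1) hAB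
  exact Units.ext (bot_inj _ _ _ h2)
end PartE3
set_option linter.unusedSectionVars false
set_option linter.style.haveILetI false

section PartE4

theorem pv_mono (ℓ a b : ℕ) [Fact ℓ.Prime] (hb : b ≠ 0) (h : a ∣ b) : padicValNat ℓ a ≤ padicValNat ℓ b :=
  (padicValNat_dvd_iff_le hb).1 (pow_padicValNat_dvd.trans h)

theorem pv_prod (ℓ : ℕ) [Fact ℓ.Prime] {ι : Type} (s : Finset ι) (f : ι → ℕ) (h : ∀ i ∈ s, f i ≠ 0) :
    padicValNat ℓ (∏ i ∈ s, f i) = ∑ i ∈ s, padicValNat ℓ (f i) := by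
  classical
  induction s using Finset.induction_on with
  | empty => simp
  | insert a s ha ih =>
    rw [Finset.prod_insert ha, Finset.sum_insert ha, padicValNat.mul (h a (Finset.mem_insert_self a s))
      (Finset.prod_ne_zero_iff.2 fun i hi => h i (Finset.mem_insert_of_mem hi)),
      ih fun i hi => h i (Finset.mem_insert_of_mem hi)]

theorem tot_dvd (ℓ q : ℕ) (h : Nat.Coprime q ℓ) (i : ℕ) (hi : ℓ.totient ∣ i) : ℓ ∣ q ^ i - 1 := by
  obtain ⟨k, rfl⟩ := hi
  have h1 := (Nat.ModEq.pow_totient h).pow k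
  rw [← pow_mul, one_pow] at h1
  rcases Nat.eq_zero_or_pos (q ^ (ℓ.totient * k)) with h0 | h0
  · rw [h0]; simp
  · exact (Nat.modEq_iff_dvd' h0).1 h1.symm

theorem pv_pow (ℓ q : ℕ) (hℓ : ℓ.Prime) (hq : 1 < q) (h : Nat.Coprime q ℓ) :
    ∃ K, ∀ j, 0 < j → padicValNat ℓ (q ^ j - 1) ≤ K + Nat.log 2 j := by
  haveI := Fact.mk hℓ
  have hlog : ∀ j, padicValNat ℓ j ≤ Nat.log 2 j := fun j =>
    (padicValNat_le_nat_log j).trans (Nat.log_anti_left (by norm_num) hℓ.two_le)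
  have hnd : ¬ ℓ ∣ q := fun hd => by
    have := Nat.dvd_gcd hd dvd_rfl
    rw [h] at this
    exact hℓ.one_lt.ne' (Nat.dvd_one.1 this)
  have hne : ∀ j, 0 < j → q ^ j - 1 ≠ 0 := fun j hj => by
    have := Nat.one_lt_pow hj.ne' hq
    omega
  have hmul : ∀ j E, 0 < j → 0 < E → padicValNat ℓ (q ^ j - 1) ≤ padicValNat ℓ (q ^ (j * E) - 1) := by
    intro j E hj hE
    apply pv_mono _ _ _ (hne _ (Nat.mul_pos hj hE))
    rw [pow_mul]
    simpa only [one_pow] using Nat.sub_dvd_pow_sub_pow (q ^ j) 1 E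
  rcases hℓ.eq_two_or_odd' with rfl | hodd
  · refine ⟨padicValNat 2 (q + 1) + padicValNat 2 (q - 1) + 1, fun j hj => ?_⟩
    have h1 := padicValNat.pow_two_sub_pow (x := q) (y := 1) hq (by omega) hnd (n := 2 * j) (by omega) (even_two_mul j)
    rw [one_pow, padicValNat.mul (by norm_num) hj.ne', padicValNat_self] at h1
    have h2 := hmul j 2 hj (by norm_num)
    have h3 := hlog j
    rw [mul_comm j 2] at h2
    omega
  · have hE : 0 < ℓ.totient := Nat.totient_pos.2 hℓ.pos
    have hA : 1 < q ^ ℓ.totient := Nat.one_lt_pow hE.ne' hq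
    refine ⟨padicValNat ℓ (q ^ ℓ.totient - 1), fun j hj => ?_⟩
    have h1 := padicValNat.pow_sub_pow hodd (x := q ^ ℓ.totient) (y := 1) hA (tot_dvd ℓ q h _ dvd_rfl)
      (fun hd => hnd (hℓ.dvd_of_dvd_pow hd)) hj.ne'
    have h2 := hmul j _ hj hE
    have h3 := hlog j
    rw [one_pow, ← pow_mul] at h1
    rw [mul_comm] at h2
    omega

variable {F : Type} [Field F] [Fintype F] [DecidableEq F]

theorem pv_gl (ℓ : ℕ) (hℓ : ℓ.Prime) (h : Nat.Coprime (Fintype.card F) ℓ) (m : ℕ) :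
    padicValNat ℓ (Nat.card (GL (Fin m) F)) = ∑ j ∈ Finset.range m, padicValNat ℓ (Fintype.card F ^ (j + 1) - 1) := by
  haveI := Fact.mk hℓ
  have hq : 1 < Fintype.card F := Fintype.one_lt_card
  set q := Fintype.card F with hqd
  have hnd : ¬ ℓ ∣ q := fun hd => by
    have := Nat.dvd_gcd hd dvd_rfl
    rw [h] at this
    exact hℓ.one_lt.ne' (Nat.dvd_one.1 this)
  have hlt : ∀ i : Fin m, q ^ m - q ^ i.1 ≠ 0 := fun i => by
    have := Nat.pow_lt_pow_right hq i.2
    omega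
  rw [Matrix.card_GL_field, ← hqd, pv_prod _ _ _ (fun i _ => hlt i),
    Fin.sum_univ_eq_sum_range (fun i => padicValNat ℓ (q ^ m - q ^ i)), ← Finset.sum_range_reflect]
  refine Finset.sum_congr rfl fun j hj => ?_
  have hj := Finset.mem_range.1 hj
  have e1 : q ^ m - q ^ (m - 1 - j) = q ^ (m - 1 - j) * (q ^ (j + 1) - 1) := by
    rw [Nat.mul_sub, ← pow_add, mul_one]
    congr 2; omega
  have h1 := Nat.one_lt_pow (n := j + 1) (by omega) hq
  rw [e1, padicValNat.mul (pow_ne_zero _ (by omega)) (by omega),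
    padicValNat.eq_zero_of_not_dvd (fun hd => hnd (hℓ.dvd_of_dvd_pow hd)), zero_add]

theorem pv_cl (ℓ : ℕ) (hℓ : ℓ.Prime) (h : Nat.Coprime (Fintype.card F) ℓ) (n₀ : ℕ) :
    ∃ K, ∀ (n : ℕ) (g : GL (Fin n₀) F),
    padicValNat ℓ (Nat.card {x // IsConj (glEmbed (Nat.le_add_right n₀ n) g) x}) ≤ n₀ * (K + Nat.log 2 (n₀ + n)) := by
  haveI := Fact.mk hℓ
  obtain ⟨K, hK⟩ := pv_pow ℓ (Fintype.card F) hℓ Fintype.one_lt_card h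
  refine ⟨K, fun n g => ?_⟩
  have h1 := pv_mono ℓ _ _ (Nat.card_pos (α := GL (Fin (n₀ + n)) F)).ne' (cl_dvd n₀ n g)
  haveI : Nonempty {x // IsConj (glEmbed (Nat.le_add_right n₀ n) g) x} := ⟨⟨_, IsConj.refl _⟩⟩
  rw [padicValNat.mul Nat.card_pos.ne' Nat.card_pos.ne', pv_gl ℓ hℓ h, pv_gl ℓ hℓ h,
    show Finset.range (n₀ + n) = Finset.range (n + n₀) by rw [add_comm], Finset.sum_range_add] at h1
  have h2 : ∑ x ∈ Finset.range n₀, padicValNat ℓ (Fintype.card F ^ (n + x + 1) - 1) ≤ ∑ x ∈ Finset.range n₀, (K + Nat.log 2 (n₀ + n)) := by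
    refine Finset.sum_le_sum fun x hx => ?_
    have hx := Finset.mem_range.1 hx
    refine (hK _ (by omega)).trans ?_
    have := Nat.log_mono_right (b := 2) (show n + x + 1 ≤ n₀ + n by omega)
    omega
  rw [Finset.sum_const, Finset.card_range, smul_eq_mul] at h2
  exact (Nat.le_of_add_le_add_right (h1.trans_eq (add_comm _ _))).trans h2

theorem log_small (c c' : ℕ) : ∀ᶠ N : ℕ in Filter.atTop, c * Nat.log 2 N + c' ≤ N := by
  have h1 := (Real.isLittleO_log_id_atTop.comp_tendsto tendsto_natCast_atTop_atTop).bound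
    (c := Real.log 2 / (2 * (c + 1))) (by have := Real.log_pos (show (1 : ℝ) < 2 by norm_num); positivity)
  filter_upwards [h1, Filter.eventually_ge_atTop (2 * c'), Filter.eventually_ge_atTop 1] with N hN hN' hN1
  have hl : 0 < Real.log 2 := Real.log_pos (by norm_num)
  simp only [Function.comp, id, Real.norm_eq_abs] at hN
  have hNp : (1 : ℝ) ≤ N := by exact_mod_cast hN1
  rw [abs_of_nonneg (Real.log_nonneg hNp), abs_of_nonneg (by linarith)] at hN
  have h2 : (Nat.log 2 N : ℝ) ≤ Real.log N / Real.log 2 := by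
    have := Real.natLog_le_logb N 2
    rwa [Real.logb] at this
  have h3 : Real.log N / Real.log 2 ≤ N / (2 * (c + 1)) := by
    rw [div_le_iff₀ hl]
    calc _ ≤ _ := hN
      _ = _ := by ring
  have h4 : (c : ℝ) * (Nat.log 2 N) ≤ N / 2 := by
    have h5 := h2.trans h3
    rw [le_div_iff₀ (by positivity)] at h5
    have : (0 : ℝ) ≤ Nat.log 2 N := by positivity
    nlinarith
  have h6 : (2 * c' : ℝ) ≤ N := by exact_mod_cast hN'
  have h7 : ((c * Nat.log 2 N + c' : ℕ) : ℝ) ≤ N := by push_cast; linarith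
  exact_mod_cast h7
end PartE4
set_option linter.unusedSectionVars false
set_option linter.style.haveILetI false

section PartE5
open Filter
variable {F : Type} [Field F] [Fintype F] [DecidableEq F]

noncomputable def badN (n₀ : ℕ) (g : GL (Fin n₀) F) (d n : ℕ) : ℝ :=
  (Nat.card {χ : Ch F (n₀ + n) // ¬ IsIntegral ℤ (χ.1 (glEmbed (Nat.le_add_right n₀ n) g) / (d : ℂ))} : ℝ)

theorem badN_nonneg (n₀ : ℕ) (g : GL (Fin n₀) F) (d n : ℕ) : 0 ≤ badN n₀ g d n := Nat.cast_nonneg _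

theorem bad_pp (n₀ : ℕ) (hn₀ : 0 < n₀) (g : GL (Fin n₀) F) (ℓ a : ℕ) (hℓ : ℓ.Prime)
    (hc : Nat.Coprime (Fintype.card F) ℓ) :
    Tendsto (fun n => badN n₀ g (ℓ ^ a) n / (Fintype.card (Ch F (n₀ + n)) : ℝ)) atTop (nhds 0) := by
  have he : 0 < ℓ.totient := Nat.totient_pos.2 hℓ.pos
  set e := ℓ.totient with hed
  set κ := (TT F (2 * e)).card with hκd
  have hκ : 0 < κ := by
    apply Finset.card_pos.2
    obtain ⟨δ⟩ := chNonempty (F := F) 0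
    exact ⟨⟨0, δ⟩, mem_TT.2 (Nat.zero_le _)⟩
  set M := 4 * e * κ with hM
  have hMp : 0 < M := by positivity
  have hq2 : (2 : ℝ) ≤ Fintype.card F := by exact_mod_cast (Fintype.one_lt_card (α := F))
  set q : ℝ := ((Fintype.card F : ℕ) : ℝ) with hqd
  obtain ⟨r, hr1, hrM⟩ : ∃ r : ℝ, 1 < r ∧ r ^ M < 1.04 := by
    have h1 : ∀ᶠ r : ℝ in nhds 1, r ^ M < 1.04 := by
      refine ((continuous_pow M).tendsto (1 : ℝ)).eventually_lt_const ?_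
      rw [one_pow]; norm_num
    obtain ⟨r, h2, h3⟩ := ((h1.filter_mono nhdsWithin_le_nhds : ∀ᶠ r : ℝ in nhdsWithin 1 (Set.Ioi 1), r ^ M < 1.04).and
      self_mem_nhdsWithin).exists
    exact ⟨r, h3, h2⟩
  obtain ⟨C, hC0, hC⟩ := ch_upper (F := F) (q * r) (by rw [← hqd]; nlinarith)
  obtain ⟨K, hK⟩ := pv_cl (F := F) ℓ hℓ hc n₀
  have hadd : Tendsto (fun n : ℕ => n₀ + n) atTop atTop := tendsto_atTop_mono (fun n => Nat.le_add_left n n₀) tendsto_id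
  have hsmall := hadd.eventually (log_small (4 * e * n₀) (4 * e * (n₀ * K + a)))
  have hlim : Tendsto (fun n : ℕ => (16 * κ * C * r ^ M) * (0.95 * r ^ M) ^ ((n₀ + n) / M)) atTop (nhds 0) := by
    have h1 : Tendsto (fun n : ℕ => (n₀ + n) / M) atTop atTop := (Nat.tendsto_div_const_atTop hMp.ne').comp hadd
    have h2 : Tendsto (fun k : ℕ => (0.95 * r ^ M) ^ k) atTop (nhds 0) :=
      tendsto_pow_atTop_nhds_zero_of_lt_one (by positivity) (by linarith)
    simpa using (h2.comp h1).const_mul (16 * κ * C * r ^ M)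
  refine squeeze_zero' (Eventually.of_forall fun n => div_nonneg (badN_nonneg _ _ _ _) (Nat.cast_nonneg _)) ?_ hlim
  filter_upwards [hsmall] with n hn
  have hNpos : 0 < n₀ + n := by omega
  have hlow := ch_lower (F := F) (n₀ + n) hNpos
  rw [← hqd] at hlow
  set N := n₀ + n with hN
  have hqN : 0 < q ^ N := by positivity
  set b := n₀ * (K + Nat.log 2 N) + a with hb
  have hbc := bad_count (F := F) ℓ e hℓ.ne_zero he (tot_dvd ℓ _ hc) (q * r) C (by nlinarith) hC N b hNpos (by
    calc 4 * e * b = 4 * e * n₀ * Nat.log 2 N + 4 * e * (n₀ * K + a) := by rw [hb]; ring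
      _ ≤ N := hn)
  have hle : badN n₀ g (ℓ ^ a) n ≤ (Nat.card {χ : Ch F N // ¬ IsIntegral ℤ (χ.1 1 / (ℓ : ℂ) ^ b)} : ℝ) := by
    unfold badN
    rw [Nat.cast_le]
    refine Nat.card_le_card_of_injective (Subtype.map id ?_) (Subtype.map_injective _ Function.injective_id)
    intro χ hχ h1
    exact hχ (dvd_of_deg χ.2 _ ℓ a b hℓ (Nat.add_le_add_right (hK n g) a) h1)
  rw [← hκd, ← hM] at hbc
  have hcp : 0 < (Fintype.card (Ch F N) : ℝ) := by linarith [half_pos hqN]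
  rw [div_le_iff₀ hcp]
  refine (hle.trans hbc).trans ?_
  have hr0 : 0 < r := by linarith
  have hrN : r ^ N ≤ r ^ M * (r ^ M) ^ (N / M) := by
    rw [← pow_mul, ← pow_add]
    apply pow_le_pow_right₀ hr1.le
    have := Nat.div_add_mod N M
    have := Nat.mod_lt N hMp
    omega
  have hX : 0 < 16 * κ * C * r ^ M * (0.95 * r ^ M) ^ (N / M) := by positivity
  calc (κ : ℝ) * (8 * C * (q * r) ^ N * 0.95 ^ (N / M))
      = (8 * κ * C * q ^ N * 0.95 ^ (N / M)) * r ^ N := by rw [mul_pow]; ring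
    _ ≤ (8 * κ * C * q ^ N * 0.95 ^ (N / M)) * (r ^ M * (r ^ M) ^ (N / M)) :=
        mul_le_mul_of_nonneg_left hrN (by positivity)
    _ = (16 * κ * C * r ^ M * (0.95 * r ^ M) ^ (N / M)) * (q ^ N / 2) := by rw [mul_pow]; ring
    _ ≤ _ := mul_le_mul_of_nonneg_left hlow hX.le

theorem bad_zero (n₀ : ℕ) (hn₀ : 0 < n₀) (g : GL (Fin n₀) F) (d : ℕ) : 0 < d → Nat.Coprime d (Fintype.card F) →
    Tendsto (fun n => badN n₀ g d n / (Fintype.card (Ch F (n₀ + n)) : ℝ)) atTop (nhds 0) := by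
  induction d using Nat.recOnPosPrimePosCoprime with
  | prime_pow ℓ a hℓ ha =>
    intro _ hc
    exact bad_pp n₀ hn₀ g ℓ a hℓ ((Nat.coprime_pow_left_iff ha _ _).1 hc).symm
  | zero => intro h; omega
  | one =>
    intro _ _
    have h0 : ∀ n, badN n₀ g 1 n = 0 := by
      intro n
      unfold badN
      rw [Nat.cast_eq_zero, Nat.card_eq_zero]
      left
      refine ⟨?_⟩
      rintro ⟨χ, hχ⟩
      apply hχ
      rw [Nat.cast_one, div_one]
      exact χ.2.integral _
    simp only [h0, zero_div]
    exact tendsto_const_nhds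
  | coprime a b ha hb hab iha ihb =>
    intro _ hc
    have h1 := iha (by omega) (Nat.Coprime.coprime_mul_right hc)
    have h2 := ihb (by omega) (Nat.Coprime.coprime_mul_left hc)
    have h3 := h1.add h2
    rw [add_zero] at h3
    refine squeeze_zero (fun n => div_nonneg (badN_nonneg _ _ _ _) (Nat.cast_nonneg _)) (fun n => ?_) h3
    rw [← add_div]
    apply div_le_div_of_nonneg_right _ (Nat.cast_nonneg _)
    classical
    unfold badN
    rw [← Nat.cast_add, Nat.cast_le, Nat.card_eq_fintype_card, Nat.card_eq_fintype_card, Nat.card_eq_fintype_card,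
      Fintype.card_subtype, Fintype.card_subtype, Fintype.card_subtype]
    refine (Finset.card_le_card ?_).trans (Finset.card_union_le _ _)
    intro χ hχ
    simp only [Finset.mem_union, Finset.mem_filter, Finset.mem_univ, true_and] at hχ ⊢
    by_contra hcon
    push Not at hcon
    exact hχ (bez2 _ a b (by omega) (by omega) hab hcon.1 hcon.2)
end PartE5
theorem divisibility_of_character_values
    (q : ℕ) (hq : IsPrimePow q)
    (F : Type) [Field F] [Fintype F] (hFq : Fintype.card F = q)
    (d : ℕ) (hd : 0 < d) (hdq : Nat.Coprime d q)
    (n₀ : ℕ) (hn₀ : 0 < n₀) (g : GL (Fin n₀) F) :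
    Filter.Tendsto
      (fun n : ℕ =>
        (Nat.card {χ : GL (Fin (n₀ + n)) F → ℂ //
            IsIrrChar _ χ ∧ NatDvdAlg d (χ (glEmbed (Nat.le_add_right n₀ n) g))} : ℝ) /
          (Nat.card {χ : GL (Fin (n₀ + n)) F → ℂ // IsIrrChar _ χ} : ℝ))
      Filter.atTop (nhds 1) := by
  classical
  subst hFq
  have h1 := (bad_zero n₀ hn₀ g d hd hdq).const_sub 1
  rw [sub_zero] at h1
  refine h1.congr fun n => ?_
  have hpos : 0 < Nat.card (Ch F (n₀ + n)) := by
    haveI := chNonempty (F := F) (n₀ + n)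
    exact Nat.card_pos
  have hpos' : (Nat.card (Ch F (n₀ + n)) : ℝ) ≠ 0 := Nat.cast_ne_zero.2 hpos.ne'
  have e1 : Nat.card {χ : GL (Fin (n₀ + n)) F → ℂ //
      IsIrrChar _ χ ∧ NatDvdAlg d (χ (glEmbed (Nat.le_add_right n₀ n) g))} =
      Nat.card {χ : Ch F (n₀ + n) // IsIntegral ℤ (χ.1 (glEmbed (Nat.le_add_right n₀ n) g) / (d : ℂ))} :=
    Nat.card_congr (Equiv.subtypeSubtypeEquivSubtypeInter (fun χ => IsIrrChar (GL (Fin (n₀ + n)) F) χ)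
      (fun χ => NatDvdAlg d (χ (glEmbed (Nat.le_add_right n₀ n) g)))).symm
  have e2 : Nat.card {χ : Ch F (n₀ + n) // IsIntegral ℤ (χ.1 (glEmbed (Nat.le_add_right n₀ n) g) / (d : ℂ))} +
      Nat.card {χ : Ch F (n₀ + n) // ¬ IsIntegral ℤ (χ.1 (glEmbed (Nat.le_add_right n₀ n) g) / (d : ℂ))} =
      Nat.card (Ch F (n₀ + n)) := by
    rw [← Nat.card_sum]
    exact Nat.card_congr (Equiv.sumCompl _)
  have e3 : (Nat.card {χ : Ch F (n₀ + n) // IsIntegral ℤ (χ.1 (glEmbed (Nat.le_add_right n₀ n) g) / (d : ℂ))} : ℝ) +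
      badN n₀ g d n = Nat.card (Ch F (n₀ + n)) := by
    unfold badN
    exact_mod_cast e2
  change _ = _ / (Nat.card (Ch F (n₀ + n)) : ℝ)
  rw [e1, ← Nat.card_eq_fintype_card, eq_div_iff hpos', sub_mul, div_mul_cancel₀ _ hpos']
  linarith
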